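/- arXiv:2210.07854 — 3 statements merged into one kernel-verified Lean document; each statement's English description precedes it below -/
import Mathlib

section
/- Let k ∈ ℂ with Re(k) > 0 and δ > 0. Let f : ℚ → ℂ satisfy weak periodicity (f(x+1) = f(x) for all x ∈ ℚ\[−1,0]) and the reciprocity relation f(x) − |x|^{−k}·f(−1/x) = h(x) for all x ∈ ℚ\{0}, where |h(x)| ≤ C·exp(|x|^{−1+δ}) for all x ∈ (−1,1)\{0}. Assume h is not identically zero on [−1,1]\{0} and that either (i) h extends to a continuous function on [−1,1]; or (ii) h(x) ~ c₀·x^{−λ} as x → 0⁺ for some c₀ ∈ ℂ\{0} and some λ ∈ ℝ with λ > 0 and λ ≠ k. Let f‡ be the function defined on a full-measure set X ⊆ ℝ by f‡(x) := lim_{j→∞} den(x_{2j+1})^{−k}·f( (x_{2j+1})‾ ) along the odd-index continued-fraction convergents of x. Then the pushforward of Lebesgue measure on [0,1] under f‡ is diffuse: for every c ∈ ℂ, the set {x ∈ [0,1] ∩ X : f‡(x) = c} has Lebesgue measure zero. -/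
open Filter Topology MeasureTheory Set

/-- Partial quotients of the regular continued fraction expansion of `x`
(with the convention that `cfb j x = 0` for `j` beyond the length of the expansion). -/
noncomputable def cfb : ℕ → ℝ → ℤ
  | 0, x => ⌊x⌋
  | n + 1, x => cfb n (Int.fract x)⁻¹

/-- Numerators and denominators of the continued fraction convergents of `x`. -/
noncomputable def cfPQ (x : ℝ) : ℕ → ℤ × ℤ
  | 0 => (cfb 0 x, 1)
  | 1 => (cfb 1 x * cfb 0 x + 1, cfb 1 x)
  | n + 2 => (cfb (n + 2) x * (cfPQ x (n + 1)).1 + (cfPQ x n).1,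
              cfb (n + 2) x * (cfPQ x (n + 1)).2 + (cfPQ x n).2)

/-- The `n`-th continued fraction convergent of `x`, as a rational number. -/
noncomputable def cfConv (x : ℝ) (n : ℕ) : ℚ := ((cfPQ x n).1 : ℚ) / ((cfPQ x n).2 : ℚ)

/-- For a rational `y = a/q` in lowest terms, `ratBar y = ā/q` where `ā ∈ {1,…,q}` is
the multiplicative inverse of `a` modulo `q` (and `ā = 1` when `q = 1`). -/
def ratBar (y : ℚ) : ℚ :=
  (if ((y.num : ZMod y.den)⁻¹).val = 0 then (y.den : ℚ)
   else (((y.num : ZMod y.den)⁻¹).val : ℚ)) / (y.den : ℚ)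

/-- The Gauss map `x ↦ {1/x}`. -/
noncomputable def gaussMap (x : ℝ) : ℝ := Int.fract x⁻¹

/-- The inverse branch `t ↦ [0; d₁, …, d_m + t]` attached to a list of digits. -/
noncomputable def cfBranch : List ℤ → ℝ → ℝ
  | [], t => t
  | d :: w, t => ((d : ℝ) + cfBranch w t)⁻¹

/-- The first `n` continued fraction digits of a point of the unit interval. -/
noncomputable def cfDigits : ℕ → ℝ → List ℤ
  | 0, _ => []
  | n + 1, x => ⌊x⁻¹⌋ :: cfDigits n (gaussMap x)

/-- Irrational points of the open unit interval. -/
def irrUnit : Set ℝ := {x | x ∈ Ioo (0 : ℝ) 1 ∧ Irrational x}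

theorem gaussMap_mem_irrUnit {x : ℝ} (hx : x ∈ irrUnit) : gaussMap x ∈ irrUnit := by
  obtain ⟨_, hirr⟩ := hx
  have h1 : Irrational (gaussMap x) := by
    unfold gaussMap Int.fract
    exact (irrational_inv_iff.2 hirr).sub_intCast _
  refine ⟨⟨lt_of_le_of_ne (Int.fract_nonneg _) ?_, Int.fract_lt_one _⟩, h1⟩
  exact (h1.ne_zero).symm

theorem iterate_gaussMap_mem_irrUnit {x : ℝ} (hx : x ∈ irrUnit) (n : ℕ) :
    gaussMap^[n] x ∈ irrUnit := by
  induction n generalizing x with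
  | zero => exact hx
  | succ n ih => exact ih (gaussMap_mem_irrUnit hx)

theorem one_le_floor_inv {x : ℝ} (hx : x ∈ irrUnit) : 1 ≤ ⌊x⁻¹⌋ := by
  rw [Int.le_floor]
  simpa using (one_le_inv₀ hx.1.1).2 hx.1.2.le

theorem length_cfDigits (n : ℕ) (x : ℝ) : (cfDigits n x).length = n := by
  induction n generalizing x with
  | zero => rfl
  | succ n ih => simp [cfDigits, ih]

theorem one_le_of_mem_cfDigits {n : ℕ} {x : ℝ} (hx : x ∈ irrUnit) :
    ∀ d ∈ cfDigits n x, 1 ≤ d := by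
  induction n generalizing x with
  | zero => simp [cfDigits]
  | succ n ih =>
    intro d hd
    rcases List.mem_cons.1 hd with rfl | hd
    · exact one_le_floor_inv hx
    · exact ih (gaussMap_mem_irrUnit hx) d hd

theorem cfDigits_add (m n : ℕ) (x : ℝ) :
    cfDigits (m + n) x = cfDigits m x ++ cfDigits n (gaussMap^[m] x) := by
  induction m generalizing x with
  | zero => simp [cfDigits]
  | succ m ih =>
    rw [Nat.succ_add]
    simp [cfDigits, ih]

theorem cfBranch_cfDigits (n : ℕ) (x : ℝ) :
    cfBranch (cfDigits n x) (gaussMap^[n] x) = x := by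
  induction n generalizing x with
  | zero => rfl
  | succ n ih =>
    simp only [cfDigits, cfBranch, Function.iterate_succ, Function.comp, ih]
    rw [gaussMap, Int.floor_add_fract, inv_inv]

theorem cfBranch_append (v w : List ℤ) (t : ℝ) :
    cfBranch (v ++ w) t = cfBranch v (cfBranch w t) := by
  induction v with
  | nil => rfl
  | cons d v ih => simp [cfBranch, ih]

theorem cfBranch_mem_irrUnit {w : List ℤ} (hw : ∀ d ∈ w, 1 ≤ d) {t : ℝ} (ht : t ∈ irrUnit) :
    cfBranch w t ∈ irrUnit := by
  induction w with
  | nil => exact ht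
  | cons d w ih =>
    obtain ⟨⟨h0, h1⟩, hirr⟩ := ih fun e he => hw e (List.mem_cons_of_mem _ he)
    have hd : (1 : ℝ) ≤ d := by exact_mod_cast hw d List.mem_cons_self
    refine ⟨⟨by simp only [cfBranch]; positivity, ?_⟩, ?_⟩
    · exact inv_lt_one_of_one_lt₀ (by linarith)
    · exact irrational_inv_iff.2 (hirr.intCast_add d)

theorem cfDigits_gaussMap_cfBranch {w : List ℤ} (hw : ∀ d ∈ w, 1 ≤ d) {t : ℝ}
    (ht : t ∈ irrUnit) :
    cfDigits w.length (cfBranch w t) = w ∧ gaussMap^[w.length] (cfBranch w t) = t := by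
  induction w with
  | nil => exact ⟨rfl, rfl⟩
  | cons d w ih =>
    have hw' : ∀ d ∈ w, 1 ≤ d := fun e he => hw e (List.mem_cons_of_mem _ he)
    obtain ⟨⟨h0, h1⟩, -⟩ := cfBranch_mem_irrUnit hw' ht
    have hfl : ⌊(cfBranch (d :: w) t)⁻¹⌋ = d := by
      rw [cfBranch, inv_inv, Int.floor_intCast_add, Int.floor_eq_zero_iff.2 ⟨h0.le, h1⟩, add_zero]
    have hg : gaussMap (cfBranch (d :: w) t) = cfBranch w t := by
      rw [gaussMap, cfBranch, inv_inv, Int.fract_intCast_add, Int.fract_eq_self.2 ⟨h0.le, h1⟩]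
    obtain ⟨e1, e2⟩ := ih hw'
    refine ⟨?_, ?_⟩
    · rw [List.length_cons, cfDigits, hfl, hg, e1]
    · rw [List.length_cons, Function.iterate_succ_apply, hg, e2]

theorem cfBranch_mem_Icc {w : List ℤ} (hw : ∀ d ∈ w, 1 ≤ d) {t : ℝ} (ht : t ∈ Icc (0 : ℝ) 1) :
    cfBranch w t ∈ Icc (0 : ℝ) 1 := by
  induction w with
  | nil => exact ht
  | cons d w ih =>
    obtain ⟨h0, h1⟩ := ih fun e he => hw e (List.mem_cons_of_mem _ he)
    have hd : (1 : ℝ) ≤ d := by exact_mod_cast hw d List.mem_cons_self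
    exact ⟨by simp only [cfBranch]; positivity, inv_le_one_of_one_le₀ (by linarith)⟩

/-- A branch of length `n` maps the unit interval to an interval of length at most `1/(n+1)`. -/
theorem abs_cfBranch_sub_le {w : List ℤ} (hw : ∀ d ∈ w, 1 ≤ d) {s t : ℝ}
    (hs : s ∈ Icc (0 : ℝ) 1) (ht : t ∈ Icc (0 : ℝ) 1) :
    |cfBranch w s - cfBranch w t| ≤ 1 / (w.length + 1) := by
  induction w with
  | nil =>
    simp only [cfBranch, List.length_nil, abs_le]
    constructor <;> norm_num <;> linarith [hs.1, hs.2, ht.1, ht.2]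
  | cons d w ih =>
    have hw' : ∀ d ∈ w, 1 ≤ d := fun e he => hw e (List.mem_cons_of_mem _ he)
    obtain ⟨a0, -⟩ := cfBranch_mem_Icc hw' hs
    obtain ⟨b0, -⟩ := cfBranch_mem_Icc hw' ht
    have hd : (1 : ℝ) ≤ d := by exact_mod_cast hw d List.mem_cons_self
    have ih := ih hw'
    simp only [cfBranch, List.length_cons]
    set a := cfBranch w s
    set b := cfBranch w t
    have key : |a - b| ≤ (w.length + 1 : ℝ)⁻¹ := by simpa using ih
    have hab : 1 + |a - b| ≤ (d + a) * (d + b) := by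
      rcases abs_cases (a - b) with ⟨h, _⟩ | ⟨h, _⟩ <;> rw [h] <;> nlinarith [mul_nonneg a0 b0]
    have hpos : (0 : ℝ) < (d + a) * (d + b) := by positivity
    have e : ((d : ℝ) + a)⁻¹ - ((d : ℝ) + b)⁻¹ = (b - a) / ((d + a) * (d + b)) := by
      have : (d : ℝ) + a ≠ 0 := by positivity
      have : (d : ℝ) + b ≠ 0 := by positivity
      field_simp
      ring
    rw [e, abs_div, abs_of_pos hpos, abs_sub_comm, div_le_div_iff₀ hpos (by positivity)]
    push_cast
    have hn : (0 : ℝ) < (w.length : ℝ) + 1 := by positivity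
    have : |a - b| * (w.length + 1) ≤ 1 := by
      calc _ ≤ (w.length + 1 : ℝ)⁻¹ * (w.length + 1) := by gcongr
        _ = 1 := inv_mul_cancel₀ hn.ne'
    linarith

/-- Möbius form of a branch. -/
theorem exists_cfBranch_eq_div {w : List ℤ} (hw : ∀ d ∈ w, 1 ≤ d) :
    ∃ p p' q q' ε : ℝ, 0 ≤ p ∧ 0 ≤ p' ∧ 0 < q ∧ 0 ≤ q' ∧ q' ≤ q ∧ p' + q' ≤ p + q ∧
      |ε| = 1 ∧ p' * q - p * q' = ε ∧
      ∀ t ∈ Icc (0 : ℝ) 1, cfBranch w t = (p + p' * t) / (q + q' * t) := by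
  induction w with
  | nil => exact ⟨0, 1, 1, 0, 1, by norm_num, by norm_num, by norm_num, by norm_num, by norm_num,
      by norm_num, by norm_num, by norm_num, fun t _ => by simp [cfBranch]⟩
  | cons d w ih =>
    obtain ⟨p, p', q, q', ε, hp, hp', hq, hq', hle, hsum, hε, hdet, hform⟩ :=
      ih fun e he => hw e (List.mem_cons_of_mem _ he)
    have hd : (1 : ℝ) ≤ d := by exact_mod_cast hw d List.mem_cons_self
    refine ⟨q, q', d * q + p, d * q' + p', -ε, hq.le, hq', by positivity, by positivity, ?_, ?_,
      by rw [abs_neg, hε], by rw [← hdet]; ring, fun t ht => ?_⟩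
    · nlinarith
    · nlinarith
    · have h1 : 0 < q + q' * t := by have := mul_nonneg hq' ht.1; linarith
      rw [cfBranch, hform t ht, inv_eq_one_div]
      have h2 : (d : ℝ) + (p + p' * t) / (q + q' * t)
          = (d * q + p + (d * q' + p') * t) / (q + q' * t) := by
        rw [eq_div_iff h1.ne', add_mul, div_mul_cancel₀ _ h1.ne']
        ring
      rw [h2, one_div_div]

/-- Bounded distortion of branches. -/
theorem abs_sub_mul_le_cfBranch {w : List ℤ} (hw : ∀ d ∈ w, 1 ≤ d) :
    0 < |cfBranch w 1 - cfBranch w 0| ∧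
    (∀ t ∈ Icc (0 : ℝ) 1, cfBranch w t ∈ uIcc (cfBranch w 0) (cfBranch w 1)) ∧
    ∀ s ∈ Icc (0 : ℝ) 1, ∀ t ∈ Icc (0 : ℝ) 1,
      |cfBranch w 1 - cfBranch w 0| * |s - t| ≤ 2 * |cfBranch w s - cfBranch w t| := by
  obtain ⟨p, p', q, q', ε, hp, hp', hq, hq', hle, hsum, hε, hdet, hform⟩ :=
    exists_cfBranch_eq_div hw
  have hD : ∀ t ∈ Icc (0 : ℝ) 1, 0 < q + q' * t := fun t ht => by
    have := mul_nonneg hq' ht.1; linarith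
  have hdiff : ∀ s ∈ Icc (0 : ℝ) 1, ∀ t ∈ Icc (0 : ℝ) 1,
      cfBranch w s - cfBranch w t = ε * (s - t) / ((q + q' * s) * (q + q' * t)) := by
    intro s hs t ht
    have h1 := (hD s hs).ne'
    have h2 := (hD t ht).ne'
    rw [hform s hs, hform t ht, ← hdet, div_sub_div _ _ h1 h2]
    congr 1
    ring
  have habs : ∀ s ∈ Icc (0 : ℝ) 1, ∀ t ∈ Icc (0 : ℝ) 1,
      |cfBranch w s - cfBranch w t| = |s - t| / ((q + q' * s) * (q + q' * t)) := by
    intro s hs t ht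
    rw [hdiff s hs t ht, abs_div, abs_mul, hε, one_mul,
      abs_of_pos (mul_pos (hD s hs) (hD t ht))]
  have m0 : (0 : ℝ) ∈ Icc (0 : ℝ) 1 := by simp
  have m1 : (1 : ℝ) ∈ Icc (0 : ℝ) 1 := by simp
  have hlen : |cfBranch w 1 - cfBranch w 0| = 1 / ((q + q') * q) := by
    rw [habs 1 m1 0 m0]; simp
  refine ⟨by rw [hlen]; positivity, fun t ht => ?_, fun s hs t ht => ?_⟩
  · have a1 := hdiff t ht 0 m0
    have a2 := hdiff 1 m1 t ht
    have c1 : 0 ≤ (t - 0) / ((q + q' * t) * (q + q' * 0)) :=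
      div_nonneg (by linarith [ht.1]) (mul_pos (hD t ht) (hD 0 m0)).le
    have c2 : 0 ≤ (1 - t) / ((q + q' * 1) * (q + q' * t)) :=
      div_nonneg (by linarith [ht.2]) (mul_pos (hD 1 m1) (hD t ht)).le
    rw [mul_div_assoc] at a1 a2
    rw [mem_uIcc]
    rcases (abs_eq zero_le_one).1 hε with h | h <;> rw [h] at a1 a2
    · left; constructor <;> linarith
    · right; constructor <;> linarith
  · rw [hlen, habs s hs t ht, div_mul_eq_mul_div, one_mul, ← mul_div_assoc]
    have hs' : q + q' * s ≤ q + q' := by nlinarith [hs.2]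
    have ht' : q + q' * t ≤ 2 * q := by nlinarith [ht.2]
    rw [div_le_div_iff₀ (by positivity) (mul_pos (hD s hs) (hD t ht))]
    have := mul_le_mul hs' ht' (hD t ht).le (by positivity)
    nlinarith [mul_le_mul_of_nonneg_left this (abs_nonneg (s - t))]

theorem measurableSet_cfBranch_image {w : List ℤ} (hw : ∀ d ∈ w, 1 ≤ d) {A : Set ℝ}
    (hA : MeasurableSet A) (hA1 : A ⊆ Icc 0 1) : MeasurableSet (cfBranch w '' A) := by
  obtain ⟨hpos, -, hdist⟩ := abs_sub_mul_le_cfBranch hw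
  refine hA.image_of_continuousOn_injOn ?_ ?_
  · refine ContinuousOn.mono ?_ hA1
    clear hpos hdist
    induction w with
    | nil => exact continuousOn_id
    | cons d w ih =>
      have hw' : ∀ d ∈ w, 1 ≤ d := fun e he => hw e (List.mem_cons_of_mem _ he)
      have hd : (1 : ℝ) ≤ d := by exact_mod_cast hw d List.mem_cons_self
      refine ContinuousOn.inv₀ (continuousOn_const.add (ih hw')) fun t ht => ?_
      have := (cfBranch_mem_Icc hw' ht).1
      positivity
  · intro s hs t ht hst
    have := hdist s (hA1 hs) t (hA1 ht)
    rw [hst, sub_self, abs_zero, mul_zero] at this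
    have h0 : |s - t| = 0 := by
      refine le_antisymm ?_ (abs_nonneg _)
      by_contra hlt
      push Not at hlt
      exact absurd (mul_pos hpos hlt) (not_lt.2 this)
    exact sub_eq_zero.1 (abs_eq_zero.1 h0)

theorem volume_cfBranch_image_ge {w : List ℤ} (hw : ∀ d ∈ w, 1 ≤ d) {A : Set ℝ}
    (hA1 : A ⊆ Icc 0 1) :
    ENNReal.ofReal |cfBranch w 1 - cfBranch w 0| * volume A ≤ 2 * volume (cfBranch w '' A) := by
  obtain ⟨hpos, -, hdist⟩ := abs_sub_mul_le_cfBranch hw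
  set L := |cfBranch w 1 - cfBranch w 0| with hL
  have hanti : ∀ s ∈ A, ∀ t ∈ A, |s - t| ≤ 2 / L * |cfBranch w s - cfBranch w t| := by
    intro s hs t ht
    have := hdist s (hA1 hs) t (hA1 ht)
    rw [div_mul_eq_mul_div, le_div_iff₀ hpos]
    linarith
  have hinj : InjOn (cfBranch w) A := by
    intro s hs t ht hst
    have := hanti s hs t ht
    rw [hst, sub_self, abs_zero, mul_zero] at this
    exact sub_eq_zero.1 (abs_eq_zero.1 (le_antisymm this (abs_nonneg _)))
  have hlip : LipschitzOnWith (2 / L).toNNReal (Function.invFunOn (cfBranch w) A)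
      (cfBranch w '' A) := by
    refine LipschitzOnWith.of_dist_le_mul ?_
    rintro _ ⟨s, hs, rfl⟩ _ ⟨t, ht, rfl⟩
    rw [hinj.leftInvOn_invFunOn hs, hinj.leftInvOn_invFunOn ht, Real.dist_eq, Real.dist_eq,
      Real.coe_toNNReal _ (by positivity)]
    exact hanti s hs t ht
  have := hlip.hausdorffMeasure_image_le zero_le_one
  rw [hinj.leftInvOn_invFunOn.image_image, hausdorffMeasure_real, ENNReal.rpow_one] at this
  calc ENNReal.ofReal L * volume A
      ≤ ENNReal.ofReal L * (ENNReal.ofReal (2 / L) * volume (cfBranch w '' A)) := by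
        gcongr
        exact this
    _ = 2 * volume (cfBranch w '' A) := by
        rw [← mul_assoc, ← ENNReal.ofReal_mul hpos.le, mul_div_cancel₀ _ hpos.ne']
        simp

/-- Lebesgue density along cylinders: every cylinder neighbourhood of a density point of `E`
meets `E` in any prescribed piece of positive measure, as soon as it is deep enough. -/
theorem exists_forall_eventually_cfBranch_mem {E : Set ℝ} (hE : volume E ≠ 0)
    (hEU : E ⊆ irrUnit) :
    ∃ x ∈ irrUnit, ∀ A : Set ℝ, MeasurableSet A → A ⊆ Icc 0 1 → volume A ≠ 0 →
      ∀ᶠ m in atTop, ∃ t ∈ A, cfBranch (cfDigits m x) t ∈ E := by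
  obtain ⟨x, hxE, hx⟩ := Measure.exists_mem_of_measure_ne_zero_of_ae hE
    (IsUnifLocDoublingMeasure.ae_tendsto_measure_inter_div (volume : Measure ℝ) E 1)
  have hxU := hEU hxE
  refine ⟨x, hxU, fun A hA hA1 hA0 => ?_⟩
  have hw : ∀ m, ∀ d ∈ cfDigits m x, 1 ≤ d := fun m => one_le_of_mem_cfDigits hxU
  set a : ℕ → ℝ := fun m => cfBranch (cfDigits m x) 0 with ha
  set b : ℕ → ℝ := fun m => cfBranch (cfDigits m x) 1 with hb
  have hball : ∀ m, Metric.closedBall ((a m + b m) / 2) (|b m - a m| / 2) = uIcc (a m) (b m) := by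
    intro m
    ext y
    rw [Metric.mem_closedBall, Real.dist_eq, mem_uIcc, abs_le]
    rcases abs_cases (b m - a m) with ⟨h, _⟩ | ⟨h, _⟩ <;> rw [h]
    · constructor
      · rintro ⟨_, _⟩; left; constructor <;> linarith
      · rintro (⟨_, _⟩ | ⟨_, _⟩) <;> constructor <;> linarith
    · constructor
      · rintro ⟨_, _⟩; right; constructor <;> linarith
      · rintro (⟨_, _⟩ | ⟨_, _⟩) <;> constructor <;> linarith
  have hvol : ∀ m, volume (uIcc (a m) (b m)) = ENNReal.ofReal |b m - a m| := fun m => by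
    rw [Real.volume_interval]
  have hpos : ∀ m, 0 < |b m - a m| := fun m => (abs_sub_mul_le_cfBranch (hw m)).1
  have hmem : ∀ m, ∀ t ∈ Icc (0 : ℝ) 1, cfBranch (cfDigits m x) t ∈ uIcc (a m) (b m) :=
    fun m => (abs_sub_mul_le_cfBranch (hw m)).2.1
  have hlim : Tendsto (fun m => |b m - a m| / 2) atTop (𝓝[>] 0) := by
    rw [tendsto_nhdsWithin_iff]
    refine ⟨?_, Eventually.of_forall fun m => by have := hpos m; simp only [mem_Ioi]; positivity⟩
    refine squeeze_zero (fun m => by positivity) (fun m => ?_)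
      tendsto_one_div_add_atTop_nhds_zero_nat
    have := abs_cfBranch_sub_le (hw m) (s := 1) (t := 0) (by simp) (by simp)
    rw [length_cfDigits] at this
    exact (half_le_self (abs_nonneg _)).trans this
  have hT := hx (fun m => (a m + b m) / 2) _ hlim (Eventually.of_forall fun m => by
    rw [one_mul, hball]
    have hg := iterate_gaussMap_mem_irrUnit hxU m
    have := hmem m _ (Ioo_subset_Icc_self hg.1)
    rwa [cfBranch_cfDigits] at this)
  simp only [hball, hvol] at hT
  have hAtop : volume A ≠ ⊤ := ((measure_mono hA1).trans_lt (by simp)).ne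
  have hlt : 1 - volume A / 2 < 1 := ENNReal.sub_lt_self ENNReal.one_ne_top one_ne_zero
    (by simpa using hA0)
  filter_upwards [hT.eventually (lt_mem_nhds hlt)] with m hm
  by_contra hcon
  push Not at hcon
  have hL0 : ENNReal.ofReal |b m - a m| ≠ 0 := by simpa using (hpos m)
  have hsub : E ∩ uIcc (a m) (b m) ⊆ uIcc (a m) (b m) \ cfBranch (cfDigits m x) '' A := by
    rintro y ⟨hy, hy'⟩
    refine ⟨hy', ?_⟩
    rintro ⟨t, ht, rfl⟩
    exact hcon t ht hy
  have himg := volume_cfBranch_image_ge (hw m) hA1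
  have hmeas := measurableSet_cfBranch_image (hw m) hA hA1
  have himgsub : cfBranch (cfDigits m x) '' A ⊆ uIcc (a m) (b m) := by
    rintro _ ⟨t, ht, rfl⟩
    exact hmem m t (hA1 ht)
  have h1 : volume (E ∩ uIcc (a m) (b m)) ≤
      ENNReal.ofReal |b m - a m| * (1 - volume A / 2) := by
    calc _ ≤ _ := measure_mono hsub
      _ = ENNReal.ofReal |b m - a m| - volume (cfBranch (cfDigits m x) '' A) := by
        rw [measure_sdiff himgsub hmeas.nullMeasurableSet
          ((measure_mono himgsub).trans_lt (by rw [hvol]; simp)).ne, hvol]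
      _ ≤ ENNReal.ofReal |b m - a m| - ENNReal.ofReal |b m - a m| * (volume A / 2) := by
        gcongr
        rw [← mul_div_assoc]
        exact ENNReal.div_le_of_le_mul' himg
      _ = _ := by rw [ENNReal.mul_sub (fun _ _ => ENNReal.ofReal_ne_top), mul_one]
  have h2 := ENNReal.div_le_of_le_mul' h1
  exact absurd hm (not_lt.2 h2)

/-- The (unnormalised) Gauss measure on the unit interval. -/
noncomputable def gaussMeasure : Measure ℝ :=
  (volume.restrict (Ico 0 1)).withDensity fun x => ENNReal.ofReal (1 + x)⁻¹

theorem measurable_gaussMap : Measurable gaussMap :=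
  measurable_fract.comp measurable_inv

theorem gaussMeasure_apply {A : Set ℝ} (hA : MeasurableSet A) :
    gaussMeasure A = ∫⁻ x in A ∩ Ico 0 1, ENNReal.ofReal (1 + x)⁻¹ := by
  rw [gaussMeasure, withDensity_apply _ hA, Measure.restrict_restrict hA]

theorem hasSum_inv_sub_inv {a : ℝ} (ha : 0 ≤ a) :
    HasSum (fun n : ℕ => ((n : ℝ) + 1 + a)⁻¹ - (((n + 1 : ℕ) : ℝ) + 1 + a)⁻¹) (1 + a)⁻¹ := by
  rw [hasSum_iff_tendsto_nat_of_nonneg]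
  · have : ∀ n : ℕ, ∑ i ∈ Finset.range n,
        (((i : ℝ) + 1 + a)⁻¹ - (((i + 1 : ℕ) : ℝ) + 1 + a)⁻¹) =
        (1 + a)⁻¹ - ((n : ℝ) + 1 + a)⁻¹ := fun n => by
      rw [Finset.sum_range_sub' (fun i : ℕ => ((i : ℝ) + 1 + a)⁻¹)]
      simp
    simp only [this]
    have h2 : Tendsto (fun n : ℕ => ((n : ℝ) + 1 + a)⁻¹) atTop (𝓝 0) :=
      tendsto_inv_atTop_zero.comp (tendsto_atTop_add_const_right _ _
        (tendsto_atTop_add_const_right _ _ tendsto_natCast_atTop_atTop))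
    simpa using (tendsto_const_nhds (x := (1 + a)⁻¹)).sub h2
  · intro n
    rw [sub_nonneg]
    push_cast
    gcongr
    linarith

theorem gaussMeasure_preimage_le {A : Set ℝ} (hA : MeasurableSet A) :
    gaussMeasure (gaussMap ⁻¹' A) ≤ gaussMeasure A := by
  rw [gaussMeasure_apply (measurable_gaussMap hA), gaussMeasure_apply hA]
  set B := A ∩ Ico (0 : ℝ) 1 with hB
  have hBm : MeasurableSet B := hA.inter measurableSet_Ico
  let φ : ℕ → ℝ → ℝ := fun n a => ((n : ℝ) + 1 + a)⁻¹
  have hsub : gaussMap ⁻¹' A ∩ Ico 0 1 ⊆ {0} ∪ ⋃ n, φ n '' B := by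
    rintro x ⟨hxA, hx0, hx1⟩
    rcases hx0.eq_or_lt with rfl | hx0
    · simp
    right
    have hfl : 1 ≤ ⌊x⁻¹⌋ := by
      rw [Int.le_floor]
      simpa using (one_le_inv₀ hx0).2 hx1.le
    obtain ⟨n, hn⟩ := Int.eq_ofNat_of_zero_le (sub_nonneg.2 hfl)
    refine mem_iUnion.2 ⟨n, gaussMap x, ⟨hxA, Int.fract_nonneg _, Int.fract_lt_one _⟩, ?_⟩
    have hn' : (n : ℝ) + 1 = ⌊x⁻¹⌋ := by
      have h1 : (n : ℤ) + 1 = ⌊x⁻¹⌋ := by omega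
      exact_mod_cast h1
    simp only [φ, hn', gaussMap, Int.floor_add_fract, inv_inv]
  have himage : ∀ n, ∫⁻ x in φ n '' B, ENNReal.ofReal (1 + x)⁻¹ =
      ∫⁻ a in B, ENNReal.ofReal (((n : ℝ) + 1 + a)⁻¹ - (((n + 1 : ℕ) : ℝ) + 1 + a)⁻¹) := by
    intro n
    rw [lintegral_image_eq_lintegral_abs_deriv_mul hBm
      (f' := fun a => -1 / ((n : ℝ) + 1 + a) ^ 2)]
    · refine setLIntegral_congr_fun hBm fun a ha => ?_
      have h0 : (0 : ℝ) < (n : ℝ) + 1 + a := by have := ha.2.1; positivity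
      rw [← ENNReal.ofReal_mul (abs_nonneg _), abs_div, abs_neg, abs_one, abs_of_pos (by positivity)]
      congr 1
      simp only [φ]
      push_cast
      have h1 : (0 : ℝ) < (n : ℝ) + 1 + 1 + a := by linarith
      have h2 : 1 + ((n : ℝ) + 1 + a)⁻¹ = ((n : ℝ) + 1 + 1 + a) / ((n : ℝ) + 1 + a) := by
        field_simp
        ring
      rw [h2]
      field_simp
      ring
    · intro a ha
      have h0 : (n : ℝ) + 1 + a ≠ 0 := by have := ha.2.1; positivity
      exact (((hasDerivAt_id a).const_add ((n : ℝ) + 1)).inv h0).hasDerivWithinAt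
    · intro a _ b _ hab
      simpa [φ] using hab
  calc ∫⁻ x in gaussMap ⁻¹' A ∩ Ico 0 1, ENNReal.ofReal (1 + x)⁻¹
      ≤ ∫⁻ x in {0} ∪ ⋃ n, φ n '' B, ENNReal.ofReal (1 + x)⁻¹ := lintegral_mono_set hsub
    _ ≤ (∫⁻ x in ({0} : Set ℝ), ENNReal.ofReal (1 + x)⁻¹) +
        ∫⁻ x in ⋃ n, φ n '' B, ENNReal.ofReal (1 + x)⁻¹ := lintegral_union_le _ _ _
    _ ≤ 0 + ∑' n, ∫⁻ x in φ n '' B, ENNReal.ofReal (1 + x)⁻¹ := by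
        gcongr
        · simp
        · exact lintegral_iUnion_le _ _
    _ = ∫⁻ a in B, ∑' n : ℕ,
          ENNReal.ofReal (((n : ℝ) + 1 + a)⁻¹ - (((n + 1 : ℕ) : ℝ) + 1 + a)⁻¹) := by
        rw [zero_add, lintegral_tsum]
        · simp only [himage]
        · intro n
          fun_prop
    _ = ∫⁻ a in B, ENNReal.ofReal (1 + a)⁻¹ := by
        refine setLIntegral_congr_fun hBm fun a ha => ?_
        have hs := hasSum_inv_sub_inv ha.2.1
        rw [← ENNReal.ofReal_tsum_of_nonneg _ hs.summable, hs.tsum_eq]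
        intro n
        have := ha.2.1
        rw [sub_nonneg]
        push_cast
        gcongr
        linarith

theorem gaussMeasure_iterate_preimage_le {A : Set ℝ} (hA : MeasurableSet A) (n : ℕ) :
    gaussMeasure (gaussMap^[n] ⁻¹' A) ≤ gaussMeasure A := by
  induction n with
  | zero => rfl
  | succ n ih =>
    rw [Function.iterate_succ, preimage_comp]
    exact (gaussMeasure_preimage_le (measurable_gaussMap.iterate n hA)).trans ih

theorem gaussMeasure_le_volume {A : Set ℝ} (hA : MeasurableSet A) :
    gaussMeasure A ≤ volume (A ∩ Ico 0 1) := by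
  rw [gaussMeasure_apply hA]
  calc _ ≤ ∫⁻ _ in A ∩ Ico 0 1, 1 := by
        refine setLIntegral_mono measurable_const fun x hx => ?_
        rw [ENNReal.ofReal_le_one]
        exact inv_le_one_of_one_le₀ (by linarith [hx.2.1])
    _ = _ := by simp

theorem ae_restrict_of_ae_gaussMeasure {p : ℝ → Prop} (h : ∀ᵐ x ∂gaussMeasure, p x) :
    ∀ᵐ x ∂volume.restrict (Ico (0 : ℝ) 1), p x := by
  rw [gaussMeasure, ae_withDensity_iff (by fun_prop)] at h
  filter_upwards [h, ae_restrict_mem measurableSet_Ico] with x hx hx1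
  refine hx ?_
  have := hx1.1
  simp only [ne_eq, ENNReal.ofReal_eq_zero, not_le]
  positivity

/-- Almost every point has digits growing at most like a fixed power of their index. -/
theorem exists_set_digits_le {e c : ℝ} (he0 : 0 < e) (he : e < 1) (hc : 0 < c) :
    ∃ K : ℕ, ∃ G : Set ℝ, MeasurableSet G ∧ G ⊆ irrUnit ∧ volume G ≠ 0 ∧
      ∀ t ∈ G, ∀ j : ℕ, ((⌊(gaussMap^[j] t)⁻¹⌋ : ℝ) + 1) ^ e ≤ c * j + K := by
  have hmeasj : ∀ j : ℕ, Measurable fun t => ((⌊(gaussMap^[j] t)⁻¹⌋ : ℝ) + 1) ^ e := fun j => by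
    have : Measurable fun t : ℝ => ((⌊t⁻¹⌋ : ℤ) : ℝ) :=
      (measurable_from_top (f := fun z : ℤ => (z : ℝ))).comp (Int.measurable_floor.comp measurable_inv)
    exact ((this.comp (measurable_gaussMap.iterate j)).add_const 1).pow_const e
  let B : ℕ → Set ℝ := fun j => {t | c * (j + 1) < ((⌊t⁻¹⌋ : ℝ) + 1) ^ e}
  have hBm : ∀ j, MeasurableSet (B j) := fun j => measurableSet_lt measurable_const (hmeasj 0)
  have hBvol : ∀ j : ℕ, gaussMeasure (B j) ≤
      ENNReal.ofReal (2 * c ^ (-e⁻¹) * (1 / ((j + 1 : ℕ) : ℝ) ^ e⁻¹)) := by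
    intro j
    refine (gaussMeasure_le_volume (hBm j)).trans ?_
    set r := 2 * c ^ (-e⁻¹) * (1 / ((j + 1 : ℕ) : ℝ) ^ e⁻¹) with hr
    have : B j ∩ Ico 0 1 ⊆ Ico 0 r := by
      rintro t ⟨hB, h0, h1⟩
      refine ⟨h0, ?_⟩
      have hjp : (0 : ℝ) < (j + 1 : ℕ) := by positivity
      have hrpos : 0 < r := by positivity
      rcases h0.eq_or_lt with rfl | h0
      · exact hrpos
      have hX : (⌊t⁻¹⌋ : ℝ) + 1 ≤ 2 / t := by
        have := Int.floor_le t⁻¹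
        have h3 : 1 ≤ t⁻¹ := (one_le_inv₀ h0).2 h1.le
        rw [div_eq_mul_inv]
        linarith
      have hfl : (0 : ℝ) ≤ ⌊t⁻¹⌋ := by
        have : 0 ≤ ⌊t⁻¹⌋ := Int.floor_nonneg.2 (by positivity)
        exact_mod_cast this
      have h4 : c * ((j + 1 : ℕ) : ℝ) < (2 / t) ^ e := by
        push_cast
        exact lt_of_lt_of_le hB (Real.rpow_le_rpow (by positivity) hX he0.le)
      have h5 : (c * ((j + 1 : ℕ) : ℝ)) ^ e⁻¹ < 2 / t := by
        have := Real.rpow_lt_rpow (by positivity) h4 (inv_pos.2 he0)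
        rwa [← Real.rpow_mul (by positivity), mul_inv_cancel₀ he0.ne', Real.rpow_one] at this
      rw [Real.mul_rpow hc.le hjp.le] at h5
      rw [hr, Real.rpow_neg hc.le]
      have hc1 : 0 < c ^ e⁻¹ := by positivity
      have hj1 : 0 < ((j + 1 : ℕ) : ℝ) ^ e⁻¹ := by positivity
      rw [lt_div_iff₀ h0] at h5
      have : 2 * (c ^ e⁻¹)⁻¹ * (1 / ((j + 1 : ℕ) : ℝ) ^ e⁻¹) =
        2 / (c ^ e⁻¹ * ((j + 1 : ℕ) : ℝ) ^ e⁻¹) := by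
        field_simp
      rw [this, lt_div_iff₀ (by positivity)]
      linarith
    refine (measure_mono this).trans ?_
    simp
  have hsum : ∑' j : ℕ, gaussMeasure (gaussMap^[j] ⁻¹' B j) ≠ ⊤ := by
    refine ne_top_of_le_ne_top ?_ (ENNReal.tsum_le_tsum fun j =>
      (gaussMeasure_iterate_preimage_le (hBm j) j).trans (hBvol j))
    refine Summable.tsum_ofReal_ne_top ?_
    refine Summable.mul_left _ ?_
    exact (summable_nat_add_iff 1).2 (Real.summable_one_div_nat_rpow.2 ((one_lt_inv₀ he0).2 he))
  have hae := ae_restrict_of_ae_gaussMeasure (ae_eventually_notMem hsum)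
  let G : ℕ → Set ℝ := fun K => {t | t ∈ Ioo (0 : ℝ) 1} ∩ {t | Irrational t} ∩
    ⋂ j : ℕ, {t | ((⌊(gaussMap^[j] t)⁻¹⌋ : ℝ) + 1) ^ e ≤ c * j + K}
  have hirr : MeasurableSet {t : ℝ | Irrational t} :=
    (countable_range ((↑) : ℚ → ℝ)).measurableSet.compl
  have hGm : ∀ K, MeasurableSet (G K) := fun K =>
    ((measurableSet_Ioo).inter hirr).inter
      (MeasurableSet.iInter fun j => measurableSet_le (hmeasj j) measurable_const)
  suffices hex : ∃ K, volume (G K) ≠ 0 by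
    obtain ⟨K, hK⟩ := hex
    exact ⟨K, G K, hGm K, fun t ht => ht.1, hK, fun t ht j => mem_iInter.1 ht.2 j⟩
  by_contra hcon
  push Not at hcon
  have hU : volume (⋃ K, G K) = 0 := measure_iUnion_null hcon
  have hirrae : ∀ᵐ t : ℝ, Irrational t :=
    (countable_range ((↑) : ℚ → ℝ)).ae_notMem _
  rw [← Measure.restrict_congr_set Ioo_ae_eq_Ico] at hae
  have hall : ∀ᵐ t ∂volume.restrict (Ioo (0 : ℝ) 1), t ∈ ⋃ K, G K := by
    filter_upwards [hae, ae_restrict_mem measurableSet_Ioo, ae_restrict_of_ae hirrae]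
      with t ht ht1 ht2
    obtain ⟨N, hN⟩ := eventually_atTop.1 ht
    obtain ⟨K, hK⟩ := exists_nat_ge (c + ∑ j ∈ Finset.range N,
      ((⌊(gaussMap^[j] t)⁻¹⌋ : ℝ) + 1) ^ e)
    have hnn : ∀ j : ℕ, 0 ≤ ((⌊(gaussMap^[j] t)⁻¹⌋ : ℝ) + 1) ^ e := fun j => by
      have := one_le_floor_inv (iterate_gaussMap_mem_irrUnit ⟨ht1, ht2⟩ j)
      have : (1 : ℝ) ≤ ⌊(gaussMap^[j] t)⁻¹⌋ := by exact_mod_cast this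
      positivity
    refine mem_iUnion.2 ⟨K, ⟨ht1, ht2⟩, mem_iInter.2 fun j => ?_⟩
    simp only [mem_ofPred_eq]
    have hcj : 0 ≤ c * j := by positivity
    have hS : 0 ≤ ∑ j ∈ Finset.range N, ((⌊(gaussMap^[j] t)⁻¹⌋ : ℝ) + 1) ^ e :=
      Finset.sum_nonneg fun i _ => hnn i
    rcases lt_or_ge j N with hj | hj
    · have := Finset.single_le_sum (fun i _ => hnn i) (Finset.mem_range.2 hj)
      linarith
    · have := hN j hj
      simp only [mem_preimage, B, mem_ofPred_eq, not_lt] at this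
      linarith
  have h0 : volume (Ioo (0 : ℝ) 1) = 0 := by
    have h1 : volume.restrict (Ioo (0 : ℝ) 1) (⋃ K, G K)ᶜ = 0 := hall
    have h2 : volume.restrict (Ioo (0 : ℝ) 1) (⋃ K, G K) = 0 :=
      le_antisymm ((Measure.restrict_apply_le _ _).trans hU.le) zero_le
    have h3 := measure_union_null h2 h1
    rwa [union_compl_self, Measure.restrict_apply_univ] at h3
  simp at h0

/-- State of the continued fraction algorithm: two consecutive denominators and a sign. -/
def cfStep (s : ℤ × ℤ × ℤ) (d : ℤ) : ℤ × ℤ × ℤ := (d * s.1 + s.2.1, s.1, -s.2.2)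

/-- Admissible states: `1 ≤ q' ≤ q` and the sign is `±1`. -/
def IsCfState (s : ℤ × ℤ × ℤ) : Prop :=
  1 ≤ s.2.1 ∧ s.2.1 ≤ s.1 ∧ (s.2.2 = 1 ∨ s.2.2 = -1)

theorem IsCfState.step {s : ℤ × ℤ × ℤ} (hs : IsCfState s) {d : ℤ} (hd : 1 ≤ d) :
    IsCfState (cfStep s d) := by
  obtain ⟨h1, h2, h3⟩ := hs
  refine ⟨h1.trans h2, ?_, ?_⟩
  · simp only [cfStep]; nlinarith
  · simp only [cfStep]; omega

theorem IsCfState.foldl {s : ℤ × ℤ × ℤ} (hs : IsCfState s) {w : List ℤ}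
    (hw : ∀ d ∈ w, 1 ≤ d) : IsCfState (w.foldl cfStep s) := by
  induction w generalizing s with
  | nil => exact hs
  | cons d w ih =>
    exact ih (hs.step (hw d List.mem_cons_self)) fun e he => hw e (List.mem_cons_of_mem _ he)

/-- The state reached by `x` after `n + 1` digits. -/
noncomputable def cfState (x : ℝ) (n : ℕ) : ℤ × ℤ × ℤ :=
  ((cfPQ x (n + 1)).2, (cfPQ x n).2, (-1) ^ n)

theorem cfb_succ_eq {x : ℝ} (hx : x ∈ irrUnit) (n : ℕ) :
    cfb (n + 1) x = ⌊(gaussMap^[n] x)⁻¹⌋ := by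
  have hfr : ∀ {y : ℝ}, y ∈ irrUnit → Int.fract y = y := fun hy =>
    Int.fract_eq_self.2 ⟨hy.1.1.le, hy.1.2⟩
  induction n generalizing x with
  | zero => simp [cfb, hfr hx]
  | succ n ih =>
    rw [Function.iterate_succ_apply, ← ih (gaussMap_mem_irrUnit hx), cfb, hfr hx, cfb, cfb,
      hfr (gaussMap_mem_irrUnit hx), gaussMap]

theorem cfState_succ (x : ℝ) (n : ℕ) :
    cfState x (n + 1) = cfStep (cfState x n) (cfb (n + 2) x) := by
  simp [cfState, cfStep, cfPQ, pow_succ]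

theorem cfState_eq_foldl {x : ℝ} (hx : x ∈ irrUnit) (n : ℕ) :
    cfState x n = (cfDigits (n + 1) x).foldl cfStep (1, 0, -1) := by
  induction n with
  | zero => simp [cfState, cfStep, cfPQ, cfDigits, cfb_succ_eq hx 0]
  | succ n ih =>
    rw [cfDigits_add (n + 1) 1, List.foldl_append, ← ih, cfState_succ, cfb_succ_eq hx (n + 1)]
    rfl

theorem isCfState_cfState {x : ℝ} (hx : x ∈ irrUnit) (n : ℕ) : IsCfState (cfState x n) := by
  induction n with
  | zero =>
    have h := one_le_floor_inv hx
    refine ⟨le_rfl, ?_, Or.inl rfl⟩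
    have := cfb_succ_eq hx 0
    simp only [cfState, cfPQ, this]
    exact h
  | succ n ih =>
    rw [cfState_succ, cfb_succ_eq hx]
    exact ih.step (one_le_floor_inv (iterate_gaussMap_mem_irrUnit hx _))

theorem cfPQ_det (x : ℝ) (n : ℕ) :
    (cfPQ x (n + 1)).1 * (cfPQ x n).2 - (cfPQ x n).1 * (cfPQ x (n + 1)).2 = (-1) ^ n := by
  induction n with
  | zero => simp [cfPQ]; ring
  | succ n ih =>
    rw [pow_succ, ← ih]
    simp only [cfPQ]
    ring

theorem cfConv_den_and_ratBar {x : ℝ} (hx : x ∈ irrUnit) (j : ℕ) :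
    ((cfConv x (2 * (j + 1) + 1)).den : ℤ) = (cfPQ x (2 * (j + 1) + 1)).2 ∧
    ratBar (cfConv x (2 * (j + 1) + 1)) =
      ((cfPQ x (2 * (j + 1))).2 : ℚ) / ((cfPQ x (2 * (j + 1) + 1)).2 : ℚ) := by
  obtain ⟨hq1, -, -⟩ := isCfState_cfState hx (2 * (j + 1))
  have hlt : (cfPQ x (2 * (j + 1))).2 < (cfPQ x (2 * (j + 1) + 1)).2 := by
    obtain ⟨h1, h2, -⟩ := isCfState_cfState hx (2 * j + 1)
    have h3 : cfState x (2 * (j + 1)) = _ := cfState_succ x (2 * j + 1)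
    have hd : 1 ≤ cfb (2 * j + 1 + 2) x := by
      rw [cfb_succ_eq hx]
      exact one_le_floor_inv (iterate_gaussMap_mem_irrUnit hx _)
    have e1 : (cfPQ x (2 * (j + 1) + 1)).2 =
        cfb (2 * j + 1 + 2) x * (cfState x (2 * j + 1)).1 + (cfState x (2 * j + 1)).2.1 :=
      congrArg Prod.fst h3
    have e2 : (cfPQ x (2 * (j + 1))).2 = (cfState x (2 * j + 1)).1 :=
      congrArg (fun s => s.2.1) h3
    rw [e1, e2]
    nlinarith
  have hdet := cfPQ_det x (2 * (j + 1))
  rw [pow_mul] at hdet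
  norm_num at hdet
  simp only [cfState] at hq1
  unfold cfConv
  set p := (cfPQ x (2 * (j + 1) + 1)).1
  set q := (cfPQ x (2 * (j + 1) + 1)).2
  set p' := (cfPQ x (2 * (j + 1))).1
  set q' := (cfPQ x (2 * (j + 1))).2
  have hq : 0 < q := by omega
  have hcop : Nat.Coprime p.natAbs q.natAbs := by
    rw [← Int.isCoprime_iff_nat_coprime]
    exact ⟨q', -p', by linarith⟩
  have hden := Rat.den_div_eq_of_coprime hq hcop
  have hnum := Rat.num_div_eq_of_coprime hq hcop
  refine ⟨hden, ?_⟩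
  rw [ratBar, hnum]
  set N := ((p : ℚ) / (q : ℚ)).den with hN
  obtain ⟨m, hm⟩ := Int.eq_ofNat_of_zero_le (show 0 ≤ q' by omega)
  have hmN : m < N := by omega
  have hmul : ((p : ℤ) : ZMod N) * (m : ZMod N) = 1 := by
    have h1 : (((p * q' - p' * q : ℤ)) : ZMod N) = 1 := by rw [hdet]; simp
    rw [hm, ← hden] at h1
    simpa using h1
  have hinv : ((p : ℤ) : ZMod N)⁻¹ = (m : ZMod N) := ZMod.inv_eq_of_mul_eq_one N _ _ hmul
  rw [hinv, ZMod.val_natCast_of_lt hmN, if_neg (by omega)]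
  have hqN : (q : ℚ) = (N : ℚ) := by exact_mod_cast hden.symm
  rw [hqN, hm]
  simp

/-- The signed quotient `±q'/q` of a state. -/
def cfRatio (s : ℤ × ℤ × ℤ) : ℚ := s.2.2 * s.2.1 / s.1

theorem IsCfState.fst_pos {s : ℤ × ℤ × ℤ} (hs : IsCfState s) : 0 < s.1 := by
  obtain ⟨h1, h2, -⟩ := hs
  omega

theorem periodic_add_natCast {f : ℚ → ℂ}
    (hper : ∀ x : ℚ, x ∉ Set.Icc (-1 : ℚ) 0 → f (x + 1) = f x) {r : ℚ} (hr : 0 < r) (n : ℕ) :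
    f (r + n) = f r ∧ f (-(r + n)) = f (-r) := by
  induction n with
  | zero => simp
  | succ n ih =>
    have hn : (0 : ℚ) ≤ n := n.cast_nonneg
    constructor
    · rw [← ih.1, ← hper (r + n) fun h => absurd h.2 (by linarith)]
      push_cast
      rw [add_assoc]
    · rw [← ih.2, ← hper (-(r + (n + 1 : ℕ))) fun h => absurd h.1 (by push_cast; linarith)]
      congr 1
      push_cast
      ring

/-- One step of the reciprocity relation along the continued fraction algorithm. -/
theorem reciprocity_step {k : ℂ} {f : ℚ → ℂ} {h : ℝ → ℂ}
    (hper : ∀ x : ℚ, x ∉ Set.Icc (-1 : ℚ) 0 → f (x + 1) = f x)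
    (hrec : ∀ x : ℚ, x ≠ 0 → f x - ((|((x : ℚ) : ℝ)| : ℝ) : ℂ) ^ (-k) * f (-1 / x) = h x)
    {s : ℤ × ℤ × ℤ} (hs : IsCfState s) {d : ℤ} (hd : 1 ≤ d) :
    f (cfRatio (cfStep s d)) = h (cfRatio (cfStep s d)) +
      (((s.1 : ℝ) / ((cfStep s d).1 : ℝ) : ℝ) : ℂ) ^ (-k) * f (cfRatio s) := by
  have hq := hs.fst_pos
  have hQ := (hs.step hd).fst_pos
  obtain ⟨n, hn⟩ := Int.eq_ofNat_of_zero_le (show 0 ≤ d by omega)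
  obtain ⟨q, q', σ⟩ := s
  obtain ⟨h1, h2, hσ⟩ := hs
  simp only [cfStep] at *
  have hq' : (0 : ℚ) < q := by exact_mod_cast hq
  have hQ' : (0 : ℚ) < d * q + q' := by exact_mod_cast hQ
  have hqr : (0 : ℝ) < q := by exact_mod_cast hq
  have hQr : (0 : ℝ) < d * q + q' := by exact_mod_cast hQ
  have hr : (0 : ℚ) < q' / q := div_pos (by exact_mod_cast h1) hq'
  obtain ⟨p1, p2⟩ := periodic_add_natCast hper hr n
  have hdn : (d : ℚ) = n := by exact_mod_cast hn
  have hne : cfRatio (d * q + q', q, -σ) ≠ 0 := by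
    simp only [cfRatio]
    rcases hσ with rfl | rfl <;> push_cast
    · exact div_ne_zero (by linarith) hQ'.ne'
    · exact div_ne_zero (by linarith) hQ'.ne'
  have habs : |((cfRatio (d * q + q', q, -σ) : ℚ) : ℝ)| = (q : ℝ) / ((d * q + q' : ℤ) : ℝ) := by
    simp only [cfRatio]
    push_cast
    rw [abs_div, abs_of_pos hQr, abs_mul, abs_of_pos hqr]
    rcases hσ with rfl | rfl <;> simp
  have hinv : f (-1 / cfRatio (d * q + q', q, -σ)) = f (cfRatio (q, q', σ)) := by
    simp only [cfRatio]
    rcases hσ with rfl | rfl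
    · have e1 : (-1 : ℚ) / (((-1 : ℤ) : ℚ) * q / ((d * q + q' : ℤ) : ℚ)) = q' / q + n := by
        rw [← hdn]
        push_cast
        field_simp
        ring
      rw [e1, p1]
      simp
    · have e1 : (-1 : ℚ) / (((- -1 : ℤ) : ℚ) * q / ((d * q + q' : ℤ) : ℚ)) = -(q' / q + n) := by
        rw [← hdn]
        push_cast
        field_simp
        ring
      rw [e1, p2]
      congr 1
      push_cast
      ring
  have := hrec _ hne
  rw [habs, hinv] at this
  rw [← this]
  ring

theorem div_cpow_mul_cpow {a b : ℝ} (ha : 0 < a) (hb : 0 < b) (z : ℂ) :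
    ((a / b : ℝ) : ℂ) ^ z * (b : ℂ) ^ z = (a : ℂ) ^ z := by
  rw [← Complex.mul_cpow_ofReal_nonneg (by positivity) hb.le, ← Complex.ofReal_mul,
    div_mul_cancel₀ _ hb.ne']

theorem sq_mul_two_pow_le_cfState {x : ℝ} (hx : x ∈ irrUnit) (n i : ℕ) :
    (cfState x n).1 ^ 2 * 2 ^ i ≤ (cfState x (n + i + 1)).1 ^ 2 := by
  have hd : ∀ n, 1 ≤ cfb (n + 1) x := fun n => by
    rw [cfb_succ_eq hx]
    exact one_le_floor_inv (iterate_gaussMap_mem_irrUnit hx _)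
  have hmono : ∀ n, (cfState x n).1 ≤ (cfState x (n + 1)).1 := fun n => by
    obtain ⟨h1, h2, -⟩ := isCfState_cfState hx n
    rw [cfState_succ]
    simp only [cfStep]
    nlinarith [hd (n + 1)]
  have hdouble : ∀ n, 2 * (cfState x n).1 ≤ (cfState x (n + 2)).1 := fun n => by
    obtain ⟨h1, h2, -⟩ := isCfState_cfState hx n
    have h3 := hmono n
    have e : (cfState x (n + 1)).2.1 = (cfState x n).1 := by rw [cfState_succ]; rfl
    rw [cfState_succ x (n + 1)]
    simp only [cfStep, e]
    nlinarith [hd (n + 1 + 1)]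
  have hpos : ∀ n, 0 < (cfState x n).1 := fun n => (isCfState_cfState hx n).fst_pos
  induction i using Nat.twoStepInduction with
  | zero => simpa using pow_le_pow_left₀ (hpos n).le (hmono n) 2
  | one =>
    have := pow_le_pow_left₀ (by have := hpos n; omega) (hdouble n) 2
    nlinarith
  | more i ih _ =>
    have := pow_le_pow_left₀ (by have := hpos (n + i + 1); omega) (hdouble (n + i + 1)) 2
    have e : n + (i + 2) + 1 = n + i + 1 + 2 := by ring
    rw [e, pow_add]
    nlinarith

theorem rpow_neg_cfState_le {x : ℝ} (hx : x ∈ irrUnit) {κ : ℝ} (hκ : 0 < κ) (n i : ℕ) :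
    ((cfState x (n + i + 1)).1 : ℝ) ^ (-κ) ≤
      ((cfState x n).1 : ℝ) ^ (-κ) * Real.exp (-(2 * (κ * Real.log 2 / 4) * i)) := by
  have hq : (0 : ℝ) < (cfState x n).1 := by exact_mod_cast (isCfState_cfState hx n).fst_pos
  have hQ : (0 : ℝ) < (cfState x (n + i + 1)).1 := by
    exact_mod_cast (isCfState_cfState hx (n + i + 1)).fst_pos
  have h1 : ((cfState x n).1 : ℝ) ^ 2 * 2 ^ i ≤ ((cfState x (n + i + 1)).1 : ℝ) ^ 2 := by
    exact_mod_cast sq_mul_two_pow_le_cfState hx n i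
  have h2 : ((cfState x n).1 : ℝ) * Real.exp (Real.log 2 / 2 * i) ≤
      (cfState x (n + i + 1)).1 := by
    have he : Real.exp (Real.log 2 / 2 * i) ^ 2 = 2 ^ i := by
      rw [← Real.exp_nat_mul, ← Real.exp_log (show (0 : ℝ) < 2 ^ i by positivity), Real.log_pow]
      congr 1
      push_cast
      ring
    rwa [← pow_le_pow_iff_left₀ (by positivity) hQ.le two_ne_zero, mul_pow, he]
  calc _ ≤ (((cfState x n).1 : ℝ) * Real.exp (Real.log 2 / 2 * i)) ^ (-κ) :=
        Real.rpow_le_rpow_of_nonpos (by positivity) h2 (by linarith)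
    _ = _ := by
        rw [Real.mul_rpow hq.le (Real.exp_pos _).le, ← Real.exp_mul]
        congr 2
        ring

theorem norm_le_exp_of_ratio {δ C : ℝ} {h : ℝ → ℂ} (hC : 0 < C)
    (hbound : ∀ x : ℝ, x ∈ Set.Ioo (-1 : ℝ) 1 → x ≠ 0 → ‖h x‖ ≤ C * Real.exp (|x| ^ (-1 + δ)))
    {s : ℤ × ℤ × ℤ} (hs : IsCfState s) {d : ℤ} (hd : 1 ≤ d) :
    ‖h (cfRatio (cfStep s d))‖ ≤ C * Real.exp (((d : ℝ) + 1) ^ (1 - min δ (1 / 2))) := by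
  obtain ⟨q, q', σ⟩ := s
  have hq := hs.fst_pos
  have hQ := (hs.step hd).fst_pos
  obtain ⟨h1, h2, hσ⟩ := hs
  simp only [cfStep] at *
  have hqr : (0 : ℝ) < q := by exact_mod_cast hq
  have hQr : (0 : ℝ) < d * q + q' := by exact_mod_cast hQ
  have h1r : (1 : ℝ) ≤ q' := by exact_mod_cast h1
  have h2r : (q' : ℝ) ≤ q := by exact_mod_cast h2
  have hdr : (1 : ℝ) ≤ d := by exact_mod_cast hd
  have habs : |((cfRatio (d * q + q', q, -σ) : ℚ) : ℝ)| = q / (d * q + q') := by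
    simp only [cfRatio]
    push_cast
    rw [abs_div, abs_of_pos hQr, abs_mul, abs_of_pos hqr]
    rcases hσ with rfl | rfl <;> simp
  set y : ℝ := ((cfRatio (d * q + q', q, -σ) : ℚ) : ℝ)
  have hy0 : 0 < |y| := by rw [habs]; positivity
  have hy1 : |y| < 1 := by
    rw [habs, div_lt_one hQr]
    nlinarith
  refine (hbound y (abs_lt.1 hy1) (abs_pos.1 hy0)).trans ?_
  gcongr
  have hm : min δ (1 / 2) ≤ δ := min_le_left _ _
  have hm2 : min δ (1 / 2) ≤ 1 / 2 := min_le_right _ _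
  calc |y| ^ (-1 + δ) ≤ |y| ^ (-(1 - min δ (1 / 2))) :=
        Real.rpow_le_rpow_of_exponent_ge hy0 hy1.le (by linarith)
    _ = (|y|⁻¹) ^ (1 - min δ (1 / 2)) := by rw [Real.rpow_neg hy0.le, Real.inv_rpow hy0.le]
    _ ≤ ((d : ℝ) + 1) ^ (1 - min δ (1 / 2)) := by
        refine Real.rpow_le_rpow (by positivity) ?_ (by linarith)
        rw [habs, inv_div, div_le_iff₀ hqr]
        linarith

/-- On a set of tails of positive measure, the limit is approximated by the state value with an
error that is uniform after normalisation. -/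
theorem exists_tail_bound {k : ℂ} (hk : 0 < k.re) {δ : ℝ} (hδ : 0 < δ) {f : ℚ → ℂ} {h : ℝ → ℂ}
    (hper : ∀ x : ℚ, x ∉ Set.Icc (-1 : ℚ) 0 → f (x + 1) = f x)
    (hrec : ∀ x : ℚ, x ≠ 0 → f x - ((|((x : ℚ) : ℝ)| : ℝ) : ℂ) ^ (-k) * f (-1 / x) = h x)
    {C : ℝ} (hC : 0 < C)
    (hbound : ∀ x : ℝ, x ∈ Set.Ioo (-1 : ℝ) 1 → x ≠ 0 → ‖h x‖ ≤ C * Real.exp (|x| ^ (-1 + δ))) :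
    ∃ M : ℝ, 0 ≤ M ∧ ∃ G : Set ℝ, MeasurableSet G ∧ G ⊆ irrUnit ∧ volume G ≠ 0 ∧
      ∀ x ∈ irrUnit, ∀ L : ℂ, Tendsto (fun j : ℕ =>
        (((cfConv x (2 * j + 1)).den : ℝ) : ℂ) ^ (-k) * f (ratBar (cfConv x (2 * j + 1))))
        atTop (𝓝 L) →
      ∀ n, gaussMap^[n + 1] x ∈ G →
        ‖(((cfState x n).1 : ℝ) : ℂ) ^ k * L - f (cfRatio (cfState x n))‖ ≤ M := by
  set κ := k.re
  set c := κ * Real.log 2 / 4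
  have hc : 0 < c := by have := Real.log_pos one_lt_two; positivity
  have hm0 : 0 < min δ (1 / 2) := by positivity
  have hm2 : min δ (1 / 2) ≤ 1 / 2 := min_le_right _ _
  obtain ⟨K, G, hGm, hGU, hG0, hG⟩ := exists_set_digits_le
    (e := 1 - min δ (1 / 2)) (by linarith) (by linarith) hc
  have hgeo : Summable fun i : ℕ => C * Real.exp K * Real.exp (-c) ^ i :=
    (summable_geometric_of_lt_one (Real.exp_pos _).le
      (Real.exp_lt_one_iff.2 (by linarith))).mul_left _
  set M := ∑' i : ℕ, C * Real.exp K * Real.exp (-c) ^ i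
  refine ⟨M, tsum_nonneg fun i => by positivity, G, hGm, hGU, hG0, fun x hx L hL n hn => ?_⟩
  have hst := isCfState_cfState hx
  have hd : ∀ n, 1 ≤ cfb (n + 1) x := fun n => by
    rw [cfb_succ_eq hx]
    exact one_le_floor_inv (iterate_gaussMap_mem_irrUnit hx _)
  let W : ℕ → ℂ := fun n => (((cfState x n).1 : ℝ) : ℂ) ^ (-k) * f (cfRatio (cfState x n))
  have hpos : ∀ n, (0 : ℝ) < (cfState x n).1 := fun n => by exact_mod_cast (hst n).fst_pos
  have hWstep : ∀ n, W (n + 1) - W n =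
      (((cfState x (n + 1)).1 : ℝ) : ℂ) ^ (-k) * h (cfRatio (cfState x (n + 1))) := fun n => by
    have hr := reciprocity_step hper hrec (hst n) (hd (n + 1))
    rw [← cfState_succ] at hr
    have hdiv := div_cpow_mul_cpow (hpos n) (hpos (n + 1)) (-k)
    simp only [W]
    rw [← hdiv, hr]
    ring
  have hWlim : Tendsto (fun j => W (2 * (j + 1))) atTop (𝓝 L) := by
    refine ((tendsto_add_atTop_iff_nat 1).2 hL).congr fun j => ?_
    obtain ⟨e1, e2⟩ := cfConv_den_and_ratBar hx j
    have e3 : ((cfConv x (2 * (j + 1) + 1)).den : ℝ) = (cfState x (2 * (j + 1))).1 := by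
      exact_mod_cast e1
    simp only [W]
    rw [e2, e3]
    congr 2
    simp [cfRatio, cfState]
  set q : ℝ := ((cfState x n).1 : ℝ)
  have hterm : ∀ i, dist (W (n + i)) (W (n + (i + 1))) ≤
      q ^ (-κ) * (C * Real.exp K * Real.exp (-c) ^ i) := fun i => by
    rw [dist_comm, dist_eq_norm, ← add_assoc, hWstep, norm_mul,
      Complex.norm_cpow_eq_rpow_re_of_pos (hpos _), Complex.neg_re]
    have b1 := rpow_neg_cfState_le hx hk n i
    have b2 : ‖h (cfRatio (cfState x (n + i + 1)))‖ ≤ C * Real.exp (c * i + K) := by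
      rw [cfState_succ]
      refine (norm_le_exp_of_ratio hC hbound (hst _) (hd (n + i + 1))).trans ?_
      gcongr
      have := hG _ hn i
      rw [← Function.iterate_add_apply, show i + (n + 1) = n + i + 1 by ring] at this
      rw [cfb_succ_eq hx]
      exact this
    calc _ ≤ (q ^ (-κ) * Real.exp (-(2 * c * i))) * (C * Real.exp (c * i + K)) :=
          mul_le_mul b1 b2 (norm_nonneg _) (by have := hpos n; positivity)
      _ = q ^ (-κ) * (C * (Real.exp (-(2 * c * i)) * Real.exp (c * i + K))) := by ring
      _ = _ := by
          rw [mul_assoc C, ← Real.exp_nat_mul, ← Real.exp_add, ← Real.exp_add]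
          congr 3
          ring
  have hdist : ∀ J, dist (W n) (W (n + J)) ≤ q ^ (-κ) * M := fun J => by
    refine (dist_le_range_sum_of_dist_le (f := fun i => W (n + i)) J fun _ => hterm _).trans ?_
    rw [← Finset.mul_sum]
    have := hpos n
    gcongr
    exact hgeo.sum_le_tsum _ fun i _ => by positivity
  have hfin : dist (W n) L ≤ q ^ (-κ) * M := by
    refine le_of_tendsto (tendsto_const_nhds.dist hWlim) ?_
    filter_upwards [eventually_ge_atTop n] with j hj
    obtain ⟨J, hJ⟩ := Nat.exists_eq_add_of_le (show n ≤ 2 * (j + 1) by omega)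
    rw [hJ]
    exact hdist J
  have hq := hpos n
  have hqc : ((q : ℝ) : ℂ) ^ k * ((q : ℝ) : ℂ) ^ (-k) = 1 := by
    rw [Complex.cpow_neg, mul_inv_cancel₀]
    rw [Complex.cpow_ne_zero_iff_of_exponent_ne_zero (by rintro rfl; simp [κ] at hk)]
    exact Complex.ofReal_ne_zero.2 hq.ne'
  have hval : (q : ℂ) ^ k * L - f (cfRatio (cfState x n)) = (q : ℂ) ^ k * (L - W n) := by
    simp only [W]
    rw [mul_sub, ← mul_assoc, hqc, one_mul]
  rw [hval, norm_mul, Complex.norm_cpow_eq_rpow_re_of_pos hq, ← dist_eq_norm, dist_comm]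
  calc _ ≤ q ^ κ * (q ^ (-κ) * M) := by gcongr
    _ = M := by rw [← mul_assoc, ← Real.rpow_add hq, add_neg_cancel, Real.rpow_zero, one_mul]

/-- Normalised difference between a prescribed limit `c` and the value of `f` at a state. -/
noncomputable def cfDefect (k : ℂ) (f : ℚ → ℂ) (c : ℂ) (s : ℤ × ℤ × ℤ) : ℂ :=
  ((s.1 : ℝ) : ℂ) ^ k * c - f (cfRatio s)

/-- Any two words can be read from a common state so that both defects remain bounded. -/
def HasBoundedDefects (k : ℂ) (f : ℚ → ℂ) (c : ℂ) (M : ℝ) : Prop :=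
  ∀ v w : List ℤ, (∀ d ∈ v, 1 ≤ d) → (∀ d ∈ w, 1 ≤ d) → ∀ σ : ℤ, (σ = 1 ∨ σ = -1) →
    ∃ s, IsCfState s ∧ s.2.2 = σ ∧ ‖cfDefect k f c (v.foldl cfStep s)‖ ≤ M ∧
      ‖cfDefect k f c (w.foldl cfStep s)‖ ≤ M

theorem exists_hasBoundedDefects {k : ℂ} (hk : 0 < k.re) {δ : ℝ} (hδ : 0 < δ) {f : ℚ → ℂ}
    {h : ℝ → ℂ}
    (hper : ∀ x : ℚ, x ∉ Set.Icc (-1 : ℚ) 0 → f (x + 1) = f x)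
    (hrec : ∀ x : ℚ, x ≠ 0 → f x - ((|((x : ℚ) : ℝ)| : ℝ) : ℂ) ^ (-k) * f (-1 / x) = h x)
    {C : ℝ} (hC : 0 < C)
    (hbound : ∀ x : ℝ, x ∈ Set.Ioo (-1 : ℝ) 1 → x ≠ 0 → ‖h x‖ ≤ C * Real.exp (|x| ^ (-1 + δ)))
    {c : ℂ} {E : Set ℝ} (hEU : E ⊆ irrUnit) (hE : volume E ≠ 0)
    (hlim : ∀ x ∈ E, Tendsto (fun j : ℕ =>
      (((cfConv x (2 * j + 1)).den : ℝ) : ℂ) ^ (-k) * f (ratBar (cfConv x (2 * j + 1))))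
      atTop (𝓝 c)) :
    ∃ M, 0 ≤ M ∧ HasBoundedDefects k f c M := by
  obtain ⟨M, hM, G, hGm, hGU, hG0, hG⟩ := exists_tail_bound hk hδ hper hrec hC hbound
  obtain ⟨x₀, hx₀, hx⟩ := exists_forall_eventually_cfBranch_mem hE hEU
  have hGI : G ⊆ Icc 0 1 := fun t ht => Ioo_subset_Icc_self (hGU ht).1
  have hev : ∀ w : List ℤ, (∀ d ∈ w, 1 ≤ d) →
      ∀ᶠ n in atTop, ‖cfDefect k f c (w.foldl cfStep (cfState x₀ n))‖ ≤ M := by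
    intro w hw
    have hA := hx (cfBranch w '' G) (measurableSet_cfBranch_image hw hGm hGI)
      (by rintro _ ⟨t, ht, rfl⟩; exact cfBranch_mem_Icc hw (hGI ht)) (by
        intro h0
        have h1 := volume_cfBranch_image_ge hw hGI
        rw [h0, mul_zero, nonpos_iff_eq_zero, mul_eq_zero] at h1
        rcases h1 with h1 | h1
        · exact absurd (abs_sub_mul_le_cfBranch hw).1 (not_lt.2 (ENNReal.ofReal_eq_zero.1 h1))
        · exact hG0 h1)
    filter_upwards [(tendsto_add_atTop_nat 1).eventually hA] with n hn
    obtain ⟨_, ⟨t, ht, rfl⟩, hE'⟩ := hn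
    rw [← cfBranch_append] at hE'
    have hwd : ∀ d ∈ cfDigits (n + 1) x₀ ++ w, 1 ≤ d := by
      intro d hd
      rcases List.mem_append.1 hd with hd | hd
      · exact one_le_of_mem_cfDigits hx₀ d hd
      · exact hw d hd
    obtain ⟨e1, e2⟩ := cfDigits_gaussMap_cfBranch hwd (hGU ht)
    have hlen : (cfDigits (n + 1) x₀ ++ w).length = n + w.length + 1 := by
      rw [List.length_append, length_cfDigits]
      ring
    rw [hlen] at e1 e2
    have hs : cfState (cfBranch (cfDigits (n + 1) x₀ ++ w) t) (n + w.length) =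
        w.foldl cfStep (cfState x₀ n) := by
      rw [cfState_eq_foldl (hEU hE'), e1, List.foldl_append, ← cfState_eq_foldl hx₀]
    rw [← hs]
    exact hG _ (hEU hE') c (hlim _ hE') _ (by rwa [e2])
  refine ⟨M, hM, fun v w hv hw σ hσ => ?_⟩
  obtain ⟨N, hN⟩ := eventually_atTop.1 ((hev v hv).and (hev w hw))
  have hsign : ∃ n, N ≤ n ∧ (-1 : ℤ) ^ n = σ := by
    rcases hσ with rfl | rfl
    · exact ⟨2 * N, by omega, by simp⟩
    · exact ⟨2 * N + 1, by omega, by simp [pow_succ]⟩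
  obtain ⟨n, hn, hnσ⟩ := hsign
  exact ⟨cfState x₀ n, isCfState_cfState hx₀ n, hnσ, hN n hn⟩

/-- The real quotient `q'/q` of a state. -/
noncomputable def cfQuot (s : ℤ × ℤ × ℤ) : ℝ := (s.2.1 : ℝ) / s.1

theorem IsCfState.cfQuot_mem {s : ℤ × ℤ × ℤ} (hs : IsCfState s) : cfQuot s ∈ Ioc (0 : ℝ) 1 := by
  have hq : (0 : ℝ) < s.1 := by exact_mod_cast hs.fst_pos
  have h1 : (1 : ℝ) ≤ s.2.1 := by exact_mod_cast hs.1
  have h2 : (s.2.1 : ℝ) ≤ s.1 := by exact_mod_cast hs.2.1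
  exact ⟨div_pos (by linarith) hq, (div_le_one hq).2 h2⟩

theorem IsCfState.cfQuot_step {s : ℤ × ℤ × ℤ} (hs : IsCfState s) (d : ℤ) :
    cfQuot (cfStep s d) = ((d : ℝ) + cfQuot s)⁻¹ := by
  have hq : (0 : ℝ) < s.1 := by exact_mod_cast hs.fst_pos
  simp only [cfQuot, cfStep]
  push_cast
  rw [eq_comm, inv_eq_iff_eq_inv, inv_div, add_div, mul_div_cancel_right₀ _ hq.ne']

theorem cfRatio_eq_mul_cfQuot (s : ℤ × ℤ × ℤ) : ((cfRatio s : ℚ) : ℝ) = s.2.2 * cfQuot s := by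
  simp only [cfRatio, cfQuot]
  push_cast
  ring

theorem cfQuot_foldl_reverse {s : ℤ × ℤ × ℤ} (hs : IsCfState s) {w : List ℤ}
    (hw : ∀ d ∈ w, 1 ≤ d) :
    cfQuot (w.reverse.foldl cfStep s) = cfBranch w (cfQuot s) ∧
      (w.reverse.foldl cfStep s).2.2 = (-1) ^ w.length * s.2.2 := by
  induction w with
  | nil => simp [cfBranch]
  | cons d w ih =>
    have hw' : ∀ d ∈ w, 1 ≤ d := fun e he => hw e (List.mem_cons_of_mem _ he)
    obtain ⟨e1, e2⟩ := ih hw'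
    have hs' : IsCfState (w.reverse.foldl cfStep s) :=
      hs.foldl fun e he => hw' e (List.mem_reverse.1 he)
    rw [List.reverse_cons, List.foldl_append]
    refine ⟨?_, ?_⟩
    · rw [List.foldl_cons, List.foldl_nil, hs'.cfQuot_step, e1, cfBranch]
    · rw [List.foldl_cons, List.foldl_nil, List.length_cons, pow_succ]
      simp only [cfStep, e2]
      ring

theorem cfDefect_step {k : ℂ} {f : ℚ → ℂ} {h : ℝ → ℂ}
    (hper : ∀ x : ℚ, x ∉ Set.Icc (-1 : ℚ) 0 → f (x + 1) = f x)
    (hrec : ∀ x : ℚ, x ≠ 0 → f x - ((|((x : ℚ) : ℝ)| : ℝ) : ℂ) ^ (-k) * f (-1 / x) = h x)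
    (c : ℂ) {s : ℤ × ℤ × ℤ} (hs : IsCfState s) {d : ℤ} (hd : 1 ≤ d) :
    cfDefect k f c s = (cfQuot (cfStep s d) : ℂ) ^ k *
      (cfDefect k f c (cfStep s d) + h (-s.2.2 * cfQuot (cfStep s d))) := by
  have hq : (0 : ℝ) < s.1 := by exact_mod_cast hs.fst_pos
  have hQ : (0 : ℝ) < (cfStep s d).1 := by exact_mod_cast (hs.step hd).fst_pos
  have hr := reciprocity_step hper hrec hs hd
  have hrat : ((cfRatio (cfStep s d) : ℚ) : ℝ) = -s.2.2 * cfQuot (cfStep s d) := by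
    rw [cfRatio_eq_mul_cfQuot]
    simp [cfStep]
  have hquot : cfQuot (cfStep s d) = (s.1 : ℝ) / ((cfStep s d).1 : ℝ) := rfl
  have hdiv := div_cpow_mul_cpow hq hQ k
  rw [hrat] at hr
  rw [hquot] at hr ⊢
  have hne : (((s.1 : ℝ) / ((cfStep s d).1 : ℝ) : ℝ) : ℂ) ^ k ≠ 0 := by
    intro h0
    rw [Complex.cpow_eq_zero_iff] at h0
    exact (div_pos hq hQ).ne' (Complex.ofReal_eq_zero.1 h0.1)
  rw [Complex.cpow_neg] at hr
  rw [cfDefect, cfDefect, hr, ← hdiv]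
  field_simp
  ring

theorem norm_cfDefect_le {k : ℂ} (hk : 0 < k.re) {f : ℚ → ℂ} {h : ℝ → ℂ}
    (hper : ∀ x : ℚ, x ∉ Set.Icc (-1 : ℚ) 0 → f (x + 1) = f x)
    (hrec : ∀ x : ℚ, x ≠ 0 → f x - ((|((x : ℚ) : ℝ)| : ℝ) : ℂ) ^ (-k) * f (-1 / x) = h x)
    {c : ℂ} {M B : ℝ} (hB : ∀ x ∈ Icc (-1 : ℝ) 1, x ≠ 0 → ‖h x‖ ≤ B)
    {s : ℤ × ℤ × ℤ} (hs : IsCfState s) {d : ℤ} (hd : 1 ≤ d)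
    (hM : ‖cfDefect k f c (cfStep s d)‖ ≤ M) :
    ‖cfDefect k f c s‖ ≤ (d : ℝ) ^ (-k.re) * (M + B) := by
  have hm := (hs.step hd).cfQuot_mem
  have hd0 : (0 : ℝ) < d := by exact_mod_cast (show 0 < d by omega)
  rw [cfDefect_step hper hrec c hs hd, norm_mul, Complex.norm_cpow_eq_rpow_re_of_pos hm.1,
    Real.rpow_neg hd0.le, ← Real.inv_rpow hd0.le]
  refine mul_le_mul ?_ ((norm_add_le _ _).trans (add_le_add hM (hB _ ?_ ?_))) (norm_nonneg _)
    (by positivity)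
  · refine Real.rpow_le_rpow hm.1.le ?_ hk.le
    rw [hs.cfQuot_step]
    exact inv_anti₀ hd0 (by linarith [hs.cfQuot_mem.1])
  · rcases hs.2.2 with h | h <;> rw [h] <;> constructor <;> push_cast <;> linarith [hm.1, hm.2]
  · rcases hs.2.2 with h | h <;> rw [h] <;> push_cast <;> simpa using hm.1.ne'

theorem not_hasBoundedDefects_of_continuous {k : ℂ} (hk : 0 < k.re) {f : ℚ → ℂ} {h : ℝ → ℂ}
    (hper : ∀ x : ℚ, x ∉ Set.Icc (-1 : ℚ) 0 → f (x + 1) = f x)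
    (hrec : ∀ x : ℚ, x ≠ 0 → f x - ((|((x : ℚ) : ℝ)| : ℝ) : ℂ) ^ (-k) * f (-1 / x) = h x)
    (hnz : ∃ x : ℝ, x ∈ Set.Icc (-1 : ℝ) 1 ∧ x ≠ 0 ∧ h x ≠ 0)
    {hc : ℝ → ℂ} (hcont : ContinuousOn hc (Set.Icc (-1 : ℝ) 1))
    (hext : ∀ x ∈ Set.Icc (-1 : ℝ) 1, x ≠ 0 → hc x = h x) (c : ℂ) (M : ℝ) :
    ¬ HasBoundedDefects k f c M := by
  intro hbd
  obtain ⟨x₀, hx₀, hx₀0, hhx₀⟩ := hnz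
  obtain ⟨B, hB⟩ := isCompact_Icc.exists_bound_of_continuousOn hcont
  have hBh : ∀ x ∈ Icc (-1 : ℝ) 1, x ≠ 0 → ‖h x‖ ≤ B := fun x hx h0 => by
    rw [← hext x hx h0]
    exact hB x hx
  obtain ⟨u, τ, hu, hτ, hcu⟩ : ∃ u : ℝ, ∃ τ : ℤ, u ∈ irrUnit ∧ (τ = 1 ∨ τ = -1) ∧
      hc (τ * u) ≠ 0 := by
    have hev : ∀ᶠ y in 𝓝[Icc (-1 : ℝ) 1] x₀, hc y ≠ 0 :=
      (hcont x₀ hx₀).eventually_ne (by rwa [hext x₀ hx₀ hx₀0])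
    have hcl : x₀ ∈ closure (Ioo (-1 : ℝ) 1 ∩ {y | Irrational y}) := by
      rw [← closure_Ioo (by norm_num : (-1 : ℝ) ≠ 1)] at hx₀
      exact closure_minimal (dense_irrational.open_subset_closure_inter isOpen_Ioo)
        isClosed_closure hx₀
    obtain ⟨y, ⟨hy, hyirr⟩, hy'⟩ := ((mem_closure_iff_frequently.1 hcl).and_eventually
      (eventually_nhdsWithin_iff.1 hev)).exists
    have hcy := hy' (Ioo_subset_Icc_self hy)
    rcases lt_or_gt_of_ne hyirr.ne_zero with h0 | h0
    · exact ⟨-y, -1, ⟨⟨by linarith, by linarith [hy.1]⟩, hyirr.neg⟩, Or.inr rfl, by simpa using hcy⟩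
    · exact ⟨y, 1, ⟨⟨h0, hy.2⟩, hyirr⟩, Or.inl rfl, by simpa using hcy⟩
  have hmemτ : ∀ y ∈ Icc (0 : ℝ) 1, (τ : ℝ) * y ∈ Icc (-1 : ℝ) 1 := fun y hy => by
    rcases hτ with rfl | rfl <;> constructor <;> push_cast <;> linarith [hy.1, hy.2]
  set η := ‖hc (τ * u)‖ / 2 with hη
  have hη0 : 0 < η := by have := norm_pos_iff.2 hcu; positivity
  obtain ⟨ε, hε, hnear⟩ := Metric.continuousOn_iff.1 hcont _
    (hmemτ u (Ioo_subset_Icc_self hu.1)) η hη0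
  have hu2 : 0 < u / 2 := by linarith [hu.1.1]
  obtain ⟨n, hn⟩ := exists_nat_one_div_lt (lt_min hε hu2)
  set v := cfDigits n (gaussMap u) with hv
  have hdig : cfDigits (n + 1) u = ⌊u⁻¹⌋ :: v := rfl
  have hd1 := one_le_floor_inv hu
  have hvd : ∀ d ∈ v.reverse, 1 ≤ d := fun d hd =>
    one_le_of_mem_cfDigits (gaussMap_mem_irrUnit hu) d (List.mem_reverse.1 hd)
  have hσ : τ * (-1) ^ (n + 1) = 1 ∨ τ * (-1) ^ (n + 1) = -1 := by
    rcases hτ with rfl | rfl <;> rcases neg_one_pow_eq_or ℤ (n + 1) with h | h <;> simp [h]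
  have hineq : ∀ b : ℕ, 1 ≤ b →
      η ≤ ((u / 2) ^ (-k.re) + 1) * ((b : ℝ) ^ (-k.re) * (M + B)) := by
    intro b hb
    have hb' : (1 : ℤ) ≤ b := by exact_mod_cast hb
    obtain ⟨s, hs, hsσ, hM1, hM2⟩ := hbd (v.reverse ++ [(b : ℤ)]) (v.reverse ++ [⌊u⁻¹⌋, (b : ℤ)])
      (by
        intro d hd
        rcases List.mem_append.1 hd with hd | hd
        · exact hvd d hd
        · simp only [List.mem_singleton] at hd; omega)
      (by
        intro d hd
        rcases List.mem_append.1 hd with hd | hd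
        · exact hvd d hd
        · simp only [List.mem_cons, List.not_mem_nil, or_false] at hd
          rcases hd with rfl | rfl <;> assumption) _ hσ
    rw [List.foldl_append] at hM1 hM2
    simp only [List.foldl_cons, List.foldl_nil] at hM1 hM2
    set P := v.reverse.foldl cfStep s with hP
    have hPs : IsCfState P := hs.foldl hvd
    have hP's := hPs.step hd1
    have hdP := norm_cfDefect_le hk hper hrec hBh hPs hb' hM1
    have hdP' := norm_cfDefect_le hk hper hrec hBh hP's hb' hM2
    have hrel := cfDefect_step hper hrec c hPs hd1
    obtain ⟨hquot, hsign⟩ := cfQuot_foldl_reverse hs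
      (one_le_of_mem_cfDigits (n := n + 1) hu)
    rw [hdig, List.reverse_cons, List.foldl_append] at hquot hsign
    simp only [List.foldl_cons, List.foldl_nil] at hquot hsign
    rw [← hdig] at hquot hsign
    rw [← hP] at hquot hsign
    have hPsign : -(P.2.2 : ℝ) = τ := by
      have : -P.2.2 = τ := by
        have h1 : (cfStep P ⌊u⁻¹⌋).2.2 = -P.2.2 := rfl
        rw [← h1, hsign, hsσ, length_cfDigits, mul_left_comm, ← mul_pow]
        simp
      exact_mod_cast this
    rw [hPsign] at hrel
    set R := cfQuot (cfStep P ⌊u⁻¹⌋) with hR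
    have hRm := hP's.cfQuot_mem
    rw [← hR] at hRm
    have hRu : |R - u| < min ε (u / 2) := by
      have hb := abs_cfBranch_sub_le (one_le_of_mem_cfDigits (n := n + 1) hu)
        (Ioc_subset_Icc_self hs.cfQuot_mem)
        (Ioo_subset_Icc_self (iterate_gaussMap_mem_irrUnit hu (n + 1)).1)
      rw [cfBranch_cfDigits, length_cfDigits, ← hquot] at hb
      refine lt_of_le_of_lt hb (lt_of_le_of_lt ?_ hn)
      push_cast
      gcongr
      linarith
    have hRu2 : u / 2 ≤ R := by
      have := (abs_lt.1 (hRu.trans_le (min_le_right _ _))).1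
      linarith
    have hτR := hmemτ R (Ioc_subset_Icc_self hRm)
    have hhR : η ≤ ‖h (τ * R)‖ := by
      have h1 := hnear _ hτR (by
        rw [Real.dist_eq, ← mul_sub, abs_mul]
        have : |(τ : ℝ)| = 1 := by rcases hτ with rfl | rfl <;> simp
        rw [this, one_mul]
        exact hRu.trans_le (min_le_left _ _))
      have hτR0 : (τ : ℝ) * R ≠ 0 := by
        rcases hτ with rfl | rfl <;> push_cast <;> simpa using hRm.1.ne'
      rw [hext _ hτR hτR0, dist_eq_norm] at h1
      have h2 := norm_sub_norm_le (hc (τ * u)) (h (τ * R))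
      rw [norm_sub_rev] at h2
      linarith
    have hRk : (R : ℂ) ^ k ≠ 0 := by
      intro h0
      rw [Complex.cpow_eq_zero_iff] at h0
      exact hRm.1.ne' (Complex.ofReal_eq_zero.1 h0.1)
    have hsolve : h (τ * R) = (R : ℂ) ^ (-k) * cfDefect k f c P -
        cfDefect k f c (cfStep P ⌊u⁻¹⌋) := by
      rw [hrel, Complex.cpow_neg, inv_mul_cancel_left₀ hRk]
      ring
    calc η ≤ ‖h (τ * R)‖ := hhR
      _ ≤ ‖(R : ℂ) ^ (-k) * cfDefect k f c P‖ + ‖cfDefect k f c (cfStep P ⌊u⁻¹⌋)‖ := by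
          rw [hsolve]
          exact norm_sub_le _ _
      _ ≤ (u / 2) ^ (-k.re) * ((b : ℝ) ^ (-k.re) * (M + B)) +
            (b : ℝ) ^ (-k.re) * (M + B) := by
          rw [norm_mul, Complex.norm_cpow_eq_rpow_re_of_pos hRm.1, Complex.neg_re]
          refine add_le_add (mul_le_mul ?_ hdP (norm_nonneg _) (by positivity)) hdP'
          exact Real.rpow_le_rpow_of_nonpos hu2 hRu2 (by linarith)
      _ = _ := by ring
  have hlim : Tendsto (fun b : ℕ => ((u / 2) ^ (-k.re) + 1) * ((b : ℝ) ^ (-k.re) * (M + B)))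
      atTop (𝓝 0) := by
    have := (((tendsto_rpow_neg_atTop hk).comp tendsto_natCast_atTop_atTop).mul_const
      (M + B)).const_mul ((u / 2) ^ (-k.re) + 1)
    simpa using this
  exact absurd (ge_of_tendsto hlim (eventually_atTop.2 ⟨1, hineq⟩)) (not_le.2 hη0)

theorem eq_zero_of_two_cpow_of_three_cpow {w : ℂ} (h2 : (2 : ℂ) ^ w = 1) (h3 : (3 : ℂ) ^ w = 1) :
    w = 0 := by
  by_contra hw
  rw [Complex.cpow_def_of_ne_zero (by norm_num), Complex.exp_eq_one_iff] at h2 h3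
  obtain ⟨a, ha⟩ := h2
  obtain ⟨b, hb⟩ := h3
  have hl2 : Complex.log 2 = (Real.log 2 : ℝ) := by simp
  have hl3 : Complex.log 3 = (Real.log 3 : ℝ) := by simp
  rw [hl2] at ha
  rw [hl3] at hb
  have hlog2 : (0 : ℝ) < Real.log 2 := Real.log_pos (by norm_num)
  have hlog3 : (0 : ℝ) < Real.log 3 := Real.log_pos (by norm_num)
  have hreal : Real.log 2 * b = Real.log 3 * a := by
    have : ((Real.log 2 * b : ℝ) : ℂ) * w = ((Real.log 3 * a : ℝ) : ℂ) * w := by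
      push_cast
      linear_combination (b : ℂ) * ha - (a : ℂ) * hb
    exact_mod_cast mul_right_cancel₀ hw this
  have ha0 : a ≠ 0 := by
    rintro rfl
    rw [Int.cast_zero, zero_mul, mul_eq_zero] at ha
    exact ha.elim (fun h => hlog2.ne' (by exact_mod_cast h)) hw
  have hb0 : b ≠ 0 := by
    rintro rfl
    rw [Int.cast_zero, mul_zero, eq_comm, mul_eq_zero] at hreal
    exact hreal.elim hlog3.ne' (fun h => ha0 (by exact_mod_cast h))
  have habs : (b.natAbs : ℝ) * Real.log 2 = a.natAbs * Real.log 3 := by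
    have := congrArg abs hreal
    rw [abs_mul, abs_mul, abs_of_pos hlog2, abs_of_pos hlog3] at this
    rw [Nat.cast_natAbs, Nat.cast_natAbs]
    push_cast
    linarith
  have hpow : 2 ^ b.natAbs = 3 ^ a.natAbs := by
    rw [← Real.log_pow, ← Real.log_pow] at habs
    exact_mod_cast Real.log_injOn_pos (Set.mem_Ioi.2 (by positivity))
      (Set.mem_Ioi.2 (by positivity)) habs
  have heven : Even (2 ^ b.natAbs) := (Nat.even_pow.2 ⟨even_two, Int.natAbs_ne_zero.2 hb0⟩)
  rw [hpow] at heven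
  exact Nat.not_even_iff_odd.2 (Odd.pow (by decide)) heven

theorem tendsto_add_div_rpow_neg {h : ℝ → ℂ} {c₀ : ℂ} {lam : ℝ} (hlam : 0 < lam)
    (hlim : Tendsto (fun x : ℝ => h x / ((x ^ (-lam) : ℝ) : ℂ)) (𝓝[>] 0) (𝓝 c₀))
    {x : ℕ → ℝ} (hx : Tendsto x atTop (𝓝[>] 0)) {θ : ℕ → ℂ} {M : ℝ} (hθ : ∀ b, ‖θ b‖ ≤ M) :
    Tendsto (fun b => (θ b + h (x b)) / ((x b ^ (-lam) : ℝ) : ℂ)) atTop (𝓝 c₀) := by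
  have hsmall : Tendsto (fun b => θ b / ((x b ^ (-lam) : ℝ) : ℂ)) atTop (𝓝 0) := by
    have hpow : Tendsto (fun b => M * x b ^ lam) atTop (𝓝 0) := by
      have := ((Real.continuousAt_rpow_const 0 lam (Or.inr hlam.le)).tendsto.comp
        (hx.mono_right nhdsWithin_le_nhds)).const_mul M
      simpa [Real.zero_rpow hlam.ne'] using this
    refine squeeze_zero_norm' ?_ hpow
    filter_upwards [hx.eventually self_mem_nhdsWithin] with b hb
    have hb : 0 < x b := hb
    rw [norm_div, Complex.norm_real, Real.norm_of_nonneg (by positivity), Real.rpow_neg hb.le,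
      div_inv_eq_mul]
    gcongr
    exact hθ b
  simpa [add_div] using hsmall.add (hlim.comp hx)

theorem cpow_mul_eq_cpow_sub_mul_div {x : ℝ} (hx : 0 < x) (k : ℂ) (lam : ℝ) (z : ℂ) :
    (x : ℂ) ^ k * z = (x : ℂ) ^ (k - lam) * (z / ((x ^ (-lam) : ℝ) : ℂ)) := by
  have hx' : (x : ℂ) ≠ 0 := by exact_mod_cast hx.ne'
  have hl : (x : ℂ) ^ (lam : ℂ) ≠ 0 := by simp [Complex.cpow_eq_zero_iff, hx']
  rw [Complex.cpow_sub _ _ hx', Complex.ofReal_cpow hx.le, Complex.ofReal_neg, Complex.cpow_neg]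
  field_simp

theorem natCast_cpow_eq_one_of_hasBoundedDefects {k : ℂ} {f : ℚ → ℂ} {h : ℝ → ℂ}
    (hper : ∀ x : ℚ, x ∉ Set.Icc (-1 : ℚ) 0 → f (x + 1) = f x)
    (hrec : ∀ x : ℚ, x ≠ 0 → f x - ((|((x : ℚ) : ℝ)| : ℝ) : ℂ) ^ (-k) * f (-1 / x) = h x)
    {c₀ : ℂ} (hc₀ : c₀ ≠ 0) {lam : ℝ} (hlam : 0 < lam)
    (hlim : Tendsto (fun x : ℝ => h x / ((x ^ (-lam) : ℝ) : ℂ)) (𝓝[>] 0) (𝓝 c₀))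
    {c : ℂ} {M : ℝ} (hbd : HasBoundedDefects k f c M) {n : ℕ} (hn : 1 ≤ n) :
    (n : ℂ) ^ (k - lam) = 1 := by
  have hdig : ∀ m : ℕ, 1 ≤ m → ∀ b : ℕ, ∀ d ∈ [((m * (b + 1) : ℕ) : ℤ)], 1 ≤ d := by
    intro m hm b d hd
    rw [List.mem_singleton.1 hd]
    exact_mod_cast Nat.mul_pos hm b.succ_pos
  choose s hs hsσ hM1 hM2 using fun b : ℕ =>
    hbd [((1 * (b + 1) : ℕ) : ℤ)] [((n * (b + 1) : ℕ) : ℤ)] (hdig 1 le_rfl b) (hdig n hn b)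
      (-1) (Or.inr rfl)
  simp only [List.foldl_cons, List.foldl_nil] at hM1 hM2
  have hr : ∀ b, cfQuot (s b) ∈ Ioc (0 : ℝ) 1 := fun b => (hs b).cfQuot_mem
  have hquot : ∀ m b : ℕ, cfQuot (cfStep (s b) ((m * (b + 1) : ℕ) : ℤ)) =
      ((m : ℝ) * (b + 1) + cfQuot (s b))⁻¹ := fun m b => by
    rw [(hs b).cfQuot_step]
    push_cast
    rfl
  have hpos : ∀ m b : ℕ, 0 < (m : ℝ) * (b + 1) + cfQuot (s b) := fun m b => by
    have := (hr b).1
    positivity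
  have hzero : ∀ m : ℕ, 1 ≤ m → Tendsto
      (fun b : ℕ => ((m : ℝ) * (b + 1) + cfQuot (s b))⁻¹) atTop (𝓝[>] 0) := by
    intro m hm
    refine tendsto_inv_atTop_nhdsGT_zero.comp
      (tendsto_atTop_mono (fun b => ?_) tendsto_natCast_atTop_atTop)
    have hm' : (1 : ℝ) ≤ m := by exact_mod_cast hm
    nlinarith [(hr b).1, (Nat.cast_nonneg b : (0 : ℝ) ≤ b)]
  have hdefect : ∀ m : ℕ, 1 ≤ m → ∀ b : ℕ, cfDefect k f c (s b) =
      ((((m : ℝ) * (b + 1) + cfQuot (s b))⁻¹ : ℝ) : ℂ) ^ (k - lam) *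
        ((cfDefect k f c (cfStep (s b) ((m * (b + 1) : ℕ) : ℤ)) +
          h (((m : ℝ) * (b + 1) + cfQuot (s b))⁻¹)) /
          (((((m : ℝ) * (b + 1) + cfQuot (s b))⁻¹) ^ (-lam) : ℝ) : ℂ)) := by
    intro m hm b
    rw [cfDefect_step hper hrec c (hs b) (hdig m hm b _ (List.mem_singleton.2 rfl)), hquot, hsσ,
      cpow_mul_eq_cpow_sub_mul_div (inv_pos.2 (hpos m b)) k lam]
    simp
  have hA := tendsto_add_div_rpow_neg hlam hlim (hzero 1 le_rfl) hM1
  have hA' := tendsto_add_div_rpow_neg hlam hlim (hzero n hn) hM2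
  have hratio : Tendsto (fun b : ℕ => ((n : ℝ) * (b + 1) + cfQuot (s b)) *
      (((1 : ℕ) : ℝ) * (b + 1) + cfQuot (s b))⁻¹) atTop (𝓝 n) := by
    have hsq : Tendsto (fun b : ℕ => ((n : ℝ) - 1) * cfQuot (s b) *
        (((1 : ℕ) : ℝ) * (b + 1) + cfQuot (s b))⁻¹) atTop (𝓝 0) := by
      have h0 := ((hzero 1 le_rfl).mono_right nhdsWithin_le_nhds).const_mul ((n : ℝ) - 1)
      rw [mul_zero] at h0
      have hn' : (0 : ℝ) ≤ n - 1 := by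
        have : (1 : ℝ) ≤ n := by exact_mod_cast hn
        linarith
      refine squeeze_zero (fun b => ?_) (fun b => ?_) h0
      · exact mul_nonneg (mul_nonneg hn' (hr b).1.le) (inv_nonneg.2 (hpos 1 b).le)
      · exact mul_le_mul_of_nonneg_right (mul_le_of_le_one_right hn' (hr b).2)
          (inv_nonneg.2 (hpos 1 b).le)
    have := hsq.const_sub (n : ℝ)
    rw [sub_zero] at this
    refine this.congr fun b => ?_
    have := (hpos 1 b).ne'
    field_simp
    push_cast
    ring
  have hn0 : (0 : ℝ) < n := by exact_mod_cast hn
  have hcpow : Tendsto (fun b : ℕ => ((((n : ℝ) * (b + 1) + cfQuot (s b)) *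
      (((1 : ℕ) : ℝ) * (b + 1) + cfQuot (s b))⁻¹ : ℝ) : ℂ) ^ (k - lam)) atTop
      (𝓝 ((n : ℂ) ^ (k - lam))) := by
    have hlimC := (Complex.continuous_ofReal.tendsto (n : ℝ)).comp hratio
    rw [Complex.ofReal_natCast] at hlimC
    exact hlimC.cpow tendsto_const_nhds (Or.inl (by simpa using hn0))
  have heq : (n : ℂ) ^ (k - lam) * c₀ = c₀ := by
    refine tendsto_nhds_unique ((hcpow.mul hA).congr fun b => ?_) hA'
    have h1 := (hdefect 1 le_rfl b).symm.trans (hdefect n hn b)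
    have hx : ((((n : ℝ) * (b + 1) + cfQuot (s b) : ℝ)) : ℂ) ^ (k - lam) *
        ((((n : ℝ) * (b + 1) + cfQuot (s b))⁻¹ : ℝ) : ℂ) ^ (k - lam) = 1 := by
      rw [← Complex.mul_cpow_ofReal_nonneg (hpos n b).le (inv_pos.2 (hpos n b)).le,
        ← Complex.ofReal_mul, mul_inv_cancel₀ (hpos n b).ne']
      simp
    rw [Complex.ofReal_mul, Complex.mul_cpow_ofReal_nonneg (hpos n b).le
      (inv_pos.2 (hpos 1 b)).le, mul_assoc, h1, ← mul_assoc, hx, one_mul]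
  exact mul_right_cancel₀ hc₀ (heq.trans (one_mul c₀).symm)

theorem not_hasBoundedDefects_of_asymptotic {k : ℂ} {f : ℚ → ℂ} {h : ℝ → ℂ}
    (hper : ∀ x : ℚ, x ∉ Set.Icc (-1 : ℚ) 0 → f (x + 1) = f x)
    (hrec : ∀ x : ℚ, x ≠ 0 → f x - ((|((x : ℚ) : ℝ)| : ℝ) : ℂ) ^ (-k) * f (-1 / x) = h x)
    {c₀ : ℂ} (hc₀ : c₀ ≠ 0) {lam : ℝ} (hlam : 0 < lam) (hne : (lam : ℂ) ≠ k)
    (hlim : Tendsto (fun x : ℝ => h x / ((x ^ (-lam) : ℝ) : ℂ)) (𝓝[>] 0) (𝓝 c₀))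
    (c : ℂ) (M : ℝ) : ¬ HasBoundedDefects k f c M := by
  intro hbd
  have hpow : ∀ {n : ℕ}, 1 ≤ n → (n : ℂ) ^ (k - lam) = 1 := fun hn =>
    natCast_cpow_eq_one_of_hasBoundedDefects hper hrec hc₀ hlam hlim hbd hn
  exact hne (sub_eq_zero.1 (eq_zero_of_two_cpow_of_three_cpow
    (by simpa using hpow (n := 2) (by norm_num)) (by simpa using hpow (n := 3) (by norm_num)))).symm

/-- Diffuseness of the limiting measure for `Re k > 0`, when `h` is not
identically zero and either extends continuously to `[-1,1]`, or satisfies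
`h(x) ~ c₀ x^{-λ}` as `x → 0⁺` with `λ > 0`, `λ ≠ k`. -/
theorem stmt9 (k : ℂ) (hk : 0 < k.re) (δ : ℝ) (hδ : 0 < δ)
    (f : ℚ → ℂ) (h : ℝ → ℂ)
    (hper : ∀ x : ℚ, x ∉ Set.Icc (-1 : ℚ) 0 → f (x + 1) = f x)
    (hrec : ∀ x : ℚ, x ≠ 0 →
      f x - ((|((x : ℚ) : ℝ)| : ℝ) : ℂ) ^ (-k) * f (-1 / x) = h x)
    (C : ℝ) (hC : 0 < C)
    (hbound : ∀ x : ℝ, x ∈ Set.Ioo (-1 : ℝ) 1 → x ≠ 0 →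
      ‖h x‖ ≤ C * Real.exp (|x| ^ (-1 + δ)))
    (hnz : ∃ x : ℝ, x ∈ Set.Icc (-1 : ℝ) 1 ∧ x ≠ 0 ∧ h x ≠ 0)
    (hcase :
      -- (i) `h` extends to a continuous function on `[-1,1]`
      (∃ hc : ℝ → ℂ, ContinuousOn hc (Set.Icc (-1 : ℝ) 1) ∧
        ∀ x ∈ Set.Icc (-1 : ℝ) 1, x ≠ 0 → hc x = h x) ∨
      -- (ii) `h(x) ~ c₀ · x^{-λ}` as `x → 0⁺`, `c₀ ≠ 0`, `λ > 0`, `λ ≠ k`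
      (∃ c₀ : ℂ, c₀ ≠ 0 ∧ ∃ lam : ℝ, 0 < lam ∧ (lam : ℂ) ≠ k ∧
        Tendsto (fun x : ℝ => h x / ((x ^ (-lam) : ℝ) : ℂ))
          (nhdsWithin 0 (Set.Ioi 0)) (nhds c₀)))
    (X : Set ℝ) (hXfull : volume Xᶜ = 0)
    (F : ℝ → ℂ)
    (hFlim : ∀ x ∈ X, Tendsto
      (fun j : ℕ => (((cfConv x (2 * j + 1)).den : ℝ) : ℂ) ^ (-k)
        * f (ratBar (cfConv x (2 * j + 1))))
      atTop (nhds (F x))) :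
    ∀ c : ℂ, volume {x : ℝ | x ∈ Set.Icc (0 : ℝ) 1 ∧ x ∈ X ∧ F x = c} = 0 := by
  intro c
  set E : Set ℝ := {x | x ∈ irrUnit ∧ Tendsto
    (fun j : ℕ => (((cfConv x (2 * j + 1)).den : ℝ) : ℂ) ^ (-k)
      * f (ratBar (cfConv x (2 * j + 1)))) atTop (𝓝 c)} with hE
  have hE0 : volume E = 0 := by
    by_contra hpos
    obtain ⟨M, -, hbd⟩ := exists_hasBoundedDefects hk hδ hper hrec hC hbound
      (fun x hx => hx.1) hpos (fun x hx => hx.2)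
    rcases hcase with ⟨hc, hcont, hext⟩ | ⟨c₀, hc₀, lam, hlam, hne, hlim⟩
    · exact not_hasBoundedDefects_of_continuous hk hper hrec hnz hcont hext c M hbd
    · exact not_hasBoundedDefects_of_asymptotic hper hrec hc₀ hlam hne hlim c M hbd
  refine measure_mono_null (t := E ∪ range ((↑) : ℚ → ℝ)) ?_
    (measure_union_null hE0 ((countable_range _).measure_zero volume))
  rintro x ⟨hx, hxX, hFx⟩
  by_cases hirr : Irrational x
  · refine Or.inl ⟨⟨⟨lt_of_le_of_ne hx.1 hirr.ne_zero.symm, lt_of_le_of_ne hx.2 hirr.ne_one⟩,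
      hirr⟩, ?_⟩
    rw [← hFx]
    exact hFlim x hxX
  · exact Or.inr (not_not.1 hirr)
end

section
/- Let k ∈ ℂ with Re(k) < 0 and δ > 0. Let f : ℚ → ℂ satisfy weak periodicity (f(x+1) = f(x) for all x ∈ ℚ\[−1,0]) and the reciprocity relation f(x) − |x|^{−k}·f(−1/x) = h(x) for all x ∈ ([−1,1] ∩ ℚ)\{0}, where h : ℝ\{0} → ℂ satisfies condition (coh) with parameter δ and is, in addition, real-analytic on (−1,1)\{0}. Let f† be the function defined on a full-measure set X ⊆ ℝ\ℚ by f†(x) := lim_{j→∞} f(x_j) along the continued-fraction convergents x_j of x, and let φ : ℂ → ℝ be an ℝ-linear form. Suppose that for one choice of sign ± there exist α ∈ ℝ and a set C ⊆ {x ∈ X : ±x > 0} of positive Lebesgue measure such that φ(f†(x)) = α for all x ∈ C. Then φ(f†(x)) = α for Lebesgue-almost every x with ±x > 0. -/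
open Filter Topology MeasureTheory Set

/-- Condition (coh) on the period function `h`, with parameter `δ`:
(i) `sup {|h x - h y| : |x-y| < exp(-ε^(δ-1)), |x| > 2ε} → 0` as `ε → 0⁺`, and
(ii) `|h x| ≤ C · exp(|x|^(δ-1))` on `[-1,1] \ {0}`. -/
def cohCond (δ : ℝ) (h : ℝ → ℂ) : Prop :=
  (∀ η : ℝ, 0 < η → ∃ ε₀ : ℝ, 0 < ε₀ ∧ ∀ ε : ℝ, 0 < ε → ε < ε₀ →
    ∀ x y : ℝ, x ∈ Set.Icc (-1 : ℝ) 1 → y ∈ Set.Icc (-1 : ℝ) 1 → x ≠ 0 → y ≠ 0 →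
      |x - y| < Real.exp (-(ε ^ (δ - 1))) → 2 * ε < |x| → ‖h x - h y‖ ≤ η) ∧
  (∃ C : ℝ, 0 < C ∧ ∀ x : ℝ, x ∈ Set.Icc (-1 : ℝ) 1 → x ≠ 0 →
    ‖h x‖ ≤ C * Real.exp (|x| ^ (δ - 1)))

/-! ### Convergents under translation and inversion -/

theorem cfb_nonneg (n : ℕ) {x : ℝ} (hx : 0 ≤ x) : 0 ≤ cfb n x := by
  induction n generalizing x with
  | zero => exact Int.floor_nonneg.mpr hx
  | succ n ih => exact ih (inv_nonneg.mpr (Int.fract_nonneg x))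

theorem one_le_cfPQ_fst {x : ℝ} (hx : 1 ≤ x) (n : ℕ) : 1 ≤ (cfPQ x n).1 := by
  have hb : ∀ n, 0 ≤ cfb n x := fun n => cfb_nonneg n (by linarith)
  have h0 : 1 ≤ cfb 0 x := Int.le_floor.mpr (by simpa using hx)
  induction n using Nat.twoStepInduction with
  | zero => exact h0
  | one =>
    have := mul_nonneg (hb 1) (hb 0)
    simp only [cfPQ]; omega
  | more n ih1 ih2 =>
    have := mul_nonneg (hb (n + 2)) (zero_le_one.trans ih2)
    simp only [cfPQ]; omega

theorem cfPQ_succ (x : ℝ) (n : ℕ) :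
    (cfPQ x (n + 1)).1 = ⌊x⌋ * (cfPQ (Int.fract x)⁻¹ n).1 + (cfPQ (Int.fract x)⁻¹ n).2 ∧
    (cfPQ x (n + 1)).2 = (cfPQ (Int.fract x)⁻¹ n).1 := by
  induction n using Nat.twoStepInduction with
  | zero => simp [cfPQ, cfb]; ring
  | one => simp [cfPQ, cfb]; ring
  | more n ih1 ih2 =>
    rw [cfPQ, ih2.1, ih2.2, ih1.1, ih1.2]
    simp only [cfPQ]
    have : cfb (n + 1 + 2) x = cfb (n + 2) (Int.fract x)⁻¹ := rfl
    rw [this]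
    exact ⟨by ring, rfl⟩

theorem cfConv_zero (x : ℝ) : cfConv x 0 = ⌊x⌋ := by simp [cfConv, cfPQ, cfb]

theorem Irrational.fract {x : ℝ} (hx : Irrational x) : Irrational (Int.fract x) :=
  hx.sub_intCast ⌊x⌋

theorem Irrational.fract_pos {x : ℝ} (hx : Irrational x) : 0 < Int.fract x := by
  refine lt_of_le_of_ne (Int.fract_nonneg x) fun h => hx.ne_int ⌊x⌋ ?_
  have := Int.floor_add_fract x
  rw [← h] at this
  simpa using this.symm

theorem cfConv_succ {x : ℝ} (hx : Irrational x) (n : ℕ) :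
    cfConv x (n + 1) = ⌊x⌋ + (cfConv (Int.fract x)⁻¹ n)⁻¹ := by
  have h1 : 1 ≤ (Int.fract x)⁻¹ :=
    (one_le_inv₀ hx.fract_pos).mpr (Int.fract_lt_one x).le
  have hP : ((cfPQ (Int.fract x)⁻¹ n).1 : ℚ) ≠ 0 := by
    have := one_le_cfPQ_fst h1 n
    exact_mod_cast (by omega : (cfPQ (Int.fract x)⁻¹ n).1 ≠ 0)
  simp only [cfConv, (cfPQ_succ x n).1, (cfPQ_succ x n).2]
  push_cast
  generalize ((cfPQ (Int.fract x)⁻¹ n).1 : ℚ) = P at *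
  field_simp

theorem cfConv_add_int {x : ℝ} (hx : Irrational x) (m : ℤ) (n : ℕ) :
    cfConv (x + m) n = cfConv x n + m := by
  cases n with
  | zero => simp [cfConv_zero]
  | succ n =>
    rw [cfConv_succ hx, cfConv_succ (hx.add_intCast m), Int.fract_add_intCast, Int.floor_add_intCast]
    push_cast; ring

theorem cfConv_inv {x : ℝ} (hx : Irrational x) (h1 : 1 < x) (n : ℕ) :
    cfConv x⁻¹ (n + 1) = (cfConv x n)⁻¹ := by
  have h0 : ⌊x⁻¹⌋ = 0 := Int.floor_eq_zero_iff.mpr ⟨by positivity, inv_lt_one_of_one_lt₀ h1⟩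
  have hf : Int.fract x⁻¹ = x⁻¹ :=
    Int.fract_eq_self.mpr ⟨by positivity, inv_lt_one_of_one_lt₀ h1⟩
  rw [cfConv_succ hx.inv, h0, hf, inv_inv]
  simp

theorem cfConv_nonneg {x : ℝ} (hx : 0 ≤ x) (n : ℕ) : 0 ≤ cfConv x n := by
  have h : ∀ n, 0 ≤ (cfPQ x n).1 ∧ 0 ≤ (cfPQ x n).2 := by
    have hb : ∀ n, 0 ≤ cfb n x := fun n => cfb_nonneg n hx
    intro n
    induction n using Nat.twoStepInduction with
    | zero => exact ⟨hb 0, zero_le_one⟩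
    | one => exact ⟨add_nonneg (mul_nonneg (hb 1) (hb 0)) zero_le_one, hb 1⟩
    | more n ih1 ih2 =>
      exact ⟨add_nonneg (mul_nonneg (hb _) ih2.1) ih1.1, add_nonneg (mul_nonneg (hb _) ih2.2) ih1.2⟩
  exact div_nonneg (by exact_mod_cast (h n).1) (by exact_mod_cast (h n).2)

theorem one_le_cfConv {x : ℝ} (hx : Irrational x) (h1 : 1 < x) (n : ℕ) : 1 ≤ cfConv x n := by
  have hfl : (1 : ℤ) ≤ ⌊x⌋ := Int.le_floor.mpr (by simpa using h1.le)
  have e : cfConv x n = cfConv (Int.fract x + ⌊x⌋) n := by rw [add_comm, Int.floor_add_fract]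
  rw [e, cfConv_add_int hx.fract]
  have h2 : (1 : ℚ) ≤ ⌊x⌋ := by exact_mod_cast hfl
  linarith [cfConv_nonneg (Int.fract_nonneg x) n]

theorem cfConv_neg_of_mem_Ioo {x : ℝ} (hx : Irrational x) (hx0 : 0 < x) (hx1 : x < 1) :
    ∃ M N : ℕ, ∀ j, cfConv (-x) (j + M) = -cfConv x (j + N) := by
  have hirr1 : Irrational (1 - x) := by simpa using hx.intCast_sub 1
  have hneg : ∀ j, cfConv (-x) j = cfConv (1 - x) j - 1 := fun j => by
    have := cfConv_add_int hirr1 (-1) j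
    rw [show (1 - x) + ((-1 : ℤ) : ℝ) = -x by push_cast; ring] at this
    rw [this]; push_cast; ring
  have hinv : ∀ {z : ℝ}, Irrational z → 0 < z → z < 1 → ∀ j,
      cfConv z (j + 1) = (cfConv z⁻¹ j)⁻¹ := fun {z} hz h0 h1 j => by
    have := cfConv_inv hz.inv ((one_lt_inv₀ h0).mpr h1) j
    rwa [inv_inv] at this
  have key : ∀ {z : ℝ}, Irrational z → 0 < z → z < 1 / 2 → ∀ j,
      cfConv (1 - z) (j + 2) = 1 - cfConv z (j + 1) := fun {z} hz h0 h1 j => by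
    have hz1 : Irrational (1 - z) := by simpa using hz.intCast_sub 1
    have hw : Irrational (z⁻¹ - 1) := by simpa using hz.inv.sub_intCast 1
    have h2 : 2 < z⁻¹ := by rw [lt_inv_comm₀ (by norm_num) h0]; linarith
    have e : (1 - z)⁻¹ = (z⁻¹ - 1)⁻¹ + ((1 : ℤ) : ℝ) := by
      have a1 : 1 - z ≠ 0 := by linarith
      rw [show z⁻¹ - 1 = (1 - z) / z by field_simp, inv_div]
      field_simp
      push_cast; ring
    have e2 : cfConv z⁻¹ j = cfConv (z⁻¹ - 1) j + 1 := by
      have := cfConv_add_int hw 1 j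
      simpa using this
    have hc := one_le_cfConv hw (by linarith) j
    rw [hinv hz1 (by linarith) (by linarith), e, cfConv_add_int hw.inv, cfConv_inv hw (by linarith),
      hinv hz h0 (by linarith), e2]
    generalize cfConv (z⁻¹ - 1) j = c at *
    push_cast
    field_simp
    ring
  rcases lt_or_ge x (1 / 2) with hlt | hge
  · exact ⟨2, 1, fun j => by rw [hneg, key hx hx0 hlt]; ring⟩
  · have hne : x ≠ 1 / 2 := by
      have := hx.ne_rat (1 / 2)
      simpa using this
    have hgt : 1 - x < 1 / 2 := by linarith [lt_of_le_of_ne hge hne.symm]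
    refine ⟨1, 2, fun j => ?_⟩
    have := key hirr1 (by linarith) hgt j
    rw [sub_sub_cancel] at this
    rw [hneg, this]; ring

/-- Up to a shift of the index, the convergents of `-x` are the opposites of those of `x`. -/
theorem cfConv_neg {x : ℝ} (hx : Irrational x) :
    ∃ M N : ℕ, ∀ j, cfConv (-x) (j + M) = -cfConv x (j + N) := by
  have hf := hx.fract
  obtain ⟨M, N, h⟩ := cfConv_neg_of_mem_Ioo hf hx.fract_pos (Int.fract_lt_one x)
  refine ⟨M, N, fun j => ?_⟩
  have e : x = Int.fract x + ⌊x⌋ := by rw [add_comm, Int.floor_add_fract]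
  have e1 : -x = -Int.fract x + ((-⌊x⌋ : ℤ) : ℝ) := by push_cast; linarith
  have h2 : cfConv x (j + N) = cfConv (Int.fract x) (j + N) + ⌊x⌋ := by
    rw [← cfConv_add_int hf, ← e]
  rw [h2, e1, cfConv_add_int hf.neg, h]
  push_cast; ring

theorem measurable_cfConv (n : ℕ) : Measurable fun x => cfConv x n := by
  have hb : ∀ n, Measurable (cfb n) := by
    intro n
    induction n with
    | zero => exact Int.measurable_floor
    | succ n ih => exact ih.comp (measurable_fract.inv)
  have h : ∀ n, Measurable fun x => cfPQ x n := by
    intro n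
    induction n using Nat.twoStepInduction with
    | zero => exact (hb 0).prodMk measurable_const
    | one => exact (((hb 1).mul (hb 0)).add_const 1).prodMk (hb 1)
    | more n ih1 ih2 =>
      exact (((hb _).mul ih2.fst).add ih1.fst).prodMk (((hb _).mul ih2.snd).add ih1.snd)
  have hd : Measurable fun p : ℤ × ℤ => ((p.1 : ℚ) / (p.2 : ℚ)) := Measurable.of_discrete
  exact hd.comp (h n)

/-! ### Inverse branches of the iterated Gauss map -/

/-- The Möbius transformation `y ↦ (p + p' y) / (q + q' y)`. -/
def moebius {K : Type*} [Field K] (p p' q q' : ℕ) (y : K) : K := (p + p' * y) / (q + q' * y)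

/-- An inverse branch `y ↦ (p + p' y) / (q + q' y)` of an even iterate of the Gauss map,
together with the iterated reciprocity relation that `f` satisfies along it. -/
structure Branch (f : ℚ → ℂ) (k : ℂ) where
  (p p' q q' shift : ℕ)
  H : ℝ → ℂ
  det : p' * q = p * q' + 1
  le : q' ≤ q
  sum_le : p + p' ≤ q + q'
  analytic : ∀ y : ℝ, 0 < y → y < 1 → AnalyticAt ℝ H y
  recip : ∀ r : ℚ, 0 < r → r < 1 →
    f (moebius p p' q q' r) = H r + ((q + q' * r : ℝ) : ℂ) ^ k * f r
  conv : ∀ y : ℝ, Irrational y → 0 < y → y < 1 → ∀ j,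
    cfConv (moebius p p' q q' y) (j + shift) = moebius p p' q q' (cfConv y j)

namespace Branch

variable {f : ℚ → ℂ} {k : ℂ} (B : Branch f k)

theorem q_pos : 0 < B.q := by
  rcases Nat.eq_zero_or_pos B.q with h | h
  · have := B.det
    simp [h] at this
  · exact h

theorem p_lt_q : B.p < B.q := by
  by_contra! h
  have h1 : B.p' ≤ B.q' := by have := B.sum_le; omega
  have := B.det
  nlinarith

theorem denom_pos {K : Type*} [Field K] [LinearOrder K] [IsStrictOrderedRing K] {y : K}
    (h0 : 0 ≤ y) : 0 < (B.q + B.q' * y : K) := by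
  have : (0 : K) < B.q := by exact_mod_cast B.q_pos
  positivity

theorem denom_mul {K : Type*} [Field K] [LinearOrder K] [IsStrictOrderedRing K] (a b : ℕ) {y : K}
    (h0 : 0 ≤ y) : (B.q + B.q' * ((b + y) / (1 + a * b + a * y)) : K) * (1 + a * b + a * y) =
      ((B.q * (1 + a * b) + B.q' * b : ℕ) : K) + ((B.q * a + B.q' : ℕ) : K) * y := by
  have hD : 0 < 1 + a * b + a * y := by positivity
  push_cast
  field_simp
  ring

theorem moebius_comp {K : Type*} [Field K] [LinearOrder K] [IsStrictOrderedRing K] (a b : ℕ) {y : K}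
    (h0 : 0 ≤ y) : moebius (B.p * (1 + a * b) + B.p' * b) (B.p * a + B.p')
      (B.q * (1 + a * b) + B.q' * b) (B.q * a + B.q') y =
      moebius B.p B.p' B.q B.q' ((b + y) / (1 + a * b + a * y)) := by
  have hD : 0 < 1 + a * b + a * y := by positivity
  have hd := B.denom_pos (show 0 ≤ (b + y) / (1 + a * b + a * y) by positivity)
  rw [moebius, moebius, ← B.denom_mul a b h0, div_eq_div_iff (by positivity) hd.ne']
  push_cast
  field_simp
  ring

/-- The branch of the identity. -/
def id (f : ℚ → ℂ) (k : ℂ) : Branch f k where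
  p := 0
  p' := 1
  q := 1
  q' := 0
  shift := 0
  H := 0
  det := rfl
  le := zero_le_one
  sum_le := le_rfl
  analytic _ _ _ := analyticAt_const
  recip r _ _ := by simp [moebius]
  conv y _ _ _ j := by simp [moebius]

end Branch

theorem Complex.inv_ofReal_cpow_neg {x : ℝ} (hx : 0 < x) (k : ℂ) :
    ((x⁻¹ : ℝ) : ℂ) ^ (-k) = (x : ℂ) ^ k := by
  rw [Complex.ofReal_inv, Complex.inv_cpow, Complex.cpow_neg, inv_inv]
  rw [Complex.arg_ofReal_of_nonneg hx.le]
  exact Real.pi_pos.ne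

theorem AnalyticAt.ofReal_cpow {g : ℝ → ℝ} {y : ℝ} (hg : AnalyticAt ℝ g y) (hy : 0 < g y) (k : ℂ) :
    AnalyticAt ℝ (fun y => ((g y : ℝ) : ℂ) ^ k) y := by
  have h1 : AnalyticAt ℝ (fun z : ℂ => z ^ k) (g y : ℂ) :=
    (analyticAt_id.cpow analyticAt_const (Complex.ofReal_mem_slitPlane.mpr hy)).restrictScalars
  exact h1.comp (f := fun y => ((g y : ℝ) : ℂ)) ((Complex.ofRealCLM.analyticAt _).comp hg)

section Reciprocity

variable {f : ℚ → ℂ} {h : ℝ → ℂ} {k : ℂ}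

theorem weak_periodicity_pos (hper : ∀ x : ℚ, x ∉ Set.Icc (-1 : ℚ) 0 → f (x + 1) = f x)
    {r : ℚ} (hr : 0 < r) (m : ℕ) : f (m + r) = f r := by
  induction m with
  | zero => simp
  | succ m ih =>
    rw [← ih, ← hper (m + r) (fun hm => absurd hm.2 (by push Not; positivity))]
    congr 1; push_cast; ring

theorem weak_periodicity_neg (hper : ∀ x : ℚ, x ∉ Set.Icc (-1 : ℚ) 0 → f (x + 1) = f x)
    {r : ℚ} (hr : 0 < r) (m : ℕ) : f (-(m + r)) = f (-r) := by
  induction m with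
  | zero => simp
  | succ m ih =>
    rw [← ih, ← hper (-((m + 1 : ℕ) + r))]
    · congr 1; push_cast; ring
    · intro hm
      have := hm.1
      push_cast at this
      have : (0 : ℚ) ≤ m := by positivity
      linarith

theorem reciprocity_sq (hper : ∀ x : ℚ, x ∉ Set.Icc (-1 : ℚ) 0 → f (x + 1) = f x)
    (hrec : ∀ x : ℚ, x ∈ Set.Icc (-1 : ℚ) 1 → x ≠ 0 →
      f x - ((|((x : ℚ) : ℝ)| : ℝ) : ℂ) ^ (-k) * f (-1 / x) = h x)
    {a b : ℕ} (ha : 0 < a) (hb : 0 < b) {r : ℚ} (hr : 0 < r) :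
    f ((b + r) / (1 + a * b + a * r)) =
      (h ((b + r) / (1 + a * b + a * r) : ℝ) +
        (((b + r) / (1 + a * b + a * r) : ℝ) : ℂ) ^ (-k) * h (-(b + r : ℝ)⁻¹)) +
      ((1 + a * b + a * r : ℝ) : ℂ) ^ k * f r := by
  have hrR : (0 : ℝ) < r := by exact_mod_cast hr
  have ha1 : (1 : ℚ) ≤ a := by exact_mod_cast ha
  have hb1 : (1 : ℚ) ≤ b := by exact_mod_cast hb
  have hD : (0 : ℚ) < 1 + a * b + a * r := by positivity
  have hDR : (0 : ℝ) < 1 + a * b + a * r := by positivity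
  have hb0 : (0 : ℚ) < b + r := by positivity
  have hbR : (0 : ℝ) < b + r := by positivity
  have hu0 : (0 : ℚ) < (b + r) / (1 + a * b + a * r) := by positivity
  have hu1 : ((b : ℚ) + r) / (1 + a * b + a * r) ≤ 1 := by
    rw [div_le_one hD]; nlinarith
  have hv0 : (0 : ℚ) < (b + r)⁻¹ := by positivity
  have hv1 : ((b : ℚ) + r)⁻¹ ≤ 1 := inv_le_one_of_one_le₀ (by linarith)
  have e1 := hrec _ ⟨by linarith, hu1⟩ hu0.ne'
  have e2 := hrec (-(b + r)⁻¹) ⟨by linarith, by linarith⟩ (by linarith)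
  have i1 : (-1 : ℚ) / ((b + r) / (1 + a * b + a * r)) = -(a + (b + r)⁻¹) := by
    field_simp; ring
  have i2 : (-1 : ℚ) / (-(b + r)⁻¹) = b + r := by field_simp
  rw [i1, weak_periodicity_neg hper hv0] at e1
  rw [i2, weak_periodicity_pos hper hr] at e2
  push_cast at e1 e2
  rw [abs_of_pos (by positivity)] at e1
  rw [abs_neg, abs_of_pos (by positivity)] at e2
  rw [← Complex.inv_ofReal_cpow_neg hDR]
  have e3 : ((1 + a * b + a * r : ℝ)⁻¹) = ((b + r) / (1 + a * b + a * r)) * (b + r : ℝ)⁻¹ := by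
    field_simp
  rw [e3, Complex.ofReal_mul, Complex.mul_cpow_ofReal_nonneg (by positivity) (by positivity)]
  linear_combination e1 + (((b + r) / (1 + a * b + a * r) : ℝ) : ℂ) ^ (-k) * e2

theorem cfConv_sq {y : ℝ} (hy : Irrational y) (hy0 : 0 < y) {a b : ℕ} (ha : 0 < a) (hb : 0 < b)
    (j : ℕ) : cfConv ((b + y) / (1 + a * b + a * y)) (j + 2) =
      (b + cfConv y j) / (1 + a * b + a * cfConv y j) := by
  have ha1 : (1 : ℝ) ≤ a := by exact_mod_cast ha
  have hb1 : (1 : ℝ) ≤ b := by exact_mod_cast hb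
  have hb1' : (1 : ℚ) ≤ b := by exact_mod_cast hb
  have e1 : cfConv ((b : ℝ) + y) j = b + cfConv y j := by
    simpa [add_comm] using cfConv_add_int hy b j
  have i1 : Irrational (b + y) := hy.natCast_add b
  have e2 := cfConv_inv i1 (by linarith) j
  have hv : 0 < ((b : ℝ) + y)⁻¹ := by positivity
  have i2 : Irrational (a + (b + y)⁻¹) := i1.inv.natCast_add a
  have e3 : cfConv (a + ((b : ℝ) + y)⁻¹) (j + 1) = a + cfConv ((b : ℝ) + y)⁻¹ (j + 1) := by
    simpa [add_comm] using cfConv_add_int i1.inv a (j + 1)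
  have e4 := cfConv_inv i2 (by linarith) (j + 1)
  rw [e3, e2, e1] at e4
  have i : ((b + y) / (1 + a * b + a * y) : ℝ) = (a + ((b : ℝ) + y)⁻¹)⁻¹ := by
    field_simp; ring
  have hc := cfConv_nonneg hy0.le j
  rw [i, e4]
  generalize cfConv y j = c at *
  have : 0 < (b : ℚ) + c := by linarith
  have : 0 < (1 + a * b + a * c : ℚ) := by positivity
  field_simp
  ring

/-- Refine a branch by two further partial quotients `a`, `b`. -/
noncomputable def Branch.refine (hper : ∀ x : ℚ, x ∉ Set.Icc (-1 : ℚ) 0 → f (x + 1) = f x)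
    (hrec : ∀ x : ℚ, x ∈ Set.Icc (-1 : ℚ) 1 → x ≠ 0 →
      f x - ((|((x : ℚ) : ℝ)| : ℝ) : ℂ) ^ (-k) * f (-1 / x) = h x)
    (hAnal : AnalyticOnNhd ℝ h (Set.Ioo (-1 : ℝ) 1 \ {0}))
    (B : Branch f k) {a b : ℕ} (ha : 0 < a) (hb : 0 < b) : Branch f k where
  p := B.p * (1 + a * b) + B.p' * b
  p' := B.p * a + B.p'
  q := B.q * (1 + a * b) + B.q' * b
  q' := B.q * a + B.q'
  shift := B.shift + 2
  H y := B.H ((b + y) / (1 + a * b + a * y)) +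
    ((B.q + B.q' * ((b + y) / (1 + a * b + a * y)) : ℝ) : ℂ) ^ k *
      (h ((b + y) / (1 + a * b + a * y)) +
        (((b + y) / (1 + a * b + a * y) : ℝ) : ℂ) ^ (-k) * h (-(b + y)⁻¹))
  det := by
    have := B.det
    zify at this ⊢
    linear_combination this
  le := by
    have h1 := Nat.mul_le_mul_left (B.q * a) hb
    have h2 := Nat.mul_le_mul_left B.q' hb
    have h3 := B.le
    nlinarith
  sum_le := by
    have h1 := Nat.mul_le_mul_left (1 + b) B.sum_le
    obtain ⟨c, rfl⟩ := Nat.exists_eq_add_of_le' ha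
    have h2 := Nat.mul_le_mul_right (c * b + c + 1) B.p_lt_q.le
    nlinarith
  analytic y hy0 hy1 := by
    have ha1 : (1 : ℝ) ≤ a := by exact_mod_cast ha
    have hb1 : (1 : ℝ) ≤ b := by exact_mod_cast hb
    have hD : 0 < 1 + a * b + a * y := by positivity
    have hu : AnalyticAt ℝ (fun y : ℝ => (b + y) / (1 + a * b + a * y)) y :=
      (analyticAt_const.add analyticAt_id).div
        (analyticAt_const.add (analyticAt_const.mul analyticAt_id)) hD.ne'
    have hv : AnalyticAt ℝ (fun y : ℝ => -(b + y)⁻¹) y :=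
      ((analyticAt_const.add analyticAt_id).inv (show (b : ℝ) + y ≠ 0 by positivity)).neg
    have hu0 : 0 < (b + y) / (1 + a * b + a * y) := by positivity
    have hu1 : (b + y) / (1 + a * b + a * y) < 1 := by
      rw [div_lt_one hD]; nlinarith
    have hv0 : 0 < ((b : ℝ) + y)⁻¹ := by positivity
    have hv1 : ((b : ℝ) + y)⁻¹ < 1 := inv_lt_one_of_one_lt₀ (by linarith)
    refine ((B.analytic _ hu0 hu1).comp (f := fun y : ℝ => (b + y) / (1 + a * b + a * y)) hu).add
      ((AnalyticAt.ofReal_cpow (analyticAt_const.add (analyticAt_const.mul hu))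
        (B.denom_pos hu0.le) k).mul
      (((hAnal _ ⟨⟨by linarith, hu1⟩, hu0.ne'⟩).comp
        (f := fun y : ℝ => (b + y) / (1 + a * b + a * y)) hu).add
        ((hu.ofReal_cpow hu0 _).mul
          ((hAnal _ ⟨⟨by linarith, by linarith⟩, ?_⟩).comp
          (f := fun y : ℝ => -(b + y)⁻¹) hv))))
    simpa using hv0.ne'
  recip r hr0 hr1 := by
    have ha1 : (1 : ℚ) ≤ a := by exact_mod_cast ha
    have hb1 : (1 : ℚ) ≤ b := by exact_mod_cast hb
    have hrR : (0 : ℝ) < r := by exact_mod_cast hr0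
    have hD : (0 : ℚ) < 1 + a * b + a * r := by positivity
    have hu0 : 0 < (b + r) / (1 + a * b + a * r) := by positivity
    have hu1 : (b + r) / (1 + a * b + a * r) < 1 := by
      rw [div_lt_one hD]; nlinarith
    have hDR : (0 : ℝ) < 1 + a * b + a * r := by positivity
    have huR : (0 : ℝ) ≤ (b + r) / (1 + a * b + a * r) := by positivity
    have e1 := B.recip _ hu0 hu1
    rw [reciprocity_sq hper hrec ha hb hr0] at e1
    rw [B.moebius_comp a b hr0.le, e1, ← B.denom_mul a b hrR.le, Complex.ofReal_mul,
      Complex.mul_cpow_ofReal_nonneg (B.denom_pos huR).le hDR.le]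
    push_cast
    ring
  conv y hy hy0 hy1 j := by
    have ha1 : (1 : ℝ) ≤ a := by exact_mod_cast ha
    have hb1 : (1 : ℝ) ≤ b := by exact_mod_cast hb
    have hb0 : 0 < b + y := by positivity
    have hD : 0 < 1 + a * b + a * y := by positivity
    have hu0 : 0 < (b + y) / (1 + a * b + a * y) := by positivity
    have hu1 : (b + y) / (1 + a * b + a * y) < 1 := by
      rw [div_lt_one hD]; nlinarith
    have hu : Irrational ((b + y) / (1 + a * b + a * y)) := by
      have e : (b + y) / (1 + a * b + a * y) = (a + (b + y)⁻¹)⁻¹ := by field_simp; ring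
      rw [e]
      exact ((hy.natCast_add b).inv.natCast_add a).inv
    rw [B.moebius_comp a b hy0.le, B.moebius_comp a b (cfConv_nonneg hy0.le j),
      ← cfConv_sq hy hy0 ha hb, ← B.conv _ hu hu0 hu1]
    congr 1
    ring

end Reciprocity

section Limits

variable {f : ℚ → ℂ} {h : ℝ → ℂ} {k : ℂ}

theorem exists_gauss_sq {x : ℝ} (hx : Irrational x) (h0 : 0 < x) (h1 : x < 1) :
    ∃ a b : ℕ, 0 < a ∧ 0 < b ∧ ∃ y : ℝ, Irrational y ∧ 0 < y ∧ y < 1 ∧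
      x = (b + y) / (1 + a * b + a * y) := by
  have step : ∀ {z : ℝ}, Irrational z → 0 < z → z < 1 →
      ∃ a : ℕ, 0 < a ∧ ∃ t : ℝ, Irrational t ∧ 0 < t ∧ t < 1 ∧ z⁻¹ = a + t := by
    intro z hz hz0 hz1
    refine ⟨⌊z⁻¹⌋₊, Nat.floor_pos.mpr ((one_lt_inv₀ hz0).mpr hz1).le, Int.fract z⁻¹,
      hz.inv.fract, hz.inv.fract_pos, Int.fract_lt_one _, ?_⟩
    rw [natCast_floor_eq_intCast_floor (by positivity), Int.floor_add_fract]
  obtain ⟨a, ha, t, ht, ht0, ht1, hxt⟩ := step hx h0 h1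
  obtain ⟨b, hb, y, hy, hy0, hy1, hty⟩ := step ht ht0 ht1
  refine ⟨a, b, ha, hb, y, hy, hy0, hy1, ?_⟩
  rw [← inv_inv x, hxt, ← inv_inv t, hty]
  field_simp
  ring

theorem exists_branch (hper : ∀ x : ℚ, x ∉ Set.Icc (-1 : ℚ) 0 → f (x + 1) = f x)
    (hrec : ∀ x : ℚ, x ∈ Set.Icc (-1 : ℚ) 1 → x ≠ 0 →
      f x - ((|((x : ℚ) : ℝ)| : ℝ) : ℂ) ^ (-k) * f (-1 / x) = h x)
    (hAnal : AnalyticOnNhd ℝ h (Set.Ioo (-1 : ℝ) 1 \ {0}))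
    {x : ℝ} (hx : Irrational x) (h0 : 0 < x) (h1 : x < 1) (n : ℕ) :
    ∃ B : Branch f k, n < B.q ∧ ∃ y : ℝ, Irrational y ∧ 0 < y ∧ y < 1 ∧
      x = moebius B.p B.p' B.q B.q' y := by
  induction n with
  | zero => exact ⟨Branch.id f k, Branch.q_pos _, x, hx, h0, h1, by simp [moebius, Branch.id]⟩
  | succ n ih =>
    obtain ⟨B, hB, y, hy, hy0, hy1, hxy⟩ := ih
    obtain ⟨a, b, ha, hb, z, hz, hz0, hz1, hyz⟩ := exists_gauss_sq hy hy0 hy1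
    refine ⟨B.refine hper hrec hAnal ha hb, ?_, z, hz, hz0, hz1, ?_⟩
    · have h2 : B.q * 1 ≤ B.q * (a * b) := Nat.mul_le_mul_left _ (Nat.mul_pos ha hb)
      simp only [Branch.refine]
      nlinarith
    · rw [hxy, hyz]
      exact (B.moebius_comp a b hz0.le).symm

theorem Branch.moebius_sub (B : Branch f k) {y z : ℝ} (hy : 0 ≤ y) (hz : 0 ≤ z) :
    moebius B.p B.p' B.q B.q' y - moebius B.p B.p' B.q B.q' z =
      (y - z) / ((B.q + B.q' * y) * (B.q + B.q' * z)) := by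
  have h1 := B.denom_pos hy
  have h2 := B.denom_pos hz
  have h3 : (B.p' * B.q : ℝ) = B.p * B.q' + 1 := by exact_mod_cast B.det
  rw [moebius, moebius, div_sub_div _ _ h1.ne' h2.ne']
  congr 1
  linear_combination (y - z) * h3

theorem cfConv_le_one {y : ℝ} (hy : Irrational y) (h0 : 0 < y) (h1 : y < 1) (j : ℕ) :
    cfConv y j ≤ 1 := by
  cases j with
  | zero => simp [cfConv_zero, Int.floor_eq_zero_iff.mpr ⟨h0.le, h1⟩]
  | succ j =>
    have h2 := (one_lt_inv₀ h0).mpr h1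
    have := cfConv_inv hy.inv h2 j
    rw [inv_inv] at this
    rw [this]
    exact inv_le_one_of_one_le₀ (one_le_cfConv hy.inv h2 j)

theorem tendsto_cfConv_of_mem_Ioo {x : ℝ} (hx : Irrational x) (h0 : 0 < x) (h1 : x < 1) :
    Tendsto (fun j => ((cfConv x j : ℚ) : ℝ)) atTop (𝓝 x) := by
  rw [Metric.tendsto_atTop]
  intro ε hε
  obtain ⟨n, hn⟩ := exists_nat_one_div_lt hε
  obtain ⟨B, hB, y, hy, hy0, hy1, hxy⟩ := exists_branch (f := 0) (h := 0) (k := 0)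
    (by simp) (by simp) (fun _ _ => analyticAt_const) hx h0 h1 n
  refine ⟨B.shift, fun j hj => ?_⟩
  obtain ⟨i, rfl⟩ := Nat.exists_eq_add_of_le' hj
  have hc0 : (0 : ℝ) ≤ cfConv y i := by exact_mod_cast cfConv_nonneg hy0.le i
  have hc1 : (cfConv y i : ℝ) ≤ 1 := by exact_mod_cast cfConv_le_one hy hy0 hy1 i
  have e : ((moebius B.p B.p' B.q B.q' (cfConv y i) : ℚ) : ℝ) =
      moebius B.p B.p' B.q B.q' (cfConv y i : ℝ) := by simp [moebius]
  have hq : (n : ℝ) + 1 ≤ B.q := by exact_mod_cast hB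
  have hn0 : (0 : ℝ) ≤ n := n.cast_nonneg
  rw [hxy, B.conv y hy hy0 hy1, e, Real.dist_eq, B.moebius_sub hc0 hy0.le, abs_div]
  refine lt_of_le_of_lt ?_ hn
  have hd0 : (B.q : ℝ) ≤ B.q + B.q' * cfConv y i := le_add_of_nonneg_right (by positivity)
  have hd1 : (B.q : ℝ) ≤ B.q + B.q' * y := le_add_of_nonneg_right (by positivity)
  have hD : (n : ℝ) + 1 ≤ (B.q + B.q' * cfConv y i) * (B.q + B.q' * y) := by nlinarith
  refine div_le_div₀ zero_le_one ?_ (by positivity) (hD.trans (le_abs_self _))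
  rw [abs_le]; constructor <;> linarith

theorem tendsto_cfConv {x : ℝ} (hx : Irrational x) :
    Tendsto (fun j => ((cfConv x j : ℚ) : ℝ)) atTop (𝓝 x) := by
  have h1 := (tendsto_cfConv_of_mem_Ioo hx.fract hx.fract_pos (Int.fract_lt_one x)).add_const
    (⌊x⌋ : ℝ)
  rw [add_comm, Int.floor_add_fract] at h1
  refine h1.congr fun j => ?_
  have := cfConv_add_int hx.fract ⌊x⌋ j
  rw [add_comm (Int.fract x), Int.floor_add_fract] at this
  rw [this]; push_cast; rfl

theorem eventually_cfConv_add_nat (hper : ∀ x : ℚ, x ∉ Set.Icc (-1 : ℚ) 0 → f (x + 1) = f x)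
    {x : ℝ} (hx : Irrational x) (h0 : 0 < x) (m : ℕ) :
    ∀ᶠ j in atTop, f (cfConv (x + m) j) = f (cfConv x j) := by
  filter_upwards [(tendsto_cfConv hx).eventually (lt_mem_nhds h0)] with j hj
  have := cfConv_add_int hx m j
  push_cast at this
  rw [this, add_comm, weak_periodicity_pos hper (by exact_mod_cast hj)]

theorem Branch.tendsto_cfConv_moebius (B : Branch f k) {y : ℝ} (hy : Irrational y) (h0 : 0 < y)
    (h1 : y < 1) {L : ℂ} (hL : Tendsto (fun j => f (cfConv y j)) atTop (𝓝 L)) :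
    Tendsto (fun j => f (cfConv (moebius B.p B.p' B.q B.q' y) j)) atTop
      (𝓝 (B.H y + ((B.q + B.q' * y : ℝ) : ℂ) ^ k * L)) := by
  rw [← tendsto_add_atTop_iff_nat B.shift]
  have ht := tendsto_cfConv hy
  have hw : ContinuousAt (fun y : ℝ => ((B.q + B.q' * y : ℝ) : ℂ) ^ k) y :=
    (AnalyticAt.ofReal_cpow (analyticAt_const.add (analyticAt_const.mul analyticAt_id))
      (B.denom_pos h0.le) k).continuousAt
  have hlim := ((B.analytic y h0 h1).continuousAt.tendsto.comp ht).add
    ((hw.tendsto.comp ht).mul hL)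
  refine hlim.congr' ?_
  filter_upwards [ht.eventually (lt_mem_nhds h0), ht.eventually (gt_mem_nhds h1)] with j hj0 hj1
  rw [B.conv y hy h0 h1, B.recip _ (by exact_mod_cast hj0) (by exact_mod_cast hj1)]
  rfl

end Limits

section Density

variable {f : ℚ → ℂ} {h : ℝ → ℂ} {k : ℂ}

theorem Branch.volume_le (B : Branch f k) {T : Set ℝ} (hT : T ⊆ Set.Ioo 0 1) :
    volume T ≤ ENNReal.ofReal ((B.q + B.q') ^ 2) *
      volume (Set.image (moebius B.p B.p' B.q B.q') T) := by
  set ψ : ℝ → ℝ := moebius B.p B.p' B.q B.q' with hψ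
  have hq : (0 : ℝ) < B.q := by exact_mod_cast B.q_pos
  have key : ∀ y ∈ T, ∀ z ∈ T, dist y z ≤ (B.q + B.q') ^ 2 * dist (ψ y) (ψ z) := by
    intro y hy z hz
    have hy' := hT hy
    have hz' := hT hz
    have h1 := B.denom_pos hy'.1.le
    have h2 := B.denom_pos hz'.1.le
    rw [Real.dist_eq, Real.dist_eq, hψ, B.moebius_sub hy'.1.le hz'.1.le, abs_div,
      abs_of_pos (mul_pos h1 h2), ← mul_div_assoc, le_div_iff₀ (mul_pos h1 h2), mul_comm]
    refine mul_le_mul_of_nonneg_right ?_ (abs_nonneg _)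
    rw [sq]
    refine mul_le_mul ?_ ?_ h2.le (by positivity)
    · exact add_le_add_right (mul_le_of_le_one_right (by positivity) hy'.2.le) _
    · exact add_le_add_right (mul_le_of_le_one_right (by positivity) hz'.2.le) _
  have hinj : Set.InjOn ψ T := fun y hy z hz he => by
    have := key y hy z hz
    rw [he, dist_self, mul_zero] at this
    exact dist_le_zero.mp this
  have hleft := hinj.leftInvOn_invFunOn
  have hlip : LipschitzOnWith (Real.toNNReal ((B.q + B.q') ^ 2)) (Function.invFunOn ψ T) (ψ '' T) := by
    refine LipschitzOnWith.of_dist_le_mul ?_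
    rintro _ ⟨y, hy, rfl⟩ _ ⟨z, hz, rfl⟩
    rw [hleft hy, hleft hz, Real.coe_toNNReal _ (by positivity)]
    exact key y hy z hz
  have := hlip.hausdorffMeasure_image_le (d := 1) zero_le_one
  rw [hleft.image_image, ENNReal.rpow_one, hausdorffMeasure_real] at this
  exact this

theorem exists_branch_volume_le (hper : ∀ x : ℚ, x ∉ Set.Icc (-1 : ℚ) 0 → f (x + 1) = f x)
    (hrec : ∀ x : ℚ, x ∈ Set.Icc (-1 : ℚ) 1 → x ≠ 0 →
      f x - ((|((x : ℚ) : ℝ)| : ℝ) : ℂ) ^ (-k) * f (-1 / x) = h x)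
    (hAnal : AnalyticOnNhd ℝ h (Set.Ioo (-1 : ℝ) 1 \ {0}))
    {S : Set ℝ} (hS : MeasurableSet S) (hpos : volume (S ∩ Set.Ioo 0 1) ≠ 0)
    {ε : ℝ} (hε : 0 < ε) (N : ℕ) :
    ∃ B : Branch f k, N < B.q ∧
      volume {y ∈ Set.Ioo (0 : ℝ) 1 | moebius B.p B.p' B.q B.q' y ∉ S} ≤ ENNReal.ofReal ε := by
  have hdens : ∀ᵐ x ∂(volume.restrict S : Measure ℝ), ∀ w δ : ℕ → ℝ, Tendsto δ atTop (𝓝[>] 0) →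
      (∀ n, x ∈ Metric.closedBall (w n) (δ n)) →
      Tendsto (fun n => volume (S ∩ Metric.closedBall (w n) (δ n)) /
        volume (Metric.closedBall (w n) (δ n))) atTop (𝓝 1) := by
    filter_upwards [IsUnifLocDoublingMeasure.ae_tendsto_measure_inter_div
      (volume : Measure ℝ) S 1] with x hx w δ hδ hw
    exact hx w δ hδ (Eventually.of_forall fun n => by simpa using hw n)
  have hirr : ∀ᵐ x : ℝ, Irrational x :=
    measure_eq_zero_iff_ae_notMem.mp ((Set.countable_range ((↑) : ℚ → ℝ)).measure_zero _)
  obtain ⟨x, ⟨hxS, hx0, hx1⟩, hx, hxd⟩ := ((frequently_ae_mem_iff.mpr hpos).and_eventually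
    (hirr.and ((ae_restrict_iff' hS).mp hdens))).exists
  choose B hB y hy hy0 hy1 hxy using exists_branch (k := k) hper hrec hAnal hx hx0 hx1
  set ψ : ℕ → ℝ → ℝ := fun n => moebius (B n).p (B n).p' (B n).q (B n).q' with hψ
  set w : ℕ → ℝ := fun n => (ψ n 0 + ψ n 1) / 2 with hw
  set δ : ℕ → ℝ := fun n => (ψ n 1 - ψ n 0) / 2 with hδ
  have hq : ∀ n : ℕ, (n : ℝ) + 1 ≤ (B n).q := fun n => by exact_mod_cast hB n
  have hδ' : ∀ n, 2 * δ n = 1 / ((B n).q * ((B n).q + (B n).q')) := fun n => by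
    have := (B n).moebius_sub zero_le_one le_rfl
    simp only [hδ, hψ, mul_div_cancel₀ _ (two_ne_zero' ℝ), this, mul_zero, add_zero, sub_zero,
      mul_one]
    rw [mul_comm]
  have hδ0 : ∀ n, 0 < δ n := fun n => by
    have h1 : (0 : ℝ) < (B n).q := by exact_mod_cast (B n).q_pos
    have : 0 < 2 * δ n := by rw [hδ']; positivity
    linarith
  have hδlim : Tendsto δ atTop (𝓝[>] 0) := by
    refine tendsto_nhdsWithin_iff.mpr ⟨?_, Eventually.of_forall hδ0⟩
    refine squeeze_zero (fun n => (hδ0 n).le) (fun n => ?_) tendsto_one_div_add_atTop_nhds_zero_nat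
    have h2 : 2 * δ n ≤ 1 / ((n : ℝ) + 1) := by
      rw [hδ']
      refine one_div_le_one_div_of_le (by positivity) ?_
      have h3 : (0 : ℝ) ≤ (B n).q' := Nat.cast_nonneg _
      have h4 : (0 : ℝ) ≤ n := Nat.cast_nonneg _
      nlinarith [hq n]
    linarith [hδ0 n]
  have hmem : ∀ n, ∀ z ∈ Set.Ioo (0 : ℝ) 1, ψ n z ∈ Metric.closedBall (w n) (δ n) := by
    intro n z hz
    have h1 := (B n).moebius_sub hz.1.le le_rfl
    have h2 := (B n).moebius_sub zero_le_one hz.1.le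
    have h3 := (B n).denom_pos hz.1.le
    have h4 := (B n).denom_pos (le_refl (0 : ℝ))
    have h5 := (B n).denom_pos (zero_le_one' ℝ)
    have h6 : 0 ≤ ψ n z - ψ n 0 := h1 ▸ div_nonneg (by linarith [hz.1]) (by positivity)
    have h7 : 0 ≤ ψ n 1 - ψ n z := h2 ▸ div_nonneg (by linarith [hz.2]) (by positivity)
    rw [Real.closedBall_eq_Icc]
    constructor <;> simp only [hw, hδ] <;> linarith
  have hlim := (ENNReal.tendsto_toReal ENNReal.one_ne_top).comp
    (hxd hxS w δ hδlim fun n => by rw [hxy n]; exact hmem n _ ⟨hy0 n, hy1 n⟩)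
  obtain ⟨n, hn, hNn⟩ := ((hlim.eventually
    (lt_mem_nhds (show 1 - ε / 2 < ENNReal.toReal 1 by simp [hε]))).and
      (eventually_ge_atTop N)).exists
  refine ⟨B n, lt_of_le_of_lt hNn (hB n), ?_⟩
  set I := Metric.closedBall (w n) (δ n)
  have hI : volume.real I = 2 * δ n := by
    simp only [I, Measure.real, Real.volume_closedBall]
    exact ENNReal.toReal_ofReal (by linarith [hδ0 n])
  have hIfin : volume I ≠ ⊤ := measure_closedBall_lt_top.ne
  have hsplit : volume.real (I ∩ S) + volume.real (I \ S) = volume.real I :=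
    measureReal_inter_add_sdiff hS hIfin
  have hn' : (1 - ε / 2) * volume.real I < volume.real (I ∩ S) := by
    have h2 : 1 - ε / 2 < volume.real (I ∩ S) / volume.real I := by
      rw [Set.inter_comm I S]
      rw [Function.comp_apply, ENNReal.toReal_div] at hn
      exact hn
    exact (lt_div_iff₀ (by rw [hI]; linarith [hδ0 n])).mp h2
  refine ((B n).volume_le (fun z hz => hz.1)).trans ?_
  have himg : ψ n '' {y ∈ Set.Ioo (0 : ℝ) 1 | ψ n y ∉ S} ⊆ I \ S := by
    rintro _ ⟨z, ⟨hz, hzS⟩, rfl⟩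
    exact ⟨hmem n z hz, hzS⟩
  refine (mul_le_mul_right (measure_mono himg) _).trans ?_
  rw [← ENNReal.ofReal_toReal (measure_ne_top_of_subset Set.sdiff_subset hIfin),
    ← ENNReal.ofReal_mul (by positivity)]
  refine ENNReal.ofReal_le_ofReal ?_
  change _ * volume.real (I \ S) ≤ ε
  have h1 : (0 : ℝ) < (B n).q := by exact_mod_cast (B n).q_pos
  have hle : ((B n).q' : ℝ) ≤ (B n).q := by exact_mod_cast (B n).le
  calc (((B n).q : ℝ) + (B n).q') ^ 2 * volume.real (I \ S)
      ≤ ((B n).q + (B n).q') ^ 2 * (ε / 2 * volume.real I) :=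
        mul_le_mul_of_nonneg_left (by linarith) (by positivity)
    _ = ε / 2 * (((B n).q + (B n).q') / (B n).q) := by rw [hI, hδ']; field_simp
    _ ≤ ε / 2 * 2 := by
        refine mul_le_mul_of_nonneg_left ?_ (by positivity)
        rw [div_le_iff₀ h1]; linarith
    _ = ε := by ring

end Density

section Rigidity

theorem AnalyticOnNhd.eqOn_zero_or_volume_zeros {g : ℝ → ℝ}
    (hg : AnalyticOnNhd ℝ g (Set.Ioo 0 1)) :
    Set.EqOn g 0 (Set.Ioo 0 1) ∨ volume {y ∈ Set.Ioo (0 : ℝ) 1 | g y = 0} = 0 := by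
  by_cases hfr : ∃ z ∈ Set.Ioo (0 : ℝ) 1, ∃ᶠ y in 𝓝[≠] z, g y = 0
  · obtain ⟨z, hz, hfr⟩ := hfr
    exact Or.inl (hg.eqOn_zero_of_preconnected_of_frequently_eq_zero isPreconnected_Ioo hz hfr)
  · push Not at hfr
    refine Or.inr (measure_null_of_locally_null _ fun z hz => ?_)
    have h1 := hfr z hz.1
    rw [eventually_nhdsWithin_iff] at h1
    refine ⟨_, inter_mem_nhdsWithin _ h1, measure_mono_null ?_ (measure_singleton z)⟩
    rintro y ⟨⟨-, hy0⟩, hy⟩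
    by_contra hyz
    exact hy hyz hy0

theorem Complex.ofReal_cpow_re {x : ℝ} (hx : 0 < x) (k : ℂ) :
    ((x : ℂ) ^ k).re = Real.exp (Real.log x * k.re) * Real.cos (Real.log x * k.im) := by
  rw [Complex.cpow_def_of_ne_zero (by exact_mod_cast hx.ne'), ← Complex.ofReal_log hx.le,
    Complex.exp_re, Complex.re_ofReal_mul, Complex.im_ofReal_mul]

theorem Complex.ofReal_cpow_im {x : ℝ} (hx : 0 < x) (k : ℂ) :
    ((x : ℂ) ^ k).im = Real.exp (Real.log x * k.re) * Real.sin (Real.log x * k.im) := by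
  rw [Complex.cpow_def_of_ne_zero (by exact_mod_cast hx.ne'), ← Complex.ofReal_log hx.le,
    Complex.exp_im, Complex.re_ofReal_mul, Complex.im_ofReal_mul]

variable {f : ℚ → ℂ} {h : ℝ → ℂ} {k : ℂ}

/-- The factor `(q + q' y) ^ k` in the iterated reciprocity relation along a branch. -/
noncomputable def Branch.weight (B : Branch f k) (y : ℝ) : ℂ := ((B.q + B.q' * y : ℝ) : ℂ) ^ k

theorem Branch.analyticAt_weight (B : Branch f k) {y : ℝ} (hy : 0 ≤ y) :
    AnalyticAt ℝ B.weight y :=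
  AnalyticAt.ofReal_cpow (analyticAt_const.add (analyticAt_const.mul analyticAt_id))
    (B.denom_pos hy) k

/-- The weights along two branches with different denominators are not everywhere
real-proportional when `k` is not real. -/
theorem Branch.weight_not_proportional {B₁ B₂ : Branch f k} (hlt : B₁.q < B₂.q)
    (hk : k.im ≠ 0) :
    ¬ Set.EqOn (fun y => (B₂.weight y).im * (B₁.weight y).re - (B₁.weight y).im * (B₂.weight y).re)
      0 (Set.Ioo 0 1) := by
  intro hz
  set θ : ℝ → ℝ := fun y =>
    Real.log (B₂.q + B₂.q' * y) * k.im - Real.log (B₁.q + B₁.q' * y) * k.im with hθ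
  have hsin : ∀ y ∈ Set.Ioo (0 : ℝ) 1, Real.sin (θ y) = 0 := by
    intro y hy
    have h1 := hz hy
    simp only [Branch.weight, Complex.ofReal_cpow_re (B₁.denom_pos hy.1.le),
      Complex.ofReal_cpow_re (B₂.denom_pos hy.1.le), Complex.ofReal_cpow_im (B₁.denom_pos hy.1.le),
      Complex.ofReal_cpow_im (B₂.denom_pos hy.1.le), Pi.zero_apply] at h1
    have h2 : Real.exp (Real.log (B₁.q + B₁.q' * y) * k.re) *
        Real.exp (Real.log (B₂.q + B₂.q' * y) * k.re) * Real.sin (θ y) = 0 := by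
      rw [hθ, Real.sin_sub]
      linear_combination h1
    exact (mul_eq_zero.mp h2).resolve_left (by positivity)
  have hmem : (1 / 2 : ℝ) ∈ Set.Ioo (0 : ℝ) 1 := by norm_num
  have hd : ∀ B : Branch f k, HasDerivAt (fun y : ℝ => Real.log (B.q + B.q' * y) * k.im)
      (B.q' / (B.q + B.q' * (1 / 2)) * k.im) (1 / 2) := fun B => by
    have h1 : HasDerivAt (fun y : ℝ => (B.q + B.q' * y : ℝ)) B.q' (1 / 2) := by
      simpa using ((hasDerivAt_id (1 / 2 : ℝ)).const_mul (B.q' : ℝ)).const_add (B.q : ℝ)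
    exact (h1.log (B.denom_pos hmem.1.le).ne').mul_const _
  have hder := ((hd B₂).sub (hd B₁)).sin
  have hder0 : HasDerivAt (fun y => Real.sin (θ y)) 0 (1 / 2) :=
    (hasDerivAt_const (1 / 2 : ℝ) (0 : ℝ)).congr_of_eventuallyEq
      (eventually_of_mem (isOpen_Ioo.mem_nhds hmem) hsin)
  have huniq := hder.unique hder0
  have hcos : Real.cos (θ (1 / 2)) ≠ 0 := fun hc => by
    have := Real.sin_sq_add_cos_sq (θ (1 / 2))
    rw [hc, hsin _ hmem] at this
    norm_num at this
  have hslope := (mul_eq_zero.mp huniq).resolve_left hcos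
  rw [← sub_mul, mul_eq_zero, or_iff_left hk, sub_eq_zero,
    div_eq_div_iff (B₂.denom_pos hmem.1.le).ne' (B₁.denom_pos hmem.1.le).ne'] at hslope
  have hN : B₂.q' * B₁.q = B₁.q' * B₂.q := by
    have : (B₂.q' * B₁.q : ℝ) = B₁.q' * B₂.q := by linear_combination hslope
    exact_mod_cast this
  have hcop : Nat.Coprime B₂.q B₂.q' := by
    refine Nat.Coprime.symm (Nat.isCoprime_iff_coprime.mp ⟨-B₂.p, B₂.p', ?_⟩)
    have := B₂.det
    zify at this
    linear_combination this
  have hdvd : B₂.q ∣ B₁.q := hcop.dvd_of_dvd_mul_left (hN ▸ Dvd.intro_left _ rfl)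
  exact absurd (Nat.le_of_dvd B₁.q_pos hdvd) (by omega)

/-- The set of points along whose convergents `φ ∘ f` tends to `α`. -/
def levelSet (f : ℚ → ℂ) (φ : ℂ →ₗ[ℝ] ℝ) (α : ℝ) : Set ℝ :=
  {x | Tendsto (fun j => φ (f (cfConv x j))) atTop (𝓝 α)}

theorem measurableSet_levelSet (f : ℚ → ℂ) (φ : ℂ →ₗ[ℝ] ℝ) (α : ℝ) :
    MeasurableSet (levelSet f φ α) := by
  have hm : ∀ j, Measurable fun x => φ (f (cfConv x j)) := fun j =>
    (measurable_from_top (f := fun r : ℚ => φ (f r))).comp (measurable_cfConv j)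
  exact measurableSet_tendsto (𝓝 α) hm

theorem mem_levelSet_iff {φ : ℂ →ₗ[ℝ] ℝ} {α : ℝ} {x : ℝ} {L : ℂ}
    (hL : Tendsto (fun j => f (cfConv x j)) atTop (𝓝 L)) : x ∈ levelSet f φ α ↔ φ L = α := by
  have hφ := ((φ.continuous_of_finiteDimensional.tendsto L).comp hL)
  exact ⟨fun hx => tendsto_nhds_unique hφ hx, fun hx => hx ▸ hφ⟩

theorem mem_levelSet_add_nat (hper : ∀ x : ℚ, x ∉ Set.Icc (-1 : ℚ) 0 → f (x + 1) = f x)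
    {φ : ℂ →ₗ[ℝ] ℝ} {α : ℝ} {x : ℝ} (hx : Irrational x) (h0 : 0 < x) (m : ℕ) :
    x + m ∈ levelSet f φ α ↔ x ∈ levelSet f φ α :=
  tendsto_congr' ((eventually_cfConv_add_nat hper hx h0 m).mono fun j hj => by simp only [hj])

theorem volume_unitInterval_diff_levelSet
    (hper : ∀ x : ℚ, x ∉ Set.Icc (-1 : ℚ) 0 → f (x + 1) = f x)
    (hrec : ∀ x : ℚ, x ∈ Set.Icc (-1 : ℚ) 1 → x ≠ 0 →
      f x - ((|((x : ℚ) : ℝ)| : ℝ) : ℂ) ^ (-k) * f (-1 / x) = h x)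
    (hAnal : AnalyticOnNhd ℝ h (Set.Ioo (-1 : ℝ) 1 \ {0}))
    {X : Set ℝ} (hXirr : ∀ x ∈ X, Irrational x) (hXfull : volume Xᶜ = 0) {F : ℝ → ℂ}
    (hFlim : ∀ x ∈ X, Tendsto (fun j : ℕ => f (cfConv x j)) atTop (nhds (F x)))
    (φ : ℂ →ₗ[ℝ] ℝ) (α : ℝ) (hpos : volume (levelSet f φ α ∩ Set.Ioo 0 1) ≠ 0) :
    volume (Set.Ioo 0 1 \ levelSet f φ α) = 0 := by
  set S := levelSet f φ α with hSdef
  have hS : MeasurableSet S := measurableSet_levelSet f φ α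
  by_contra hne
  obtain ⟨r, -, hr0, hr⟩ := ENNReal.lt_iff_exists_real_btwn.mp
    (lt_min (pos_iff_ne_zero.mpr hpos) (pos_iff_ne_zero.mpr hne))
  rw [ENNReal.ofReal_pos] at hr0
  obtain ⟨hrS, hrS'⟩ := lt_min_iff.mp hr
  obtain ⟨B₁, -, hB₁⟩ := exists_branch_volume_le (k := k) hper hrec hAnal hS hpos (half_pos hr0) 0
  obtain ⟨B₂, hlt, hB₂⟩ := exists_branch_volume_le (k := k) hper hrec hAnal hS hpos
    (half_pos hr0) B₁.q
  set bad : Set ℝ := {y ∈ Set.Ioo (0 : ℝ) 1 | moebius B₁.p B₁.p' B₁.q B₁.q' y ∉ S} ∪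
    {y ∈ Set.Ioo (0 : ℝ) 1 | moebius B₂.p B₂.p' B₂.q B₂.q' y ∉ S} ∪ Xᶜ with hbad
  have hbadle : volume bad ≤ ENNReal.ofReal r := by
    refine (measure_union_le _ _).trans ?_
    rw [hXfull, add_zero]
    refine (measure_union_le _ _).trans ((add_le_add hB₁ hB₂).trans_eq ?_)
    rw [← ENNReal.ofReal_add (by positivity) (by positivity), add_halves]
  have hgood : ∀ y ∈ Set.Ioo (0 : ℝ) 1, y ∉ bad → y ∈ X ∧
      φ (B₁.weight y * F y) = α - φ (B₁.H y) ∧ φ (B₂.weight y * F y) = α - φ (B₂.H y) := by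
    intro y hy hyb
    simp only [hbad, Set.mem_union, not_or, Set.mem_ofPred_eq, not_and, not_not,
      Set.mem_compl_iff] at hyb
    obtain ⟨⟨h1, h2⟩, hyX⟩ := hyb
    have key : ∀ B : Branch f k, moebius B.p B.p' B.q B.q' y ∈ S →
        φ (B.weight y * F y) = α - φ (B.H y) := fun B hB => by
      have := (mem_levelSet_iff
        (B.tendsto_cfConv_moebius (hXirr y hyX) hy.1 hy.2 (hFlim y hyX))).mp hB
      rw [map_add] at this
      rw [Branch.weight]; linarith
    exact ⟨hyX, key _ (h1 hy), key _ (h2 hy)⟩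
  have hφ : ∀ {g : ℝ → ℂ} {y : ℝ}, AnalyticAt ℝ g y → AnalyticAt ℝ (fun y => φ (g y)) y :=
    fun {g y} hg => ((LinearMap.toContinuousLinearMap φ).analyticAt (g y)).comp hg
  have hre : ∀ {g : ℝ → ℂ} {y : ℝ}, AnalyticAt ℝ g y → AnalyticAt ℝ (fun y => (g y).re) y :=
    fun {g y} hg => (Complex.reCLM.analyticAt (g y)).comp hg
  have him : ∀ {g : ℝ → ℂ} {y : ℝ}, AnalyticAt ℝ g y → AnalyticAt ℝ (fun y => (g y).im) y :=
    fun {g y} hg => (Complex.imCLM.analyticAt (g y)).comp hg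
  obtain ⟨s, A, hs, hA, hs0, hsA⟩ : ∃ s A : ℝ → ℝ, AnalyticOnNhd ℝ s (Set.Ioo 0 1) ∧
      AnalyticOnNhd ℝ A (Set.Ioo 0 1) ∧ ¬ Set.EqOn s 0 (Set.Ioo 0 1) ∧
      ∀ y ∈ Set.Ioo (0 : ℝ) 1, y ∉ bad → s y * φ (F y) = A y := by
    by_cases hk : k.im = 0
    · refine ⟨fun y => (B₁.weight y).re, fun y => α - φ (B₁.H y),
        fun y hy => hre (B₁.analyticAt_weight hy.1.le),
        fun y hy => analyticAt_const.sub (hφ (B₁.analytic y hy.1 hy.2)), fun h0 => ?_,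
        fun y hy hyb => ?_⟩
      · have hmem : (1 / 2 : ℝ) ∈ Set.Ioo (0 : ℝ) 1 := by norm_num
        have h1 := h0 hmem
        simp only [Branch.weight, Complex.ofReal_cpow_re (B₁.denom_pos hmem.1.le), hk, mul_zero,
          Real.cos_zero, mul_one, Pi.zero_apply] at h1
        exact (Real.exp_pos _).ne' h1
      · have him0 : (B₁.weight y).im = 0 := by
          rw [Branch.weight, Complex.ofReal_cpow_im (B₁.denom_pos hy.1.le), hk, mul_zero,
            Real.sin_zero, mul_zero]
        have e : B₁.weight y * F y = (B₁.weight y).re • F y := by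
          rw [Complex.real_smul]
          congr 1
          exact Complex.ext (by simp) (by simp [him0])
        dsimp only
        rw [← (hgood y hy hyb).2.1, e, map_smul, smul_eq_mul]
    · refine ⟨_, fun y => (B₂.weight y).im * (α - φ (B₁.H y)) -
          (B₁.weight y).im * (α - φ (B₂.H y)), fun y hy => ?_, fun y hy => ?_,
        Branch.weight_not_proportional hlt hk, fun y hy hyb => ?_⟩
      · have w₁ := B₁.analyticAt_weight hy.1.le
        have w₂ := B₂.analyticAt_weight hy.1.le
        exact ((him w₂).mul (hre w₁)).sub ((him w₁).mul (hre w₂))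
      · have w₁ := B₁.analyticAt_weight hy.1.le
        have w₂ := B₂.analyticAt_weight hy.1.le
        exact ((him w₂).mul (analyticAt_const.sub (hφ (B₁.analytic y hy.1 hy.2)))).sub
          ((him w₁).mul (analyticAt_const.sub (hφ (B₂.analytic y hy.1 hy.2))))
      · obtain ⟨-, e₁, e₂⟩ := hgood y hy hyb
        dsimp only
        rw [← e₁, ← e₂, ← smul_eq_mul, ← smul_eq_mul (_ : ℝ) (φ _), ← smul_eq_mul (_ : ℝ) (φ _),
          ← map_smul, ← map_smul, ← map_smul, ← map_sub]
        congr 1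
        apply Complex.ext <;> simp <;> ring
  have hAs : Set.EqOn (fun y => A y - α * s y) 0 (Set.Ioo 0 1) := by
    refine (AnalyticOnNhd.eqOn_zero_or_volume_zeros
      (fun y hy => (hA y hy).sub (analyticAt_const.mul (hs y hy)))).resolve_right
        fun (h0 : volume {y ∈ Set.Ioo (0 : ℝ) 1 | A y - α * s y = 0} = 0) => ?_
    have hsub : S ∩ Set.Ioo 0 1 ⊆ bad ∪ {y ∈ Set.Ioo (0 : ℝ) 1 | A y - α * s y = 0} := by
      rintro y ⟨hyS, hy⟩
      by_cases hyb : y ∈ bad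
      · exact Or.inl hyb
      · have e := (mem_levelSet_iff (hFlim y (hgood y hy hyb).1)).mp hyS
        exact Or.inr ⟨hy, by rw [← hsA y hy hyb, e]; ring⟩
    have := (measure_mono (μ := volume) hsub).trans (measure_union_le _ _)
    rw [h0, add_zero] at this
    exact absurd (this.trans hbadle) (not_le.mpr hrS)
  have hs_null := (AnalyticOnNhd.eqOn_zero_or_volume_zeros hs).resolve_left hs0
  have hsub : Set.Ioo 0 1 \ S ⊆ bad ∪ {y ∈ Set.Ioo (0 : ℝ) 1 | s y = 0} := by
    rintro y ⟨hy, hyS⟩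
    by_cases hyb : y ∈ bad
    · exact Or.inl hyb
    · refine Or.inr ⟨hy, ?_⟩
      by_contra hsy
      refine hyS ((mem_levelSet_iff (hFlim y (hgood y hy hyb).1)).mpr ?_)
      have e1 := hsA y hy hyb
      have e2 : A y - α * s y = 0 := hAs hy
      exact mul_left_cancel₀ hsy (by linarith)
  have := (measure_mono (μ := volume) hsub).trans (measure_union_le _ _)
  rw [hs_null, add_zero] at this
  exact absurd (this.trans hbadle) (not_le.mpr hrS')

theorem volume_ne_level_eq_zero
    (hper : ∀ x : ℚ, x ∉ Set.Icc (-1 : ℚ) 0 → f (x + 1) = f x)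
    (hrec : ∀ x : ℚ, x ∈ Set.Icc (-1 : ℚ) 1 → x ≠ 0 →
      f x - ((|((x : ℚ) : ℝ)| : ℝ) : ℂ) ^ (-k) * f (-1 / x) = h x)
    (hAnal : AnalyticOnNhd ℝ h (Set.Ioo (-1 : ℝ) 1 \ {0}))
    {X : Set ℝ} (hXirr : ∀ x ∈ X, Irrational x) (hXfull : volume Xᶜ = 0) {F : ℝ → ℂ}
    (hFlim : ∀ x ∈ X, Tendsto (fun j : ℕ => f (cfConv x j)) atTop (nhds (F x)))
    (φ : ℂ →ₗ[ℝ] ℝ) (α : ℝ) (hpos : volume {x | x ∈ X ∧ 0 < x ∧ φ (F x) = α} ≠ 0) :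
    volume {x | x ∈ X ∧ 0 < x ∧ φ (F x) ≠ α} = 0 := by
  have hcover : ∀ T : Set ℝ, volume T = 0 → volume (⋃ m : ℕ, (fun x => x + -(m : ℝ)) ⁻¹' T) = 0 :=
    fun T hT => measure_iUnion_null fun m => by rw [measure_preimage_add_right, hT]
  have hreduce : ∀ x ∈ X, 0 < x → x + -(⌊x⌋₊ : ℝ) ∈ Set.Ioo (0 : ℝ) 1 ∧
      (x + -(⌊x⌋₊ : ℝ) ∈ levelSet f φ α ↔ φ (F x) = α) := by
    intro x hx h0
    have hirr := hXirr x hx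
    have e : x + -(⌊x⌋₊ : ℝ) = Int.fract x := by
      rw [natCast_floor_eq_intCast_floor h0.le, Int.fract, sub_eq_add_neg]
    rw [← mem_levelSet_iff (hFlim x hx), e]
    refine ⟨⟨hirr.fract_pos, Int.fract_lt_one x⟩, ?_⟩
    rw [← mem_levelSet_add_nat hper hirr.fract hirr.fract_pos ⌊x⌋₊, ← e, neg_add_cancel_right]
  refine measure_mono_null ?_ (hcover _ (volume_unitInterval_diff_levelSet hper hrec hAnal hXirr
    hXfull hFlim φ α fun h0 => hpos (measure_mono_null ?_ (hcover _ h0))))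
  · rintro x ⟨hx, hx0, hxα⟩
    obtain ⟨h1, h2⟩ := hreduce x hx hx0
    exact Set.mem_iUnion.mpr ⟨⌊x⌋₊, h1, fun h3 => hxα (h2.mp h3)⟩
  · rintro x ⟨hx, hx0, hxα⟩
    obtain ⟨h1, h2⟩ := hreduce x hx hx0
    exact Set.mem_iUnion.mpr ⟨⌊x⌋₊, h2.mpr hxα, h1⟩

end Rigidity

/-- If `Re k < 0`, `h` satisfies (coh) and is real-analytic on
`(-1,1) \ {0}`, and `φ ∘ f†` is constant on a set of positive measure inside one of the
half-lines `±(0,∞)`, then it is almost everywhere constant on that half-line. -/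
theorem stmt12 (k : ℂ) (hk : k.re < 0) (δ : ℝ) (hδ : 0 < δ)
    (f : ℚ → ℂ) (h : ℝ → ℂ)
    (hper : ∀ x : ℚ, x ∉ Set.Icc (-1 : ℚ) 0 → f (x + 1) = f x)
    (hrec : ∀ x : ℚ, x ∈ Set.Icc (-1 : ℚ) 1 → x ≠ 0 →
      f x - ((|((x : ℚ) : ℝ)| : ℝ) : ℂ) ^ (-k) * f (-1 / x) = h x)
    (hcoh : cohCond δ h)
    (hAnal : AnalyticOnNhd ℝ h (Set.Ioo (-1 : ℝ) 1 \ {0}))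
    (X : Set ℝ) (hXirr : ∀ x ∈ X, Irrational x) (hXfull : volume Xᶜ = 0)
    (F : ℝ → ℂ)
    (hFlim : ∀ x ∈ X, Tendsto (fun j : ℕ => f (cfConv x j)) atTop (nhds (F x)))
    (φ : ℂ →ₗ[ℝ] ℝ) (σ : ℝ) (hσ : σ = 1 ∨ σ = -1)
    (α : ℝ) (Cs : Set ℝ)
    (hCsub : Cs ⊆ {x : ℝ | x ∈ X ∧ 0 < σ * x})
    (hCpos : 0 < volume Cs)
    (hCval : ∀ x ∈ Cs, φ (F x) = α) :
    volume {x : ℝ | x ∈ X ∧ 0 < σ * x ∧ φ (F x) ≠ α} = 0 := by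
  have hsub : Cs ⊆ {x | x ∈ X ∧ 0 < σ * x ∧ φ (F x) = α} :=
    fun x hx => ⟨(hCsub hx).1, (hCsub hx).2, hCval x hx⟩
  have hpos := (hCpos.trans_le (measure_mono hsub)).ne'
  rcases hσ with rfl | rfl
  · simp only [one_mul] at hpos ⊢
    exact volume_ne_level_eq_zero hper hrec hAnal hXirr hXfull hFlim φ α hpos
  · have hneg : ∀ P : ℝ → Prop, volume {x | P (-x)} = volume {x | P x} := fun P =>
      Measure.measure_preimage_neg volume {x | P x}
    rw [← hneg] at hpos ⊢
    simp only [neg_mul_neg, one_mul] at hpos ⊢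
    refine volume_ne_level_eq_zero (f := fun r => f (-r)) (h := fun y => h (-y)) (k := k)
      (X := {x | -x ∈ X}) (F := fun x => F (-x)) (fun x hx => ?_) (fun x hx hx0 => ?_)
      (fun y hy => ?_) (fun x hx => ?_) ?_ (fun x hx => ?_) φ α hpos
    · have := hper (-(x + 1)) fun hm => hx ⟨by linarith [hm.2], by linarith [hm.1]⟩
      rw [← this]
      congr 1
      ring
    · have := hrec (-x) ⟨by linarith [hx.2], by linarith [hx.1]⟩ (neg_ne_zero.mpr hx0)
      push_cast at this
      rw [abs_neg] at this
      rw [← this]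
      congr 3
      ring
    · refine (hAnal (-y) ⟨⟨by linarith [hy.1.2], by linarith [hy.1.1]⟩, ?_⟩).comp
        (f := fun y : ℝ => -y) analyticAt_id.neg
      simpa using hy.2
    · simpa using (hXirr _ hx).neg
    · rw [← hXfull]
      exact hneg fun x => x ∉ X
    · have hirr : Irrational x := by simpa using (hXirr _ hx).neg
      obtain ⟨M, N, hMN⟩ := cfConv_neg hirr
      rw [← tendsto_add_atTop_iff_nat N]
      simp only [← hMN]
      exact (tendsto_add_atTop_iff_nat M).mpr (hFlim _ hx)
end

section
/- For q ≥ 2, let 𝔄_q := {a ∈ ℤ : 0 ≤ a < q, gcd(a,q) = 1, and a/q ∈ 𝔗((log q)·(log log q)²)}. Then |𝔄_q| = φ(q)·(1 + o(1)) as q → ∞, i.e. |𝔄_q|/φ(q) → 1, where φ is Euler's totient function. -/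
open Filter Topology MeasureTheory Set

/-- `m ≤ r(x)`, where `r(x)` is the length of the continued fraction expansion of `x`
(`r(x) = ∞` for irrational `x`). -/
def cfLenGe (x : ℝ) (m : ℕ) : Prop := m = 0 ∨ 1 ≤ cfb m x

/-- The set `𝔗(B)` of reals all of whose partial quotients `b_j`, `1 ≤ j ≤ r(x)`,
satisfy `b_j ≤ max (B, j (log j)²)`. -/
def Tset (B : ℝ) : Set ℝ :=
  {x : ℝ | ∀ j : ℕ, 1 ≤ j → 1 ≤ cfb j x →
    (cfb j x : ℝ) ≤ max B ((j : ℝ) * (Real.log j) ^ 2)}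

lemma cfb_zero_right (n : ℕ) : cfb n 0 = 0 := by
  induction n with
  | zero => simp [cfb]
  | succ n ih => simpa [cfb] using ih

lemma exists_approx_of_complete_quotient (n : ℕ) : ∀ (x y : ℝ) (P P' Q Q' : ℤ), 1 ≤ y → 1 ≤ Q →
    0 ≤ Q' → |Q * P' - P * Q'| = 1 → x * (Q * y + Q') = P * y + P' → 1 ≤ cfb n y →
    ∃ s p : ℤ, 1 ≤ s ∧ (s * x - p : ℝ) ≠ 0 ∧ s * |s * x - p| * cfb n y ≤ 1 := by
  induction n with
  | zero =>
    intro x y P P' Q Q' hy hQ hQ' hdet hx hb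
    have hQR : (1 : ℝ) ≤ Q := by exact_mod_cast hQ
    have hQR' : (0 : ℝ) ≤ Q' := by exact_mod_cast hQ'
    have hden : 0 < Q * y + Q' := by positivity
    have hprod : (Q * x - P) * (Q * y + Q') = ((Q * P' - P * Q' : ℤ) : ℝ) := by
      push_cast
      linear_combination Q * hx
    have habs : |Q * x - P| * (Q * y + Q') = 1 := by
      rw [← abs_of_pos hden, ← abs_mul, hprod, ← Int.cast_abs, hdet, Int.cast_one]
    refine ⟨Q, P, hQ, fun h => by simp [h] at habs, ?_⟩
    have hfl : (cfb 0 y : ℝ) ≤ y := Int.floor_le y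
    calc Q * |Q * x - P| * cfb 0 y = |Q * x - P| * (Q * cfb 0 y) := by ring
      _ ≤ |Q * x - P| * (Q * y + Q') := by
        gcongr
        nlinarith
      _ = 1 := habs
  | succ n ih =>
    intro x y P P' Q Q' hy hQ hQ' hdet hx hb
    rw [cfb] at hb ⊢
    have hf0 : Int.fract y ≠ 0 := fun h => by
      rw [h, inv_zero, cfb_zero_right] at hb
      omega
    have hfl : 1 ≤ ⌊y⌋ := Int.le_floor.2 (by simpa using hy)
    refine ih x (Int.fract y)⁻¹ (P * ⌊y⌋ + P') P (Q * ⌊y⌋ + Q') Q ?_ (by nlinarith) (by omega) ?_ ?_ hb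
    · exact (one_le_inv₀ (lt_of_le_of_ne (Int.fract_nonneg y) hf0.symm)).2 (Int.fract_lt_one y).le
    · rw [← hdet, ← abs_neg]
      congr 1
      ring
    · have hy' : y = ⌊y⌋ + Int.fract y := (Int.floor_add_fract y).symm
      have h1 : x * (Q * (⌊y⌋ + Int.fract y) + Q') = P * (⌊y⌋ + Int.fract y) + P' := by
        rw [← hy']
        exact hx
      push_cast
      field_simp
      linear_combination h1

/-- A partial quotient `b` of `x` yields a convergent `p / s` with `|x - p / s| ≤ 1 / (b s²)`. -/
lemma exists_approx_of_one_le_cfb {j : ℕ} (hj : 1 ≤ j) {x : ℝ} (hb : 1 ≤ cfb j x) :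
    ∃ s p : ℤ, 1 ≤ s ∧ (s * x - p : ℝ) ≠ 0 ∧ s * |s * x - p| * cfb j x ≤ 1 := by
  obtain ⟨n, rfl⟩ := Nat.exists_eq_add_of_le' hj
  rw [cfb] at hb ⊢
  have hf0 : Int.fract x ≠ 0 := fun h => by
    rw [h, inv_zero, cfb_zero_right] at hb
    omega
  refine exists_approx_of_complete_quotient n x (Int.fract x)⁻¹ ⌊x⌋ 1 1 0 ?_ le_rfl le_rfl
    (by simp) ?_ hb
  · exact (one_le_inv₀ (lt_of_le_of_ne (Int.fract_nonneg x) hf0.symm)).2 (Int.fract_lt_one x).le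
  · have hx := Int.floor_add_fract x
    push_cast
    field_simp
    linear_combination -hx

open ArithmeticFunction in
lemma sum_vonMangoldt_div_le (N : ℕ) :
    ∑ n ∈ Finset.Icc 1 N, vonMangoldt n / n ≤ 2 * Real.log N := by
  rcases Nat.eq_zero_or_pos N with rfl | hN
  · simp
  have hswap : ∑ n ∈ Finset.Icc 1 N, ∑ m ∈ Finset.Icc 1 N, (if n ∣ m then vonMangoldt n else 0)
      = ∑ m ∈ Finset.Icc 1 N, Real.log m := by
    rw [Finset.sum_comm]
    refine Finset.sum_congr rfl fun m hm => ?_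
    rw [Finset.mem_Icc] at hm
    rw [← vonMangoldt_sum, ← Finset.sum_filter]
    refine Finset.sum_congr ?_ fun _ _ => rfl
    ext d
    simp only [Finset.mem_filter, Finset.mem_Icc, Nat.mem_divisors]
    refine ⟨fun h => ⟨h.2, by omega⟩, fun h => ⟨⟨Nat.pos_of_dvd_of_pos h.1 (by omega),
      (Nat.le_of_dvd (by omega) h.1).trans hm.2⟩, h.1⟩⟩
  have hlog : ∑ m ∈ Finset.Icc 1 N, Real.log m ≤ N * Real.log N := by
    calc ∑ m ∈ Finset.Icc 1 N, Real.log m ≤ ∑ m ∈ Finset.Icc 1 N, Real.log N := by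
          refine Finset.sum_le_sum fun m hm => ?_
          rw [Finset.mem_Icc] at hm
          exact Real.log_le_log (by exact_mod_cast hm.1) (by exact_mod_cast hm.2)
      _ = N * Real.log N := by simp
  have hterm : ∀ n ∈ Finset.Icc 1 N, (N / 2 : ℝ) * (vonMangoldt n / n) ≤
      ∑ m ∈ Finset.Icc 1 N, (if n ∣ m then vonMangoldt n else 0) := by
    intro n hn
    rw [Finset.mem_Icc] at hn
    rw [← Finset.sum_filter, Finset.sum_const, nsmul_eq_mul]
    have hcard : ((Finset.Icc 1 N).filter (n ∣ ·)).card = N / n := by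
      rw [← Nat.Ioc_filter_dvd_card_eq_div]
      rfl
    rw [hcard]
    have hn0 : (0 : ℝ) < n := by exact_mod_cast hn.1
    have hquot : (N : ℝ) ≤ 2 * ((N / n : ℕ) : ℝ) * n := by
      have h1 : 1 ≤ N / n := (Nat.one_le_div_iff (by omega)).2 hn.2
      have h2 := Nat.div_add_mod N n
      have h3 := Nat.mod_lt N hn.1
      have h4 : N ≤ 2 * (N / n) * n := by nlinarith
      exact_mod_cast h4
    have hΛ : 0 ≤ vonMangoldt n := vonMangoldt_nonneg
    rw [div_mul_div_comm, div_le_iff₀ (by positivity)]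
    nlinarith
  have hmain := Finset.sum_le_sum hterm
  rw [hswap, ← Finset.mul_sum] at hmain
  have hN' : (0 : ℝ) < N := by exact_mod_cast hN
  nlinarith

open ArithmeticFunction in
lemma sum_divisors_vonMangoldt_div_le {q : ℕ} (hq : 1 ≤ Real.log q) :
    ∑ k ∈ q.divisors, vonMangoldt k / k ≤ 2 * Real.log (Real.log q) + 1 := by
  set N := ⌊Real.log q⌋₊
  have hN : 1 ≤ N := Nat.le_floor (by simpa using hq)
  rw [← Finset.sum_filter_add_sum_filter_not q.divisors (fun k => k ≤ N)]
  gcongr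
  · calc ∑ k ∈ q.divisors with k ≤ N, vonMangoldt k / k
        ≤ ∑ k ∈ Finset.Icc 1 N, vonMangoldt k / k := by
          refine Finset.sum_le_sum_of_subset_of_nonneg (fun k hk => ?_) fun k _ _ =>
            div_nonneg vonMangoldt_nonneg (Nat.cast_nonneg k)
          rw [Finset.mem_filter] at hk
          exact Finset.mem_Icc.2 ⟨Nat.pos_of_mem_divisors hk.1, hk.2⟩
      _ ≤ 2 * Real.log N := sum_vonMangoldt_div_le N
      _ ≤ 2 * Real.log (Real.log q) := by
          gcongr
          exact Nat.floor_le (by linarith)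
  · calc ∑ k ∈ q.divisors with ¬ k ≤ N, vonMangoldt k / k
        ≤ ∑ k ∈ q.divisors with ¬ k ≤ N, vonMangoldt k / Real.log q := by
          refine Finset.sum_le_sum fun k hk => ?_
          rw [Finset.mem_filter, not_le] at hk
          exact div_le_div_of_nonneg_left vonMangoldt_nonneg (by linarith)
            (Nat.lt_of_floor_lt hk.2).le
      _ ≤ ∑ k ∈ q.divisors, vonMangoldt k / Real.log q :=
          Finset.sum_le_sum_of_subset_of_nonneg (Finset.filter_subset _ _) fun k _ _ =>
            div_nonneg vonMangoldt_nonneg (by linarith)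
      _ = 1 := by
          rw [← Finset.sum_div, vonMangoldt_sum, div_self (by linarith)]

lemma sum_divisors_dvd_inv_le {q k : ℕ} (hq : q ≠ 0) (hk : k ∣ q) :
    ∑ d ∈ q.divisors with k ∣ d, (d : ℝ)⁻¹ ≤ (k : ℝ)⁻¹ * ∑ d ∈ q.divisors, (d : ℝ)⁻¹ := by
  have hk0 : k ≠ 0 := ne_zero_of_dvd_ne_zero hq hk
  rw [Finset.mul_sum]
  calc ∑ d ∈ q.divisors with k ∣ d, (d : ℝ)⁻¹
      = ∑ d ∈ q.divisors with k ∣ d, (k : ℝ)⁻¹ * ((d / k : ℕ) : ℝ)⁻¹ := by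
        refine Finset.sum_congr rfl fun d hd => ?_
        rw [← mul_inv, ← Nat.cast_mul, Nat.mul_div_cancel' (Finset.mem_filter.1 hd).2]
    _ = ∑ e ∈ (q.divisors.filter (k ∣ ·)).image (· / k), (k : ℝ)⁻¹ * (e : ℝ)⁻¹ := by
        rw [Finset.sum_image]
        intro a ha b hb hab
        simp only [Finset.coe_filter, Set.mem_ofPred_eq] at ha hb
        rw [← Nat.mul_div_cancel' ha.2, ← Nat.mul_div_cancel' hb.2]
        exact congrArg (k * ·) hab
    _ ≤ ∑ e ∈ q.divisors, (k : ℝ)⁻¹ * (e : ℝ)⁻¹ := by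
        refine Finset.sum_le_sum_of_subset_of_nonneg (fun e he => ?_) fun _ _ _ => by positivity
        simp only [Finset.mem_image, Finset.mem_filter, Nat.mem_divisors] at he ⊢
        obtain ⟨d, ⟨⟨hd, -⟩, hkd⟩, rfl⟩ := he
        exact ⟨(Nat.div_dvd_of_dvd hkd).trans hd, hq⟩

open ArithmeticFunction in
lemma sum_divisors_log_div_le (q : ℕ) :
    ∑ d ∈ q.divisors, Real.log d * (d : ℝ)⁻¹ ≤
      (∑ k ∈ q.divisors, vonMangoldt k / k) * ∑ d ∈ q.divisors, (d : ℝ)⁻¹ := by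
  rcases eq_or_ne q 0 with rfl | hq
  · simp
  calc ∑ d ∈ q.divisors, Real.log d * (d : ℝ)⁻¹
      = ∑ d ∈ q.divisors, ∑ k ∈ q.divisors, if k ∣ d then vonMangoldt k * (d : ℝ)⁻¹ else 0 := by
        refine Finset.sum_congr rfl fun d hd => ?_
        rw [Nat.mem_divisors] at hd
        rw [← vonMangoldt_sum, Finset.sum_mul, ← Finset.sum_filter,
          Nat.divisors_filter_dvd_of_dvd hq hd.1]
    _ = ∑ k ∈ q.divisors, vonMangoldt k * ∑ d ∈ q.divisors with k ∣ d, (d : ℝ)⁻¹ := by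
        rw [Finset.sum_comm]
        refine Finset.sum_congr rfl fun k _ => ?_
        rw [Finset.mul_sum, Finset.sum_filter]
    _ ≤ ∑ k ∈ q.divisors, vonMangoldt k * ((k : ℝ)⁻¹ * ∑ d ∈ q.divisors, (d : ℝ)⁻¹) := by
        refine Finset.sum_le_sum fun k hk => ?_
        exact mul_le_mul_of_nonneg_left
          (sum_divisors_dvd_inv_le hq (Nat.dvd_of_mem_divisors hk)) vonMangoldt_nonneg
    _ = _ := by
        rw [Finset.sum_mul]
        exact Finset.sum_congr rfl fun k _ => by ring

lemma sum_Icc_inv_le_one_add_log (N : ℕ) :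
    ∑ k ∈ Finset.Icc 1 N, (k : ℝ)⁻¹ ≤ 1 + Real.log N := by
  have h := harmonic_le_one_add_log N
  rw [harmonic_eq_sum_Icc] at h
  push_cast at h
  exact h

/-- The bound `σ(q) / q = O(log log q)`. -/
lemma sum_divisors_inv_le {q : ℕ} (hq : 1 ≤ Real.log q) :
    ∑ d ∈ q.divisors, (d : ℝ)⁻¹ ≤ 6 + 8 * Real.log (Real.log q) := by
  set M := 2 * Real.log (Real.log q) + 1
  have hll : 0 ≤ Real.log (Real.log q) := Real.log_nonneg hq
  have hM : 1 ≤ M := by simp only [M]; linarith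
  set S := ∑ d ∈ q.divisors, (d : ℝ)⁻¹
  have hS : 0 ≤ S := Finset.sum_nonneg fun _ _ => by positivity
  have hT : ∑ d ∈ q.divisors, Real.log d * (d : ℝ)⁻¹ ≤ M * S :=
    (sum_divisors_log_div_le q).trans
      (mul_le_mul_of_nonneg_right (sum_divisors_vonMangoldt_div_le hq) hS)
  set N := ⌊Real.exp (2 * M)⌋₊
  have hsmall : ∑ d ∈ q.divisors with d ≤ N, (d : ℝ)⁻¹ ≤ 1 + 2 * M := by
    calc ∑ d ∈ q.divisors with d ≤ N, (d : ℝ)⁻¹ ≤ ∑ d ∈ Finset.Icc 1 N, (d : ℝ)⁻¹ := by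
          refine Finset.sum_le_sum_of_subset_of_nonneg (fun k hk => ?_) fun k _ _ => by positivity
          rw [Finset.mem_filter] at hk
          exact Finset.mem_Icc.2 ⟨Nat.pos_of_mem_divisors hk.1, hk.2⟩
      _ ≤ 1 + Real.log N := sum_Icc_inv_le_one_add_log N
      _ ≤ 1 + 2 * M := by
          have hN : 1 ≤ N := Nat.le_floor (by simpa using (by linarith : 0 ≤ M))
          have := Real.log_le_log (by exact_mod_cast hN)
            (Nat.floor_le (Real.exp_pos (2 * M)).le)
          rw [Real.log_exp] at this
          linarith
  have hlarge : 2 * M * ∑ d ∈ q.divisors with ¬ d ≤ N, (d : ℝ)⁻¹ ≤ M * S := by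
    refine le_trans ?_ hT
    rw [Finset.mul_sum]
    refine (Finset.sum_le_sum fun d hd => ?_).trans
      (Finset.sum_le_sum_of_subset_of_nonneg (Finset.filter_subset (fun d => ¬ d ≤ N) _)
        fun d _ _ => mul_nonneg (Real.log_natCast_nonneg d) (by positivity))
    rw [Finset.mem_filter, not_le] at hd
    gcongr
    rw [← Real.log_exp (2 * M)]
    exact Real.log_le_log (Real.exp_pos _) (Nat.lt_of_floor_lt hd.2).le
  have hsplit : S = _ + _ := (Finset.sum_filter_add_sum_filter_not q.divisors (fun k => k ≤ N)
    fun d => (d : ℝ)⁻¹).symm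
  have hM' : M = 2 * Real.log (Real.log q) + 1 := rfl
  have h2 : ∑ d ∈ q.divisors with ¬ d ≤ N, (d : ℝ)⁻¹ ≤ S / 2 := by
    have : M * (2 * ∑ d ∈ q.divisors with ¬ d ≤ N, (d : ℝ)⁻¹) ≤ M * S := by linarith
    linarith [le_of_mul_le_mul_left this (by linarith)]
  linarith

/-- The elements of `[1, Q]` coprime to `m` have the expected logarithmic density, up to
constants. -/
lemma sum_coprime_inv_mul_sum_divisors_inv_le {Q m : ℕ} (hQ : Q ≠ 0) (hm : m ≠ 0) :
    (∑ s ∈ Finset.Icc 1 Q with s.Coprime m, (s : ℝ)⁻¹) * ∑ e ∈ m.divisors, (e : ℝ)⁻¹ ≤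
      1 + Real.log Q + Real.log m := by
  rw [Finset.sum_mul_sum, ← Finset.sum_product']
  have hinj : Set.InjOn (fun x : ℕ × ℕ => x.1 * x.2)
      ((Finset.Icc 1 Q).filter (fun s => s.Coprime m) ×ˢ m.divisors : Finset (ℕ × ℕ)) := by
    have hgcd : ∀ s e : ℕ, s.Coprime m → e ∣ m → Nat.gcd (s * e) m = e := by
      intro s e hs he
      rw [Nat.Coprime.gcd_mul_left_cancel _ hs, Nat.gcd_eq_left he]
    rintro ⟨s, e⟩ h ⟨s', e'⟩ h' heq
    simp only [Finset.coe_product, Set.mem_prod, Finset.mem_coe, Finset.mem_filter,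
      Nat.mem_divisors] at h h' heq
    have hee : e = e' := by
      rw [← hgcd s e h.1.2 h.2.1, heq, hgcd s' e' h'.1.2 h'.2.1]
    subst hee
    have he0 : e ≠ 0 := ne_zero_of_dvd_ne_zero hm h.2.1
    rw [Nat.eq_of_mul_eq_mul_right (Nat.pos_of_ne_zero he0) heq]
  calc _ = ∑ x ∈ (Finset.Icc 1 Q).filter (fun s => s.Coprime m) ×ˢ m.divisors,
        ((x.1 * x.2 : ℕ) : ℝ)⁻¹ := Finset.sum_congr rfl fun x _ => by
          rw [Nat.cast_mul, mul_inv]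
    _ = ∑ k ∈ ((Finset.Icc 1 Q).filter (fun s => s.Coprime m) ×ˢ m.divisors).image
        (fun x : ℕ × ℕ => x.1 * x.2), (k : ℝ)⁻¹ := (Finset.sum_image (f := fun k : ℕ => (k : ℝ)⁻¹) hinj).symm
    _ ≤ ∑ k ∈ Finset.Icc 1 (Q * m), (k : ℝ)⁻¹ := by
        refine Finset.sum_le_sum_of_subset_of_nonneg (fun k hk => ?_) fun _ _ _ => by positivity
        simp only [Finset.mem_image, Finset.mem_product, Finset.mem_filter, Finset.mem_Icc] at hk ⊢
        obtain ⟨⟨s, e⟩, ⟨⟨⟨h1, h2⟩, -⟩, he⟩, rfl⟩ := hk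
        exact ⟨Nat.mul_pos h1 (Nat.pos_of_mem_divisors he),
          Nat.mul_le_mul h2 (Nat.divisor_le he)⟩
    _ ≤ 1 + Real.log (Q * m : ℕ) := sum_Icc_inv_le_one_add_log _
    _ = _ := by
        rw [Nat.cast_mul, Real.log_mul (by exact_mod_cast hQ) (by exact_mod_cast hm), add_assoc]

lemma prod_Icc_one_sub_inv_sq (n : ℕ) :
    ∏ k ∈ Finset.Icc 2 (n + 1), (1 - ((k : ℝ) ^ 2)⁻¹) = (n + 2) / (2 * (n + 1)) := by
  induction n with
  | zero => norm_num
  | succ n ih =>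
    rw [Finset.prod_Icc_succ_top (by omega), ih]
    push_cast
    field_simp
    ring

lemma half_le_prod_one_sub_inv_sq {s : Finset ℕ} (hs : ∀ k ∈ s, 2 ≤ k) :
    1 / 2 ≤ ∏ k ∈ s, (1 - ((k : ℝ) ^ 2)⁻¹) := by
  have hle : ∀ k : ℕ, 1 - ((k : ℝ) ^ 2)⁻¹ ≤ 1 := fun k => sub_le_self 1 (by positivity)
  have hnn : ∀ k : ℕ, 2 ≤ k → 0 ≤ 1 - ((k : ℝ) ^ 2)⁻¹ := fun k hk =>
    sub_nonneg.2 (inv_le_one_of_one_le₀ (one_le_pow₀ (by exact_mod_cast (by omega : 1 ≤ k))))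
  calc (1 / 2 : ℝ) ≤ ((s.sup id : ℕ) + 2) / (2 * ((s.sup id : ℕ) + 1)) := by
        rw [div_le_div_iff₀ (by norm_num) (by positivity)]
        linarith
    _ = ∏ k ∈ Finset.Icc 2 (s.sup id + 1), (1 - ((k : ℝ) ^ 2)⁻¹) :=
        (prod_Icc_one_sub_inv_sq _).symm
    _ ≤ ∏ k ∈ s, (1 - ((k : ℝ) ^ 2)⁻¹) := by
        have hsub : s ⊆ Finset.Icc 2 (s.sup id + 1) := fun k hk =>
          Finset.mem_Icc.2 ⟨hs k hk, (Finset.le_sup (f := id) hk).trans (Nat.le_succ _)⟩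
        rw [← Finset.prod_sdiff hsub]
        refine mul_le_of_le_one_left (Finset.prod_nonneg fun k hk => hnn k (hs k hk)) ?_
        refine Finset.prod_le_one (fun k hk => hnn k ?_) fun k _ => hle k
        exact (Finset.mem_Icc.1 (Finset.mem_sdiff.1 hk).1).1

lemma prod_primeFactors_one_add_inv_le {m : ℕ} (hm : m ≠ 0) :
    ∏ p ∈ m.primeFactors, (1 + (p : ℝ)⁻¹) ≤ ∑ e ∈ m.divisors, (e : ℝ)⁻¹ := by
  rw [Finset.prod_one_add]
  have hinj : Set.InjOn (fun t : Finset ℕ => ∏ p ∈ t, p) (m.primeFactors.powerset) := by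
    intro t ht u hu h
    have hprime : ∀ v : Finset ℕ, v ∈ (m.primeFactors.powerset : Set (Finset ℕ)) →
        (∏ p ∈ v, p).primeFactors = v := fun v hv =>
      Nat.primeFactors_prod fun p hp => Nat.prime_of_mem_primeFactors
        (Finset.mem_powerset.1 hv hp)
    rw [← hprime t ht, ← hprime u hu]
    exact congrArg Nat.primeFactors h
  calc ∑ t ∈ m.primeFactors.powerset, ∏ p ∈ t, (p : ℝ)⁻¹
      = ∑ t ∈ m.primeFactors.powerset, ((∏ p ∈ t, p : ℕ) : ℝ)⁻¹ :=
        Finset.sum_congr rfl fun t _ => by rw [Nat.cast_prod, Finset.prod_inv_distrib]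
    _ = ∑ e ∈ m.primeFactors.powerset.image (fun t => ∏ p ∈ t, p), (e : ℝ)⁻¹ :=
        (Finset.sum_image (f := fun k : ℕ => (k : ℝ)⁻¹) hinj).symm
    _ ≤ ∑ e ∈ m.divisors, (e : ℝ)⁻¹ := by
        refine Finset.sum_le_sum_of_subset_of_nonneg (fun e he => ?_) fun _ _ _ => by positivity
        obtain ⟨t, ht, rfl⟩ := Finset.mem_image.1 he
        exact Nat.mem_divisors.2 ⟨(Finset.prod_dvd_prod_of_subset _ _ _
          (Finset.mem_powerset.1 ht)).trans (Nat.prod_primeFactors_dvd m), hm⟩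

/-- The bound `m² ≤ 2 φ(m) σ(m)`. -/
lemma le_two_mul_totient_mul_sum_divisors_inv {m : ℕ} (hm : m ≠ 0) :
    (m : ℝ) ≤ 2 * m.totient * ∑ e ∈ m.divisors, (e : ℝ)⁻¹ := by
  have htot : (m.totient : ℝ) = m * ∏ p ∈ m.primeFactors, (1 - (p : ℝ)⁻¹) := by
    have h := congrArg (Rat.cast : ℚ → ℝ) (Nat.totient_eq_mul_prod_factors m)
    push_cast at h
    exact h
  have hhalf : 1 / 2 ≤ ∏ p ∈ m.primeFactors, (1 - ((p : ℝ) ^ 2)⁻¹) :=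
    half_le_prod_one_sub_inv_sq fun p hp => (Nat.prime_of_mem_primeFactors hp).two_le
  calc (m : ℝ) ≤ 2 * m * ∏ p ∈ m.primeFactors, (1 - ((p : ℝ) ^ 2)⁻¹) := by
        nlinarith [(Nat.cast_nonneg m : (0 : ℝ) ≤ m)]
    _ = 2 * m.totient * ∏ p ∈ m.primeFactors, (1 + (p : ℝ)⁻¹) := by
        rw [htot, mul_assoc, mul_assoc, mul_assoc, ← Finset.prod_mul_distrib]
        congr 2
        refine Finset.prod_congr rfl fun p _ => ?_
        rw [← inv_pow]
        ring
    _ ≤ _ := by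
        gcongr
        exact prod_primeFactors_one_add_inv_le hm

lemma card_unitsMap_fiber_mul_totient {q m : ℕ} [NeZero q] (h : m ∣ q) (c : (ZMod m)ˣ) :
    (Finset.univ.filter fun u : (ZMod q)ˣ => ZMod.unitsMap h u = c).card * m.totient =
      q.totient := by
  have : NeZero m := ⟨ne_zero_of_dvd_ne_zero (NeZero.ne q) h⟩
  have hsurj := ZMod.unitsMap_surjective h
  rw [← ZMod.card_units_eq_totient q, ← ZMod.card_units_eq_totient m, ← Finset.card_univ,
    ← Finset.card_univ, Finset.card_eq_sum_card_fiberwise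
      (s := Finset.univ) (f := ZMod.unitsMap h) (t := Finset.univ) (by simp),
    Finset.sum_congr rfl fun b _ =>
      MonoidHom.card_fiber_eq_of_mem_range (ZMod.unitsMap h) (hsurj b) (hsurj c)]
  simp [mul_comm]

lemma card_coprime_mul_modEq_mul_totient_le {q m : ℕ} (hq : q ≠ 0) (h : m ∣ q) {s : ℕ}
    (hs : s.Coprime m) (t : ℤ) :
    ((Finset.range q).filter fun a : ℕ => a.Coprime q ∧ (m : ℤ) ∣ a * s - t).card * m.totient ≤
      q.totient := by
  have : NeZero q := ⟨hq⟩
  set A := (Finset.range q).filter fun a : ℕ => a.Coprime q ∧ (m : ℤ) ∣ a * s - t with hA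
  rcases A.eq_empty_or_nonempty with h0 | ⟨b, hb⟩
  · simp [h0]
  rw [hA, Finset.mem_filter] at hb
  set c := ZMod.unitsMap h (ZMod.unitOfCoprime b hb.2.1)
  rw [← card_unitsMap_fiber_mul_totient h c]
  gcongr
  refine (Finset.card_le_card (t := (Finset.univ.filter fun u : (ZMod q)ˣ =>
    ZMod.unitsMap h u = c).image fun u : (ZMod q)ˣ => (u : ZMod q).val) fun a ha => ?_).trans
    Finset.card_image_le
  rw [hA, Finset.mem_filter, Finset.mem_range] at ha
  refine Finset.mem_image.2 ⟨ZMod.unitOfCoprime a ha.2.1, ?_, ?_⟩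
  · rw [Finset.mem_filter]
    refine ⟨Finset.mem_univ _, Units.ext ?_⟩
    have hdvd : (m : ℤ) ∣ s * (a - b) := by
      have h1 := dvd_sub ha.2.2 hb.2.2
      have h2 : ((a * s - t) - (b * s - t) : ℤ) = s * (a - b) := by ring
      rwa [h2] at h1
    have hdvd' : (m : ℤ) ∣ a - b :=
      IsCoprime.dvd_of_dvd_mul_left (Nat.isCoprime_iff_coprime.2 hs.symm) hdvd
    have hab := (ZMod.intCast_zmod_eq_zero_iff_dvd _ m).2 hdvd'
    push_cast at hab
    simpa [c, ZMod.unitsMap_val, ZMod.cast_natCast h] using sub_eq_zero.1 hab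
  · simp [ZMod.val_natCast, Nat.mod_eq_of_lt ha.1]

open scoped Classical in
lemma card_exists_approx_le {q : ℕ} (hq : q ≠ 0) {B : ℝ} (hB : 0 < B) :
    (((Finset.range q).filter fun a : ℕ => a.Coprime q ∧ ∃ (s : ℕ) (t : ℤ), 1 ≤ s ∧ s ≤ q ∧
      t ≠ 0 ∧ s * |(t : ℝ)| * B ≤ q ∧ (q : ℤ) ∣ a * s - t).card : ℝ) ≤
      q.totient * (4 * (1 + 2 * Real.log q) / B * ∑ d ∈ q.divisors, (d : ℝ)⁻¹) := by
  set T : ℕ → ℕ → ℕ := fun d s => ⌊q / (B * s * d ^ 2)⌋₊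
  set A : ℕ → ℕ → ℤ → Finset ℕ := fun m s t =>
    (Finset.range q).filter fun a : ℕ => a.Coprime q ∧ (m : ℤ) ∣ a * s - t
  have hcover : ((Finset.range q).filter fun a : ℕ => a.Coprime q ∧ ∃ (s : ℕ) (t : ℤ), 1 ≤ s ∧
      s ≤ q ∧ t ≠ 0 ∧ s * |(t : ℝ)| * B ≤ q ∧ (q : ℤ) ∣ a * s - t) ⊆
      q.divisors.biUnion fun d =>
        ((Finset.Icc 1 q).filter fun s => s.Coprime (q / d)).biUnion fun s =>
          ((Finset.Icc (-(T d s : ℤ)) (T d s)).erase 0).biUnion fun t => A (q / d) s t := by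
    intro a ha
    rw [Finset.mem_filter] at ha
    obtain ⟨haq, hac, s, t, hs1, hsq, ht, hst, hdvd⟩ := ha
    set d := s.gcd q
    have hd0 : 0 < d := Nat.gcd_pos_of_pos_left q hs1
    obtain ⟨s', hs'⟩ : d ∣ s := Nat.gcd_dvd_left s q
    obtain ⟨m, hm⟩ : d ∣ q := Nat.gcd_dvd_right s q
    have hqd : q / d = m := by
      rw [hm]
      exact Nat.mul_div_cancel_left m hd0
    have hsd : s / d = s' := by
      rw [hs']
      exact Nat.mul_div_cancel_left s' hd0
    have hcop : s'.Coprime m := by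
      rw [← hqd, ← hsd]
      exact Nat.coprime_div_gcd_div_gcd hd0
    have hs'1 : 1 ≤ s' := by
      rcases Nat.eq_zero_or_pos s' with h | h
      · simp [h] at hs'
        omega
      · exact h
    obtain ⟨k, hk⟩ := hdvd
    have htd : t = d * (a * s' - m * k) := by
      have h1 : (s : ℤ) = d * s' := by exact_mod_cast hs'
      have h2 : (q : ℤ) = d * m := by exact_mod_cast hm
      rw [h1, h2] at hk
      linear_combination -hk
    set t' := (a * s' - m * k : ℤ) with ht'
    have hTd : t'.natAbs ≤ T d s' := by
      refine Nat.le_floor ?_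
      rw [Nat.cast_natAbs, Int.cast_abs, le_div_iff₀ (by positivity)]
      have h1 : (s : ℝ) = d * s' := by exact_mod_cast hs'
      have h2 : (t : ℝ) = d * t' := by exact_mod_cast htd
      rw [h1, h2, abs_mul, Nat.abs_cast] at hst
      linarith
    simp only [Finset.mem_biUnion]
    refine ⟨d, Nat.mem_divisors.2 ⟨Nat.gcd_dvd_right s q, hq⟩, s', ?_, t', ?_, ?_⟩
    · rw [hqd, Finset.mem_filter, Finset.mem_Icc]
      exact ⟨⟨hs'1, (Nat.le_of_dvd hs1 ⟨d, by rw [hs', mul_comm]⟩).trans hsq⟩, hcop⟩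
    · rw [Finset.mem_erase, Finset.mem_Icc]
      exact ⟨fun h => ht (by rw [htd, h, mul_zero]), by omega, by omega⟩
    · rw [hqd, Finset.mem_filter]
      exact ⟨haq, hac, k, by rw [ht']; ring⟩
  have hA : ∀ d ∈ q.divisors, ∀ s ∈ (Finset.Icc 1 q).filter fun s => s.Coprime (q / d), ∀ t,
      ((A (q / d) s t).card : ℝ) ≤ q.totient / (q / d).totient := by
    intro d hd s hs t
    have hm := Nat.div_dvd_of_dvd (Nat.dvd_of_mem_divisors hd)
    have hm0 : 0 < q / d := Nat.pos_of_dvd_of_pos hm (Nat.pos_of_ne_zero hq)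
    rw [le_div_iff₀ (by exact_mod_cast Nat.totient_pos.2 hm0)]
    exact_mod_cast card_coprime_mul_modEq_mul_totient_le hq hm (Finset.mem_filter.1 hs).2 t
  have hcardT : ∀ N : ℕ, (((Finset.Icc (-(N : ℤ)) N).erase 0).card : ℝ) = 2 * N := by
    intro N
    rw [Finset.card_erase_of_mem (by simp), Int.card_Icc]
    have : ((N : ℤ) + 1 - -N).toNat - 1 = 2 * N := by omega
    rw [this]
    push_cast
    ring
  calc _ ≤ ∑ d ∈ q.divisors, ∑ s ∈ (Finset.Icc 1 q).filter fun s => s.Coprime (q / d),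
        ∑ t ∈ (Finset.Icc (-(T d s : ℤ)) (T d s)).erase 0, ((A (q / d) s t).card : ℝ) := by
        refine (Nat.cast_le.2 (Finset.card_le_card hcover)).trans ?_
        norm_cast
        exact Finset.card_biUnion_le.trans (Finset.sum_le_sum fun d _ =>
          Finset.card_biUnion_le.trans (Finset.sum_le_sum fun s _ => Finset.card_biUnion_le))
    _ ≤ ∑ d ∈ q.divisors, ∑ s ∈ (Finset.Icc 1 q).filter fun s => s.Coprime (q / d),
        2 * (q / (B * s * d ^ 2)) * (q.totient / (q / d).totient) := by
        refine Finset.sum_le_sum fun d hd => Finset.sum_le_sum fun s hs => ?_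
        refine (Finset.sum_le_sum fun t _ => hA d hd s hs t).trans ?_
        rw [Finset.sum_const, nsmul_eq_mul, hcardT]
        gcongr
        exact Nat.floor_le (by positivity)
    _ ≤ ∑ d ∈ q.divisors, q.totient * (4 * (1 + 2 * Real.log q) / B * (d : ℝ)⁻¹) := by
        refine Finset.sum_le_sum fun d hd => ?_
        obtain ⟨m, rfl⟩ := Nat.dvd_of_mem_divisors hd
        have hd0 : 0 < d := Nat.pos_of_mem_divisors hd
        have hm0 : 0 < m := Nat.pos_of_ne_zero fun h => hq (by simp [h])
        rw [Nat.mul_div_cancel_left m hd0]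
        set H := ∑ s ∈ Finset.Icc 1 (d * m) with s.Coprime m, (s : ℝ)⁻¹
        set S := ∑ e ∈ m.divisors, (e : ℝ)⁻¹
        have hH : 0 ≤ H := Finset.sum_nonneg fun _ _ => by positivity
        have hHS : H * S ≤ 1 + 2 * Real.log (d * m : ℕ) := by
          have h1 : H * S ≤ _ := sum_coprime_inv_mul_sum_divisors_inv_le hq hm0.ne'
          have h2 : Real.log m ≤ Real.log (d * m : ℕ) :=
            Real.log_le_log (by exact_mod_cast hm0) (by exact_mod_cast Nat.le_mul_of_pos_left m hd0)
          linarith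
        have hmS : (m : ℝ) ≤ 2 * m.totient * S := le_two_mul_totient_mul_sum_divisors_inv hm0.ne'
        have hφ : (0 : ℝ) < m.totient := by exact_mod_cast Nat.totient_pos.2 hm0
        have hmR : (0 : ℝ) < m := by exact_mod_cast hm0
        have hdR : (0 : ℝ) < d := by exact_mod_cast hd0
        have hHm : H / m.totient ≤ 2 * (1 + 2 * Real.log (d * m : ℕ)) / m := by
          rw [div_le_div_iff₀ hφ hmR]
          nlinarith
        calc _ = (d * m).totient * (2 / (B * d)) * m * (H / m.totient) := by
              rw [Finset.sum_div, Finset.mul_sum]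
              refine Finset.sum_congr rfl fun s hs => ?_
              have hs0 : (s : ℝ) ≠ 0 := by
                rw [Finset.mem_filter, Finset.mem_Icc] at hs
                exact_mod_cast (by omega : s ≠ 0)
              push_cast
              field_simp
          _ ≤ (d * m).totient * (2 / (B * d)) * m * (2 * (1 + 2 * Real.log (d * m : ℕ)) / m) := by
              gcongr
          _ = _ := by
              field_simp
              ring
    _ = _ := by rw [← Finset.mul_sum, ← Finset.mul_sum]

lemma exists_approx_of_notMem_Tset {q a : ℕ} (hq : q ≠ 0) {B : ℝ} (h : (a / q : ℝ) ∉ Tset B) :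
    ∃ (s : ℕ) (t : ℤ), 1 ≤ s ∧ s ≤ q ∧ t ≠ 0 ∧ s * |(t : ℝ)| * B ≤ q ∧ (q : ℤ) ∣ a * s - t := by
  simp only [Tset, Set.mem_ofPred_eq, not_forall, not_le] at h
  obtain ⟨j, hj, hb, hlt⟩ := h
  obtain ⟨s, p, hs, hne, hle⟩ := exists_approx_of_one_le_cfb hj hb
  lift s to ℕ using by omega
  have hqR : (0 : ℝ) < q := by exact_mod_cast Nat.pos_of_ne_zero hq
  have hs1 : 1 ≤ s := by omega
  have hbR : (1 : ℝ) ≤ cfb j (a / q) := by exact_mod_cast hb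
  have ht : ((a * s - p * q : ℤ) : ℝ) = q * (s * (a / q) - p) := by
    push_cast
    field_simp
  push_cast at hle hne
  have ht0 : (a * s - p * q : ℤ) ≠ 0 := fun h0 => by
    rw [h0, Int.cast_zero, zero_eq_mul] at ht
    exact ht.elim hqR.ne' hne
  have hkey : s * |((a * s - p * q : ℤ) : ℝ)| * cfb j (a / q) ≤ q := by
    rw [ht, abs_mul, abs_of_pos hqR]
    nlinarith
  refine ⟨s, a * s - p * q, hs1, ?_, ht0, le_trans ?_ hkey, ⟨p, by ring⟩⟩
  · have h1 : (1 : ℝ) ≤ |((a * s - p * q : ℤ) : ℝ)| := by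
      exact_mod_cast Int.one_le_abs ht0
    have h2 : (s : ℝ) ≤ q := by
      refine le_trans ?_ hkey
      rw [mul_assoc]
      exact le_mul_of_one_le_right (Nat.cast_nonneg s) (one_le_mul_of_one_le_of_one_le h1 hbR)
    exact_mod_cast h2
  · gcongr
    exact (le_max_left _ _).trans hlt.le

open scoped Classical in
/-- The number of `0 ≤ a < q` coprime to `q` with
`a/q ∈ 𝔗((log q)(log log q)²)` is `φ(q)(1 + o(1))` as `q → ∞`. -/
theorem stmt14 :
    Tendsto (fun q : ℕ =>
      (((Finset.range q).filter fun a : ℕ =>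
          Nat.Coprime a q ∧
            ((a : ℝ) / q) ∈ Tset (Real.log q * (Real.log (Real.log q)) ^ 2)).card : ℝ)
        / (q.totient : ℝ)) atTop (nhds 1) := by
  have hlog : Tendsto (fun q : ℕ => Real.log q) atTop atTop :=
    Real.tendsto_log_atTop.comp tendsto_natCast_atTop_atTop
  have hloglog : Tendsto (fun q : ℕ => Real.log (Real.log q)) atTop atTop :=
    Real.tendsto_log_atTop.comp hlog
  have hlower : Tendsto (fun q : ℕ => 1 - 168 / Real.log (Real.log q)) atTop (nhds 1) := by
    simpa using (hloglog.const_div_atTop 168).const_sub 1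
  refine tendsto_of_tendsto_of_tendsto_of_le_of_le' hlower tendsto_const_nhds ?_ ?_
  · filter_upwards [hlog.eventually_ge_atTop 1, hloglog.eventually_ge_atTop 1,
      eventually_ne_atTop 0] with q hx hy hq
    set B := Real.log q * (Real.log (Real.log q)) ^ 2 with hBdef
    have hB : 0 < B := by positivity
    have hφ : (0 : ℝ) < q.totient := by exact_mod_cast Nat.totient_pos.2 (Nat.pos_of_ne_zero hq)
    have hsplit : (q.totient : ℝ) =
        ((Finset.range q).filter fun a : ℕ => a.Coprime q ∧ (a / q : ℝ) ∈ Tset B).card +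
        ((Finset.range q).filter fun a : ℕ => a.Coprime q ∧ (a / q : ℝ) ∉ Tset B).card := by
      rw [← Finset.filter_filter, ← Finset.filter_filter, ← Nat.cast_add,
        Finset.card_filter_add_card_filter_not, Nat.totient_eq_card_coprime]
      simp only [Nat.coprime_comm]
    have hbad : (((Finset.range q).filter fun a : ℕ =>
        a.Coprime q ∧ (a / q : ℝ) ∉ Tset B).card : ℝ) ≤
        q.totient * (168 / Real.log (Real.log q)) := by
      refine (Nat.cast_le.2 (Finset.card_le_card (Finset.monotone_filter_right _ fun a _ ha =>
        ⟨ha.1, exists_approx_of_notMem_Tset hq ha.2⟩))).trans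
        ((card_exists_approx_le hq hB).trans ?_)
      gcongr
      calc 4 * (1 + 2 * Real.log q) / B * ∑ d ∈ q.divisors, (d : ℝ)⁻¹
          ≤ 4 * (3 * Real.log q) / B * (14 * Real.log (Real.log q)) := by
            gcongr
            · linarith
            · exact (sum_divisors_inv_le hx).trans (by linarith)
        _ = 168 / Real.log (Real.log q) := by
            rw [hBdef]
            field_simp
            norm_num
    rw [le_div_iff₀ hφ]
    linarith
  · refine Eventually.of_forall fun q => div_le_one_of_le₀ ?_ (Nat.cast_nonneg _)
    rw [Nat.totient_eq_card_coprime]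
    exact Nat.cast_le.2 (Finset.card_le_card (Finset.monotone_filter_right _ fun a _ ha =>
      ha.1.symm))
end
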